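/- (Compactness Theorem) Let 2<p<∞, let i₀>0, and let ζ₀ ∈ L^p(Π) be nontrivial, nonnegative, with compact support. Let Σ₀ be the set of maximisers of E over W(ζ₀,i₀), let M₀ be the (common) value of E on Σ₀, and suppose Σ₀ is nonempty and Σ₀ ⊂ R(ζ₀). Suppose (ζₙ) is a sequence of nonnegative functions in L^p(Π) ∩ L¹(Π) such that ζₙ^Δ → ζ₀^Δ in both L^p(0,∞) and L¹(0,∞), I(ζₙ) → i₀, and E(ζₙ) → M₀. Then there exist a subsequence (ζ_{n_k}), real numbers (τ_k), and an element ξ ∈ Σ₀ such that the translates x ↦ ζ_{n_k}(x₁ − τ_k, x₂) converge to ξ in both L^p(Π) and L¹(Π). -/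

import Mathlib

open MeasureTheory Real Filter Topology

noncomputable section

/-- The open upper half-plane Π. -/
def UHP : Set (ℝ × ℝ) := {x | 0 < x.2}

/-- Planar Lebesgue measure restricted to the upper half-plane. -/
def μUH : Measure (ℝ × ℝ) := MeasureTheory.volume.restrict UHP

/-- Squared Euclidean distance in the plane. -/
def sqdist (x y : ℝ × ℝ) : ℝ := (x.1 - y.1) ^ 2 + (x.2 - y.2) ^ 2

/-- Euclidean distance in the plane. -/
def euclDist (x y : ℝ × ℝ) : ℝ := Real.sqrt (sqdist x y)

/-- The Green's function of −Δ in the upper half-plane: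
`G(x,y) = (1/(4π)) log(1 + 4 x₂ y₂ / |x−y|²)`. -/
def greenG (x y : ℝ × ℝ) : ℝ :=
  (4 * π)⁻¹ * Real.log (1 + 4 * x.2 * y.2 / sqdist x y)

/-- The stream-function operator `𝒢ζ(x) = ∫_Π G(x,y) ζ(y) dy`. -/
def Gop (ζ : ℝ × ℝ → ℝ) (x : ℝ × ℝ) : ℝ := ∫ y, greenG x y * ζ y ∂μUH

/-- Kinetic energy `E(ζ) = (1/2) ∫_Π ζ 𝒢ζ`. -/
def energy (ζ : ℝ × ℝ → ℝ) : ℝ := (1 / 2) * ∫ x, ζ x * Gop ζ x ∂μUH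

/-- Impulse `I(ζ) = ∫_Π ζ(y) y₂ dy`. -/
def impulse (ζ : ℝ × ℝ → ℝ) : ℝ := ∫ y, ζ y * y.2 ∂μUH

/-- The `L^p(Π)` norm, as a real number. -/
def lpN (p : ℝ) (ζ : ℝ × ℝ → ℝ) : ℝ := (eLpNorm ζ (ENNReal.ofReal p) μUH).toReal

/-- `f ⪯ g` : `∫ (f−a)₊ ≤ ∫ (g−a)₊` for every `a > 0`. -/
def prec (f g : ℝ × ℝ → ℝ) : Prop :=
  ∀ a : ℝ, 0 < a → ∫ x, max (f x - a) 0 ∂μUH ≤ ∫ x, max (g x - a) 0 ∂μUH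

/-- `f` is a rearrangement of `g` on Π. -/
def IsRearr (f g : ℝ × ℝ → ℝ) : Prop :=
  ∀ a : ℝ, 0 < a → μUH {x | a < f x} = μUH {x | a < g x}

/-- Membership of the relaxed constraint class `𝒲(ζ₀)`. -/
def memW (ζ₀ ζ : ℝ × ℝ → ℝ) : Prop :=
  (∀ x, 0 ≤ ζ x) ∧ Integrable ζ μUH ∧ prec ζ ζ₀

/-- `𝒲(ζ₀, ≤ i₀)`. -/
def Wle (ζ₀ : ℝ × ℝ → ℝ) (i₀ : ℝ) : Set (ℝ × ℝ → ℝ) :=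
  {ζ | memW ζ₀ ζ ∧ impulse ζ ≤ i₀}

/-- `𝒲(ζ₀, i₀)`. -/
def Weq (ζ₀ : ℝ × ℝ → ℝ) (i₀ : ℝ) : Set (ℝ × ℝ → ℝ) :=
  {ζ | memW ζ₀ ζ ∧ impulse ζ = i₀}

/-- Membership of `ℛ⁺(ζ₀)`: restrictions of rearrangements of `ζ₀`. -/
def memRplus (ζ₀ ζ : ℝ × ℝ → ℝ) : Prop :=
  ∃ ξ : ℝ × ℝ → ℝ, ∃ A : Set (ℝ × ℝ), IsRearr ξ ζ₀ ∧ MeasurableSet A ∧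
    ζ = A.indicator ξ

/-- Steiner symmetry about the `x₂`-axis. -/
def SteinerSym (ζ : ℝ × ℝ → ℝ) : Prop :=
  ∀ᵐ t ∂(MeasureTheory.volume.restrict (Set.Ioi (0 : ℝ))),
    (∀ s : ℝ, ζ (-s, t) = ζ (s, t)) ∧
    (∀ s₁ s₂ : ℝ, 0 ≤ s₁ → s₁ ≤ s₂ → ζ (s₂, t) ≤ ζ (s₁, t))

/-- The decreasing rearrangement `ζ^Δ(s) = inf {a > 0 : |{ζ > a}| ≤ s}`. -/
def decRearr (ζ : ℝ × ℝ → ℝ) (s : ℝ) : ℝ :=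
  sInf {a : ℝ | 0 < a ∧ μUH {x | a < ζ x} ≤ ENNReal.ofReal s}

/-- The norm `‖ζ‖_{𝔛^p} = |I(ζ)| + ‖ζ‖₁ + ‖ζ‖_p`. -/
def XpNorm (p : ℝ) (ζ : ℝ × ℝ → ℝ) : ℝ := |impulse ζ| + lpN 1 ζ + lpN p ζ

/-- Distance to a set of functions in the `𝔛^p` norm. -/
def XpDist (p : ℝ) (ζ : ℝ × ℝ → ℝ) (S : Set (ℝ × ℝ → ℝ)) : ℝ :=
  sInf ((fun σ => XpNorm p fun x => ζ x - σ x) '' S)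


section Helpers
open scoped ENNReal NNReal


theorem sqdist_nonneg (x y : ℝ × ℝ) : 0 ≤ sqdist x y := by unfold sqdist; positivity

theorem sqdist_comm (x y : ℝ × ℝ) : sqdist x y = sqdist y x := by unfold sqdist; ring

theorem sqdist_pos {x y : ℝ × ℝ} (h : x ≠ y) : 0 < sqdist x y := by
  rcases (sqdist_nonneg x y).lt_or_eq with h1 | h1
  · exact h1
  · exfalso
    unfold sqdist at h1
    have h2 : (x.1 - y.1) ^ 2 = 0 := by nlinarith [sq_nonneg (x.1 - y.1), sq_nonneg (x.2 - y.2)]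
    have h3 : (x.2 - y.2) ^ 2 = 0 := by nlinarith [sq_nonneg (x.1 - y.1), sq_nonneg (x.2 - y.2)]
    apply h
    ext
    · have := pow_eq_zero_iff (two_ne_zero) |>.1 h2; linarith
    · have := pow_eq_zero_iff (two_ne_zero) |>.1 h3; linarith

theorem euclDist_nonneg (x y : ℝ × ℝ) : 0 ≤ euclDist x y := Real.sqrt_nonneg _

theorem euclDist_comm (x y : ℝ × ℝ) : euclDist x y = euclDist y x := by
  unfold euclDist; rw [sqdist_comm]

theorem euclDist_sq (x y : ℝ × ℝ) : euclDist x y ^ 2 = sqdist x y :=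
  Real.sq_sqrt (sqdist_nonneg x y)

theorem abs_sub_fst_le_euclDist (x y : ℝ × ℝ) : |x.1 - y.1| ≤ euclDist x y := by
  unfold euclDist
  apply Real.abs_le_sqrt
  unfold sqdist; nlinarith [sq_nonneg (x.2 - y.2)]

theorem abs_sub_snd_le_euclDist (x y : ℝ × ℝ) : |x.2 - y.2| ≤ euclDist x y := by
  unfold euclDist
  apply Real.abs_le_sqrt
  unfold sqdist; nlinarith [sq_nonneg (x.1 - y.1)]

theorem greenG_nonneg {x y : ℝ × ℝ} (hx : 0 < x.2) (hy : 0 < y.2) : 0 ≤ greenG x y := by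
  unfold greenG
  apply mul_nonneg (by positivity)
  apply Real.log_nonneg
  have : 0 ≤ 4 * x.2 * y.2 / sqdist x y := div_nonneg (by positivity) (sqdist_nonneg _ _)
  linarith

theorem greenG_pos {x y : ℝ × ℝ} (hx : 0 < x.2) (hy : 0 < y.2) (h : x ≠ y) : 0 < greenG x y := by
  unfold greenG
  apply mul_pos (by positivity)
  apply Real.log_pos
  have : 0 < 4 * x.2 * y.2 / sqdist x y := div_pos (by positivity) (sqdist_pos h)
  linarith

theorem greenG_comm (x y : ℝ × ℝ) : greenG x y = greenG y x := by
  unfold greenG; rw [sqdist_comm]; ring_nf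

theorem greenG_le {x y : ℝ × ℝ} (hx : 0 < x.2) (hy : 0 < y.2) :
    greenG x y ≤ x.2 * (1 / euclDist x y) := by
  by_cases h : x = y
  · subst h
    simp [greenG, euclDist, sqdist]
  · have hs := sqdist_pos h
    have hd : 0 < euclDist x y := Real.sqrt_pos.2 hs
    unfold greenG
    rw [← euclDist_sq]
    set d := euclDist x y with hd'
    have hyx : y.2 ≤ x.2 + d := by
      have := abs_sub_snd_le_euclDist x y
      have := (abs_le.1 this).1
      linarith
    have h1 : 1 + 4 * x.2 * y.2 / d ^ 2 ≤ (1 + 2 * (x.2 * (1 / d))) ^ 2 := by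
      have : 4 * x.2 * y.2 / d ^ 2 ≤ 4 * x.2 * (x.2 + d) / d ^ 2 := by gcongr
      have h2 : 4 * x.2 * (x.2 + d) / d ^ 2 = 4 * (x.2 * (1/d))^2 + 4 * (x.2 * (1/d)) := by
        field_simp
      nlinarith
    have hpos : 0 < 1 + 4 * x.2 * y.2 / d ^ 2 := by positivity
    have h3 : Real.log (1 + 4 * x.2 * y.2 / d ^ 2) ≤ 4 * (x.2 * (1/d)) := by
      calc _ ≤ Real.log ((1 + 2 * (x.2 * (1 / d))) ^ 2) := Real.log_le_log hpos h1
        _ = 2 * Real.log (1 + 2 * (x.2 * (1 / d))) := by rw [Real.log_pow]; norm_num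
        _ ≤ 2 * (2 * (x.2 * (1/d))) := by
            have : Real.log (1 + 2 * (x.2 * (1 / d))) ≤ (1 + 2 * (x.2 * (1 / d))) - 1 :=
              Real.log_le_sub_one_of_pos (by positivity)
            linarith
        _ = _ := by ring
    have hpi : (4 * π)⁻¹ ≤ 4⁻¹ := by
      apply inv_anti₀ (by norm_num)
      nlinarith [Real.pi_gt_three]
    have h4 : 0 ≤ x.2 * (1/d) := by positivity
    calc _ ≤ (4 * π)⁻¹ * (4 * (x.2 * (1/d))) := by gcongr
      _ ≤ 4⁻¹ * (4 * (x.2 * (1/d))) := by gcongr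
      _ = _ := by ring

theorem greenG_le' {x y : ℝ × ℝ} (hx : 0 < x.2) (hy : 0 < y.2) :
    greenG x y ≤ y.2 * (1 / euclDist x y) := by
  rw [greenG_comm, euclDist_comm]; exact greenG_le hy hx

theorem greenG_anti {x y x' y' : ℝ × ℝ} (hx : 0 < x.2) (hy : 0 < y.2) (hx' : x'.2 = x.2)
    (hy' : y'.2 = y.2) (h : |x.1 - y.1| ≤ |x'.1 - y'.1|) (hne : x ≠ y) :
    greenG x' y' ≤ greenG x y := by
  have hs := sqdist_pos hne
  have h2 : sqdist x y ≤ sqdist x' y' := by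
    unfold sqdist; rw [hx', hy']
    have := sq_le_sq.2 h
    linarith
  unfold greenG; rw [hx', hy']
  have : 0 ≤ 4 * x.2 * y.2 / sqdist x' y' := div_nonneg (by positivity) (sqdist_nonneg _ _)
  gcongr

theorem greenG_strict {x y x' y' : ℝ × ℝ} (hx : 0 < x.2) (hy : 0 < y.2) (hx' : x'.2 = x.2)
    (hy' : y'.2 = y.2) (h : |x.1 - y.1| < |x'.1 - y'.1|) (hne : x ≠ y) :
    greenG x' y' < greenG x y := by
  have hs := sqdist_pos hne
  have h2 : sqdist x y < sqdist x' y' := by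
    unfold sqdist; rw [hx', hy']
    have := sq_lt_sq.2 h
    linarith
  unfold greenG; rw [hx', hy']
  have : 0 ≤ 4 * x.2 * y.2 / sqdist x' y' := div_nonneg (by positivity) (sqdist_nonneg _ _)
  have hp : (0:ℝ) < (4 * π)⁻¹ := by positivity
  gcongr

/-- upward shift -/
def up (s : ℝ) (x : ℝ × ℝ) : ℝ × ℝ := (x.1, x.2 + s)

theorem sqdist_up (s : ℝ) (x y : ℝ × ℝ) : sqdist (up s x) (up s y) = sqdist x y := by
  unfold sqdist up; simp

theorem greenG_up_mono {x y : ℝ × ℝ} (hx : 0 < x.2) (hy : 0 < y.2) {s t : ℝ} (hs : 0 ≤ s)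
    (hst : s ≤ t) : greenG (up s x) (up s y) ≤ greenG (up t x) (up t y) := by
  unfold greenG; rw [sqdist_up, sqdist_up]
  simp only [up]
  have h1 := sqdist_nonneg x y
  have : 0 ≤ 4 * (x.2+s) * (y.2+s) / sqdist x y := div_nonneg (by positivity) h1
  have ht : 0 ≤ t := hs.trans hst
  have : 0 ≤ 4 * (x.2 + t) := by positivity
  gcongr

theorem log_half {u : ℝ} (h0 : 0 ≤ u) (h1 : u ≤ 1) : u / 2 ≤ Real.log (1 + u) := by
  have h2 : 1 - (1 + u)⁻¹ ≤ Real.log (1+u) := Real.one_sub_inv_le_log_of_pos (by linarith)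
  have h3 : u / 2 ≤ 1 - (1+u)⁻¹ := by
    have : 1 - (1+u)⁻¹ = u / (1+u) := by field_simp; ring
    rw [this]
    apply div_le_div_of_nonneg_left h0 (by linarith) (by linarith)
  linarith

/-- the truncation set -/
def TSet (r H : ℝ) (x y : ℝ × ℝ) : Prop :=
  r ≤ euclDist x y ∧ |x.1 - y.1| ≤ H ∧ x.2 ≤ H ∧ y.2 ≤ H

theorem greenG_gain {x y : ℝ × ℝ} (hx : 0 < x.2) (hy : 0 < y.2) {r H s : ℝ} (hr : 0 < r)
    (hH : 1 ≤ H) (hs : 0 ≤ s) (hs1 : s ≤ 1) (hT : TSet r H x y) :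
    greenG x y + s * (r / (40 * H ^ 2)) * greenG x y ≤ greenG (up s x) (up s y) := by
  obtain ⟨h1, h2, h3, h4⟩ := hT
  have hd : 0 < euclDist x y := by linarith
  have hsq : 0 < sqdist x y := by rw [← euclDist_sq]; positivity
  have hG : greenG x y ≤ x.2 * (1 / r) := (greenG_le hx hy).trans (by gcongr)
  set u : ℝ := 4 * s * x.2 / (5 * H^2) with hu
  have hu0 : 0 ≤ u := by positivity
  have hu1 : u ≤ 1 := by
    rw [hu, div_le_one (by positivity)]
    nlinarith [mul_le_mul hs1 h3 hx.le zero_le_one]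
  have hlog := log_half hu0 hu1
  have hkey : (1 + 4 * x.2 * y.2 / sqdist x y) * (1 + u) ≤
      1 + 4 * (x.2 + s) * (y.2 + s) / sqdist x y := by
    have hD : sqdist x y + 4 * x.2 * y.2 ≤ 5 * H^2 := by
      have ha := sq_le_sq' (abs_le.1 h2).1 (abs_le.1 h2).2
      unfold sqdist
      nlinarith [mul_self_nonneg (x.2 - y.2), mul_le_mul h3 h4 hy.le (by linarith)]
    have e1 : (1 + 4 * x.2 * y.2 / sqdist x y) * (1 + u) =
       (sqdist x y + 4 * x.2 * y.2 + (sqdist x y + 4 * x.2 * y.2) * u) / sqdist x y := by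
      field_simp
    have e2 : 1 + 4 * (x.2 + s) * (y.2 + s) / sqdist x y =
       (sqdist x y + 4 * (x.2 + s) * (y.2 + s)) / sqdist x y := by field_simp
    rw [e1, e2]
    have e3 : (sqdist x y + 4 * x.2 * y.2) * u ≤ 4 * s * x.2 := by
      calc _ ≤ 5 * H^2 * u := by gcongr
        _ = 4 * s * x.2 := by rw [hu]; field_simp
    apply div_le_div_of_nonneg_right _ hsq.le
    nlinarith [mul_nonneg hs hy.le, mul_nonneg hs hs]
  have hb : 0 < 1 + 4 * x.2 * y.2 / sqdist x y := by positivity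
  have hfin : Real.log (1 + 4 * x.2 * y.2 / sqdist x y) + u / 2 ≤
      Real.log (1 + 4 * (x.2 + s) * (y.2 + s) / sqdist x y) := by
    calc _ ≤ Real.log (1 + 4 * x.2 * y.2 / sqdist x y) + Real.log (1 + u) := by linarith
      _ = Real.log ((1 + 4 * x.2 * y.2 / sqdist x y) * (1 + u)) := by
          rw [Real.log_mul hb.ne' (by positivity)]
      _ ≤ _ := Real.log_le_log (by positivity) hkey
  have e4 : greenG (up s x) (up s y) =
      (4 * π)⁻¹ * Real.log (1 + 4 * (x.2 + s) * (y.2 + s) / sqdist x y) := by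
    unfold greenG; rw [sqdist_up]; simp [up]
  rw [e4]
  have e5 : greenG x y + (4*π)⁻¹ * (u/2) ≤
      (4 * π)⁻¹ * Real.log (1 + 4 * (x.2 + s) * (y.2 + s) / sqdist x y) := by
    have := mul_le_mul_of_nonneg_left hfin (show (0:ℝ) ≤ (4*π)⁻¹ by positivity)
    rw [mul_add] at this
    exact this
  refine le_trans ?_ e5
  have e6 : s * (r / (40 * H ^ 2)) * greenG x y ≤ s * (r / (40 * H ^ 2)) * (x.2 * (1/r)) := by
    gcongr
  have e7 : s * (r / (40 * H ^ 2)) * (x.2 * (1/r)) = s * x.2 / (40 * H^2) := by field_simp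
  have hpi : (16:ℝ)⁻¹ ≤ (4 * π)⁻¹ := by
    apply inv_anti₀ (by positivity)
    nlinarith [Real.pi_lt_four]
  have e8 : (16:ℝ)⁻¹ * (u/2) ≤ (4*π)⁻¹ * (u/2) := by gcongr
  have e9 : s * x.2 / (40 * H^2) = (16:ℝ)⁻¹ * (u/2) := by
    rw [hu]; field_simp; ring
  linarith

theorem measurable_sqdist : Measurable (fun z : (ℝ × ℝ) × (ℝ × ℝ) => sqdist z.1 z.2) := by
  unfold sqdist; fun_prop

theorem measurable_euclDist : Measurable (fun z : (ℝ × ℝ) × (ℝ × ℝ) => euclDist z.1 z.2) := by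
  unfold euclDist; exact measurable_sqdist.sqrt

theorem measurable_greenG : Measurable (fun z : (ℝ × ℝ) × (ℝ × ℝ) => greenG z.1 z.2) := by
  unfold greenG
  have := measurable_sqdist
  fun_prop

theorem measurableSet_UHP : MeasurableSet UHP := measurableSet_lt measurable_const measurable_snd

theorem ae_UHP : ∀ᵐ x ∂μUH, 0 < x.2 := ae_restrict_mem measurableSet_UHP

/-- the Green kernel, extended-real valued -/
def gE (x y : ℝ × ℝ) : ℝ≥0∞ := ENNReal.ofReal (greenG x y)

/-- truncated inverse distance -/
def pK (r : ℝ) (x y : ℝ × ℝ) : ℝ≥0∞ :=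
  if euclDist x y < r then ENNReal.ofReal (1 / euclDist x y) else 0

theorem measurable_gE : Measurable (fun z : (ℝ × ℝ) × (ℝ × ℝ) => gE z.1 z.2) :=
  measurable_greenG.ennreal_ofReal

theorem measurable_pK (r : ℝ) : Measurable (fun z : (ℝ × ℝ) × (ℝ × ℝ) => pK r z.1 z.2) := by
  unfold pK
  refine Measurable.ite (measurableSet_lt measurable_euclDist measurable_const) ?_ measurable_const
  exact (measurable_const.div measurable_euclDist).ennreal_ofReal

theorem measurableSet_TSet (r H : ℝ) :
    MeasurableSet {z : (ℝ × ℝ) × (ℝ × ℝ) | TSet r H z.1 z.2} := by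
  simp only [TSet, Set.ofPred_and]
  refine (measurableSet_le measurable_const measurable_euclDist).inter
    ((measurableSet_le ?_ measurable_const).inter
    ((measurableSet_le ?_ measurable_const).inter (measurableSet_le ?_ measurable_const))) <;>
    fun_prop

open Classical in
/-- truncated Green kernel -/
def gT (r H : ℝ) (x y : ℝ × ℝ) : ℝ≥0∞ := if TSet r H x y then gE x y else 0

theorem measurable_gT (r H : ℝ) : Measurable (fun z : (ℝ × ℝ) × (ℝ × ℝ) => gT r H z.1 z.2) := by
  unfold gT
  exact Measurable.ite (measurableSet_TSet r H) measurable_gE measurable_const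

theorem gE_le_trunc {x y : ℝ × ℝ} (hx : 0 < x.2) (hy : 0 < y.2) {r H : ℝ} (hr : 0 < r)
    (hH : 0 < H) : gE x y ≤ gT r H x y + ENNReal.ofReal x.2 * pK r x y
      + ENNReal.ofReal x.2 * ENNReal.ofReal (1 / H)
      + ENNReal.ofReal x.2 * ENNReal.ofReal (1 / (r * H)) * ENNReal.ofReal y.2 := by
  by_cases hT : TSet r H x y
  · have : gT r H x y = gE x y := by simp [gT, hT]
    rw [this]
    refine le_trans ?_ le_self_add
    refine le_trans ?_ le_self_add
    exact le_self_add
  by_cases h1 : euclDist x y < r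
  · have h2 : gE x y ≤ ENNReal.ofReal x.2 * pK r x y := by
      simp only [pK, h1, if_true, gE]
      rw [← ENNReal.ofReal_mul hx.le]
      exact ENNReal.ofReal_le_ofReal (greenG_le hx hy)
    refine le_trans ?_ le_self_add
    refine le_trans ?_ le_self_add
    exact h2.trans le_add_self
  push Not at h1
  have hd : 0 < euclDist x y := by linarith
  by_cases h2 : H < |x.1 - y.1|
  · have h3 : gE x y ≤ ENNReal.ofReal x.2 * ENNReal.ofReal (1 / H) := by
      rw [← ENNReal.ofReal_mul hx.le]
      refine ENNReal.ofReal_le_ofReal ((greenG_le hx hy).trans ?_)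
      have := abs_sub_fst_le_euclDist x y
      have h5 : H ≤ euclDist x y := by linarith
      gcongr
    refine le_trans ?_ le_self_add
    exact h3.trans le_add_self
  · have h3 : gE x y ≤ ENNReal.ofReal x.2 * ENNReal.ofReal (1 / (r * H)) * ENNReal.ofReal y.2 := by
      rw [← ENNReal.ofReal_mul hx.le, ← ENNReal.ofReal_mul (by positivity)]
      apply ENNReal.ofReal_le_ofReal
      have e : x.2 * (1 / (r * H)) * y.2 = (x.2 / H) * (y.2 / H) * (H * (1 / r)) := by field_simp
      have h4 : H < x.2 ∨ H < y.2 := by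
        unfold TSet at hT
        push Not at h2
        by_contra hc
        push Not at hc
        exact hT ⟨h1, h2, hc.1, hc.2⟩
      rcases h4 with h4 | h4
      · calc _ ≤ y.2 * (1 / euclDist x y) := greenG_le' hx hy
          _ ≤ y.2 * (1 / r) := by gcongr
          _ = 1 * (1 / r) * y.2 := by ring
          _ ≤ (x.2 / H) * (1 / r) * y.2 := by
            have : 1 ≤ x.2 / H := by rw [le_div_iff₀ hH]; linarith
            gcongr
          _ = _ := by field_simp
      · calc _ ≤ x.2 * (1 / euclDist x y) := greenG_le hx hy
          _ ≤ x.2 * (1 / r) := by gcongr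
          _ = x.2 * (1 / r) * 1 := by ring
          _ ≤ x.2 * (1 / r) * (y.2 / H) := by
            have : 1 ≤ y.2 / H := by rw [le_div_iff₀ hH]; linarith
            gcongr
          _ = _ := by field_simp
    exact h3.trans le_add_self

theorem gT_le {x y : ℝ × ℝ} (hx : 0 < x.2) (hy : 0 < y.2) {r H : ℝ} (hr : 0 < r)
    (hH : 0 < H) : gT r H x y ≤ ENNReal.ofReal (H / r) := by
  unfold gT
  split_ifs with hT
  · apply ENNReal.ofReal_le_ofReal
    obtain ⟨h1, h2, h3, h4⟩ := hT
    have hd : 0 < euclDist x y := by linarith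
    calc _ ≤ x.2 * (1 / euclDist x y) := greenG_le hx hy
      _ ≤ H * (1 / r) := by gcongr
      _ = _ := by ring
  · exact zero_le

/-- pointwise bound used outside of the heavy cells -/
theorem gE_le_out {x y : ℝ × ℝ} (hx : 0 < x.2) (hy : 0 < y.2) {r R : ℝ} (hr : 0 < r)
    (hR : 0 < R) : gE x y ≤ ENNReal.ofReal x.2 * (pK r x y
      + (if |x.1 - y.1| < R then ENNReal.ofReal (1 / r) else 0) + ENNReal.ofReal (1 / R)) := by
  have h0 : gE x y ≤ ENNReal.ofReal x.2 * ENNReal.ofReal (1 / euclDist x y) := by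
    rw [← ENNReal.ofReal_mul hx.le]
    exact ENNReal.ofReal_le_ofReal (greenG_le hx hy)
  refine h0.trans ?_
  gcongr
  by_cases h1 : euclDist x y < r
  · simp only [pK, h1, if_true]
    rw [add_assoc]; exact le_self_add
  push Not at h1
  have hd : 0 < euclDist x y := by linarith
  by_cases h2 : |x.1 - y.1| < R
  · simp only [h2, if_true]
    refine le_trans ?_ le_self_add
    refine le_trans ?_ le_add_self
    exact ENNReal.ofReal_le_ofReal (by gcongr)
  · refine le_trans ?_ le_add_self
    apply ENNReal.ofReal_le_ofReal
    have := abs_sub_fst_le_euclDist x y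
    have h5 : R ≤ euclDist x y := by linarith
    gcongr


instance : SigmaFinite μUH := by unfold μUH; infer_instance
instance : SFinite μUH := by unfold μUH; infer_instance

/-- quadratic form with kernel `K` -/
def BK (K : ℝ × ℝ → ℝ × ℝ → ℝ≥0∞) (f : ℝ × ℝ → ℝ≥0∞) : ℝ≥0∞ :=
  ∫⁻ x, f x * (∫⁻ y, K x y * f y ∂μUH) ∂μUH

structure Good (ω : ℝ → ℝ≥0∞) (C : ℝ≥0∞) (f : ℝ × ℝ → ℝ≥0∞) : Prop where
  meas : Measurable f
  mass : ∫⁻ y, f y ∂μUH ≤ C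
  imp : ∫⁻ y, f y * ENNReal.ofReal y.2 ∂μUH ≤ C
  pot : ∀ r > 0, ∀ x, ∫⁻ y, pK r x y * f y ∂μUH ≤ ω r

theorem measurable_slice {K : ℝ × ℝ → ℝ × ℝ → ℝ≥0∞}
    (hK : Measurable (fun z : (ℝ × ℝ) × (ℝ × ℝ) => K z.1 z.2)) (x : ℝ × ℝ) :
    Measurable (fun y => K x y) := hK.comp measurable_prodMk_left

theorem measurable_inner {K : ℝ × ℝ → ℝ × ℝ → ℝ≥0∞} {f : ℝ × ℝ → ℝ≥0∞}
    (hK : Measurable (fun z : (ℝ × ℝ) × (ℝ × ℝ) => K z.1 z.2)) (hf : Measurable f) :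
    Measurable (fun x => ∫⁻ y, K x y * f y ∂μUH) := by
  have : Measurable (fun z : (ℝ × ℝ) × (ℝ × ℝ) => K z.1 z.2 * f z.2) :=
    hK.mul (hf.comp measurable_snd)
  exact this.lintegral_prod_right'

theorem measurable_Kf {K : ℝ × ℝ → ℝ × ℝ → ℝ≥0∞} {f : ℝ × ℝ → ℝ≥0∞}
    (hK : Measurable (fun z : (ℝ × ℝ) × (ℝ × ℝ) => K z.1 z.2)) (hf : Measurable f) (x : ℝ × ℝ) :
    Measurable (fun y => K x y * f y) := (measurable_slice hK x).mul hf

theorem measurable_fK {K : ℝ × ℝ → ℝ × ℝ → ℝ≥0∞} {f : ℝ × ℝ → ℝ≥0∞}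
    (hK : Measurable (fun z : (ℝ × ℝ) × (ℝ × ℝ) => K z.1 z.2)) (hf : Measurable f) :
    Measurable (fun x => f x * ∫⁻ y, K x y * f y ∂μUH) := hf.mul (measurable_inner hK hf)

theorem BK_mono {K K' : ℝ × ℝ → ℝ × ℝ → ℝ≥0∞} {f f' : ℝ × ℝ → ℝ≥0∞}
    (hK : ∀ x y, 0 < x.2 → 0 < y.2 → K x y ≤ K' x y) (hf : ∀ x, f x ≤ f' x) :
    BK K f ≤ BK K' f' := by
  unfold BK
  apply lintegral_mono_ae
  filter_upwards [ae_UHP] with x hx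
  gcongr ?_ * ?_
  · exact hf x
  apply lintegral_mono_ae
  filter_upwards [ae_UHP] with y hy
  gcongr ?_ * ?_
  · exact hK x y hx hy
  · exact hf y

theorem BK_add {K K' : ℝ × ℝ → ℝ × ℝ → ℝ≥0∞} {f : ℝ × ℝ → ℝ≥0∞}
    (hK : Measurable (fun z : (ℝ × ℝ) × (ℝ × ℝ) => K z.1 z.2)) (hf : Measurable f) :
    BK (fun x y => K x y + K' x y) f = BK K f + BK K' f := by
  unfold BK
  rw [← lintegral_add_left]
  · congr 1
    ext x
    rw [← mul_add, ← lintegral_add_left (measurable_Kf hK hf x)]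
    congr 2
    ext y
    rw [add_mul]
  · exact measurable_fK hK hf

theorem BK_const_mul {K : ℝ × ℝ → ℝ × ℝ → ℝ≥0∞} {f : ℝ × ℝ → ℝ≥0∞} (c : ℝ≥0∞)
    (hK : Measurable (fun z : (ℝ × ℝ) × (ℝ × ℝ) => K z.1 z.2)) (hf : Measurable f) :
    BK (fun x y => c * K x y) f = c * BK K f := by
  unfold BK
  rw [← lintegral_const_mul _ (measurable_fK hK hf)]
  congr 1
  ext x
  rw [mul_left_comm, ← lintegral_const_mul _ (measurable_Kf hK hf x)]
  congr 2
  ext y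
  rw [mul_assoc]

section
variable {ω : ℝ → ℝ≥0∞} {C : ℝ≥0∞} {f : ℝ × ℝ → ℝ≥0∞}

theorem Good.BK_trunc (h : Good ω C f) {r H : ℝ} (hr : 0 < r) (hH : 0 < H) :
    BK gE f ≤ BK (gT r H) f + C * (ω r + ENNReal.ofReal (1 / H) * C
      + ENNReal.ofReal (1 / (r * H)) * C) := by
  have hm := h.meas
  have h1 : ∀ x : ℝ × ℝ, 0 < x.2 → ∫⁻ y, gE x y * f y ∂μUH ≤ ∫⁻ y, gT r H x y * f y ∂μUH +
      ENNReal.ofReal x.2 * (ω r + ENNReal.ofReal (1 / H) * C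
      + ENNReal.ofReal (1 / (r * H)) * C) := by
    intro x hx
    calc ∫⁻ y, gE x y * f y ∂μUH ≤ ∫⁻ y, (gT r H x y * f y + ENNReal.ofReal x.2 * ((pK r x y * f y +
          ENNReal.ofReal (1 / H) * f y) + ENNReal.ofReal (1 / (r * H)) *
            (f y * ENNReal.ofReal y.2))) ∂μUH := by
          apply lintegral_mono_ae
          filter_upwards [ae_UHP] with y hy
          calc _ ≤ _ := mul_le_mul_left (gE_le_trunc hx hy hr hH) (f y)
            _ = _ := by ring
      _ = ∫⁻ y, gT r H x y * f y ∂μUH + ENNReal.ofReal x.2 * ((∫⁻ y, pK r x y * f y ∂μUH +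
          ENNReal.ofReal (1 / H) * ∫⁻ y, f y ∂μUH) + ENNReal.ofReal (1 / (r * H)) *
            ∫⁻ y, (f y * ENNReal.ofReal y.2) ∂μUH) := by
          have m1 := measurable_slice (measurable_gT r H) x
          have m2 := measurable_slice (measurable_pK r) x
          rw [lintegral_add_left (by fun_prop), lintegral_const_mul _ (by fun_prop),
            lintegral_add_left (by fun_prop), lintegral_add_left (by fun_prop),
            lintegral_const_mul _ (by fun_prop), lintegral_const_mul _ (by fun_prop)]
      _ ≤ _ := by
          gcongr
          · exact h.pot r hr x
          · exact h.mass
          · exact h.imp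
  set D := (ω r + ENNReal.ofReal (1 / H) * C + ENNReal.ofReal (1 / (r * H)) * C)
  calc BK gE f ≤ ∫⁻ x, (f x * (∫⁻ y, gT r H x y * f y ∂μUH) + (f x * ENNReal.ofReal x.2) * D) ∂μUH := by
        apply lintegral_mono_ae
        filter_upwards [ae_UHP] with x hx
        rw [mul_assoc, ← mul_add]
        gcongr
        exact h1 x hx
    _ = BK (gT r H) f + (∫⁻ x, (f x * ENNReal.ofReal x.2) ∂μUH) * D := by
        rw [lintegral_add_left (measurable_fK (measurable_gT r H) hm),
          lintegral_mul_const _ (by fun_prop)]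
        rfl
    _ ≤ _ := by gcongr; exact h.imp

theorem Good.Gop_le (h : Good ω C f) {x : ℝ × ℝ} (hx : 0 < x.2) {r R : ℝ} (hr : 0 < r)
    (hR : 0 < R) : ∫⁻ y, gE x y * f y ∂μUH ≤ ENNReal.ofReal x.2 * (ω r +
      ENNReal.ofReal (1 / r) * ∫⁻ y in {y | |x.1 - y.1| < R}, f y ∂μUH
      + ENNReal.ofReal (1 / R) * C) := by
  have hm := h.meas
  have hs : MeasurableSet {y : ℝ × ℝ | |x.1 - y.1| < R} :=
    measurableSet_lt (by fun_prop) measurable_const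
  calc ∫⁻ y, gE x y * f y ∂μUH ≤ ∫⁻ y, ENNReal.ofReal x.2 * ((pK r x y * f y +
        ENNReal.ofReal (1/r) * ({y | |x.1 - y.1| < R}.indicator f y)) +
          ENNReal.ofReal (1 / R) * f y) ∂μUH := by
        apply lintegral_mono_ae
        filter_upwards [ae_UHP] with y hy
        calc _ ≤ _ := mul_le_mul_left (gE_le_out hx hy hr hR) (f y)
          _ = _ := by
            by_cases hy : |x.1 - y.1| < R
            · simp only [hy, if_true, Set.indicator, Set.mem_ofPred_eq]; ring
            · simp only [hy, if_false, Set.indicator, Set.mem_ofPred_eq]; ring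
    _ = ENNReal.ofReal x.2 * ((∫⁻ y, pK r x y * f y ∂μUH +
        ENNReal.ofReal (1/r) * ∫⁻ y, ({y | |x.1 - y.1| < R}.indicator f y) ∂μUH) +
          ENNReal.ofReal (1 / R) * ∫⁻ y, f y ∂μUH) := by
          have m2 := measurable_slice (measurable_pK r) x
          have m3 := hm.indicator hs
          rw [lintegral_const_mul _ (by fun_prop),
            lintegral_add_left (by fun_prop), lintegral_add_left (by fun_prop),
            lintegral_const_mul _ (by fun_prop), lintegral_const_mul _ (by fun_prop)]
    _ ≤ _ := by
      rw [lintegral_indicator hs]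
      gcongr
      · exact h.pot r hr x
      · exact h.mass

theorem Good.Gop_le' (h : Good ω C f) {x : ℝ × ℝ} (hx : 0 < x.2) :
    ∫⁻ y, gE x y * f y ∂μUH ≤ ENNReal.ofReal x.2 * (ω 1 + 2 * C) := by
  refine (h.Gop_le hx one_pos one_pos).trans ?_
  rw [two_mul, add_assoc]
  simp only [div_one, ENNReal.ofReal_one, one_mul]
  gcongr
  exact (setLIntegral_le_lintegral _ _).trans h.mass

theorem Good.BK_le (h : Good ω C f) : BK gE f ≤ C * (ω 1 + 2 * C) := by
  calc BK gE f ≤ ∫⁻ x, (f x * ENNReal.ofReal x.2) * (ω 1 + 2 * C) ∂μUH := by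
        apply lintegral_mono_ae
        filter_upwards [ae_UHP] with x hx
        rw [mul_assoc]
        gcongr
        exact h.Gop_le' hx
    _ = (∫⁻ x, (f x * ENNReal.ofReal x.2) ∂μUH) * (ω 1 + 2 * C) := by
        have := h.meas
        rw [lintegral_mul_const _ (by fun_prop)]
    _ ≤ _ := by gcongr; exact h.imp

theorem Good.BK_lt_top (h : Good ω C f) (hω : ω 1 ≠ ⊤) (hC : C ≠ ⊤) : BK gE f < ⊤ :=
  h.BK_le.trans_lt (ENNReal.mul_lt_top hC.lt_top (ENNReal.add_lt_top.2
    ⟨hω.lt_top, ENNReal.mul_lt_top (by norm_num) hC.lt_top⟩))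
end

/-- extended-valued version of a real function -/
def oR (ζ : ℝ × ℝ → ℝ) (x : ℝ × ℝ) : ℝ≥0∞ := ENNReal.ofReal (ζ x)

theorem energy_eq {ω : ℝ → ℝ≥0∞} {C : ℝ≥0∞} {ζ : ℝ × ℝ → ℝ} (hm : Measurable ζ)
    (h0 : ∀ x, 0 ≤ ζ x)
    (h : Good ω C (oR ζ)) (hω : ω 1 ≠ ⊤) (hC : C ≠ ⊤) :
    energy ζ = 1 / 2 * (BK gE (oR ζ)).toReal := by
  have hG : ∀ x : ℝ × ℝ, 0 < x.2 → Gop ζ x = (∫⁻ y, gE x y * oR ζ y ∂μUH).toReal := by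
    intro x hx
    unfold Gop
    rw [integral_eq_lintegral_of_nonneg_ae]
    · congr 1
      apply lintegral_congr_ae
      filter_upwards [ae_UHP] with y hy
      exact ENNReal.ofReal_mul (greenG_nonneg hx hy)
    · filter_upwards [ae_UHP] with y hy
      exact mul_nonneg (greenG_nonneg hx hy) (h0 y)
    · exact ((measurable_greenG.comp measurable_prodMk_left).mul hm).aestronglyMeasurable
  have hmi := measurable_inner measurable_gE h.meas
  unfold energy
  congr 1
  have e : ∫ x, ζ x * Gop ζ x ∂μUH =
      ∫ x, ζ x * (∫⁻ y, gE x y * oR ζ y ∂μUH).toReal ∂μUH := by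
    apply integral_congr_ae
    filter_upwards [ae_UHP] with x hx
    rw [hG x hx]
  rw [e, integral_eq_lintegral_of_nonneg_ae]
  · unfold BK
    congr 1
    apply lintegral_congr_ae
    filter_upwards [ae_UHP] with x hx
    rw [ENNReal.ofReal_mul (h0 x), ENNReal.ofReal_toReal]
    · rfl
    · refine ((h.Gop_le' hx).trans_lt ?_).ne
      exact ENNReal.mul_lt_top ENNReal.ofReal_lt_top (ENNReal.add_lt_top.2
        ⟨hω.lt_top, ENNReal.mul_lt_top (by norm_num) hC.lt_top⟩)
  · filter_upwards with x
    exact mul_nonneg (h0 x) ENNReal.toReal_nonneg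
  · exact (hm.mul hmi.ennreal_toReal).aestronglyMeasurable

theorem impulse_eq {ζ : ℝ × ℝ → ℝ} (hm : Measurable ζ) (h0 : ∀ x, 0 ≤ ζ x) :
    impulse ζ = (∫⁻ y, oR ζ y * ENNReal.ofReal y.2 ∂μUH).toReal := by
  unfold impulse
  rw [integral_eq_lintegral_of_nonneg_ae]
  · congr 1
    apply lintegral_congr
    intro y
    exact ENNReal.ofReal_mul (h0 y)
  · filter_upwards [ae_UHP] with y hy
    exact mul_nonneg (h0 y) hy.le
  · exact (hm.mul measurable_snd).aestronglyMeasurable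

theorem integrable_of_lt_top {ζ : ℝ × ℝ → ℝ} (hm : Measurable ζ) (h0 : ∀ x, 0 ≤ ζ x)
    (h : ∫⁻ y, oR ζ y ∂μUH ≠ ⊤) : Integrable ζ μUH := by
  refine ⟨hm.aestronglyMeasurable, ?_⟩
  rw [hasFiniteIntegral_iff_ofReal (Eventually.of_forall h0)]
  exact h.lt_top

theorem BK_pos {K : ℝ × ℝ → ℝ × ℝ → ℝ≥0∞} {f : ℝ × ℝ → ℝ≥0∞} {A B : Set (ℝ × ℝ)}
    (hK : Measurable (fun z : (ℝ × ℝ) × (ℝ × ℝ) => K z.1 z.2)) (hf : Measurable f)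
    (hA : μUH (A ∩ Function.support f) ≠ 0) (hB : μUH (B ∩ Function.support f) ≠ 0)
    (hpos : ∀ x ∈ A, ∀ y ∈ B, 0 < x.2 → 0 < y.2 → x ≠ y → K x y ≠ 0) : 0 < BK K f := by
  have hin : ∀ x ∈ A, 0 < x.2 → 0 < ∫⁻ y, K x y * f y ∂μUH := by
    intro x hxA hx
    rw [lintegral_pos_iff_support (measurable_Kf hK hf x)]
    have hne : ∀ᵐ y ∂μUH, y ≠ x := by
      refine ae_restrict_of_ae ?_
      rw [ae_iff]; simp
    refine lt_of_lt_of_le (pos_iff_ne_zero.2 hB) (measure_mono_ae ?_)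
    filter_upwards [ae_UHP, hne] with y hy hyx hyB
    exact mul_ne_zero (hpos x hxA y hyB.1 hx hy hyx.symm) hyB.2
  unfold BK
  rw [lintegral_pos_iff_support (measurable_fK hK hf)]
  refine lt_of_lt_of_le (pos_iff_ne_zero.2 hA) (measure_mono_ae ?_)
  filter_upwards [ae_UHP] with x hx hxA
  exact mul_ne_zero hxA.2 (hin x hxA.1 hx).ne'


def h1D (a r u : ℝ) : ℝ≥0∞ := if |u| < r then (ENNReal.ofReal |u|) ^ (-a) else 0

theorem measurable_h1D (a r : ℝ) : Measurable (h1D a r) := by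
  unfold h1D
  refine Measurable.ite (measurableSet_lt (by fun_prop) measurable_const) ?_ measurable_const
  fun_prop

theorem lintegral_h1D_le {a r : ℝ} (ha1 : a < 1) (hr : 0 < r) :
    ∫⁻ u, h1D a r u ≤ 2 * ENNReal.ofReal (r ^ (1 - a) / (1 - a)) := by
  set hp : ℝ → ℝ≥0∞ := (Set.Ioc 0 r).indicator (fun u => ENNReal.ofReal (u ^ (-a))) with hhp
  have hpm : Measurable hp := by
    apply Measurable.indicator _ measurableSet_Ioc
    fun_prop
  have e1 : ∫⁻ u, hp u = ENNReal.ofReal (r ^ (1 - a) / (1 - a)) := by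
    rw [hhp, lintegral_indicator measurableSet_Ioc]
    have hint : IntegrableOn (fun u : ℝ => u ^ (-a)) (Set.Ioc 0 r) := by
      have := (intervalIntegral.intervalIntegrable_rpow' (a := 0) (b := r) (r := -a) (by linarith))
      rwa [intervalIntegrable_iff_integrableOn_Ioc_of_le hr.le] at this
    rw [← ofReal_integral_eq_lintegral_ofReal hint]
    · congr 1
      rw [← intervalIntegral.integral_of_le hr.le, integral_rpow (Or.inl (by linarith))]
      rw [Real.zero_rpow (by linarith)]
      ring_nf
    · refine (ae_restrict_mem measurableSet_Ioc).mono fun u hu => ?_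
      exact Real.rpow_nonneg hu.1.le _
  have e2 : ∫⁻ u, hp (-u) = ∫⁻ u, hp u := by
    exact lintegral_neg_eq_self (μ := volume) hp
  calc ∫⁻ u, h1D a r u ≤ ∫⁻ u, (hp u + hp (-u)) := by
        apply lintegral_mono_ae
        have hne : ∀ᵐ u : ℝ, u ≠ 0 := by rw [ae_iff]; simp
        filter_upwards [hne] with u hu
        unfold h1D
        split_ifs with h
        · have hh : ∀ v : ℝ, 0 < v → v < r → (ENNReal.ofReal v) ^ (-a) = hp v := by
            intro v hv hvr
            rw [hhp, Set.indicator_of_mem (show v ∈ Set.Ioc 0 r from ⟨hv, hvr.le⟩), ENNReal.ofReal_rpow_of_pos hv]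
          rcases lt_or_gt_of_ne hu with h1 | h1
          · rw [abs_of_neg h1] at h ⊢
            rw [hh _ (by linarith) h]; exact le_add_self
          · rw [abs_of_pos h1] at h ⊢
            rw [hh _ (by linarith) h]; exact le_self_add
        · exact zero_le
    _ = _ := by rw [lintegral_add_left hpm, e2, e1, two_mul]

theorem pK_rpow_le {q r : ℝ} (hq : 0 < q) (x y : ℝ × ℝ) :
    pK r x y ^ q ≤ h1D (q / 2) r (x.1 - y.1) * h1D (q / 2) r (x.2 - y.2) := by
  unfold pK
  split_ifs with h
  · have h1 := (abs_sub_fst_le_euclDist x y).trans_lt h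
    have h2 := (abs_sub_snd_le_euclDist x y).trans_lt h
    simp only [h1D, h1, h2, if_true]
    rw [← ENNReal.mul_rpow_of_ne_top (by simp) (by simp), ← ENNReal.ofReal_mul (abs_nonneg _)]
    set d := euclDist x y
    by_cases hd : d = 0
    · rw [hd]; simp [hq]
    have hd0 : 0 < d := lt_of_le_of_ne (euclDist_nonneg x y) (Ne.symm hd)
    have h3 : |x.1 - y.1| * |x.2 - y.2| ≤ d ^ 2 := by
      rw [sq]
      exact mul_le_mul (abs_sub_fst_le_euclDist x y) (abs_sub_snd_le_euclDist x y)
        (abs_nonneg _) hd0.le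
    calc ENNReal.ofReal (1 / d) ^ q = ENNReal.ofReal (d ^ 2) ^ (-(q / 2)) := by
          rw [ENNReal.ofReal_rpow_of_pos (by positivity), ENNReal.ofReal_rpow_of_pos (by positivity)]
          congr 1
          rw [one_div, Real.inv_rpow hd0.le, ← Real.rpow_neg hd0.le, ← Real.rpow_natCast,
            ← Real.rpow_mul hd0.le]
          congr 1
          push_cast; ring
      _ ≤ _ := by
          rw [ENNReal.rpow_neg, ENNReal.rpow_neg, ENNReal.inv_le_inv]
          exact ENNReal.rpow_le_rpow (ENNReal.ofReal_le_ofReal h3) (by linarith)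
  · rw [ENNReal.zero_rpow_of_pos hq]; exact zero_le

theorem lintegral_pK_rpow_le {q r : ℝ} (hq : 0 < q) (hq2 : q < 2) (hr : 0 < r) (x : ℝ × ℝ) :
    ∫⁻ y, pK r x y ^ q ∂μUH ≤ (2 * ENNReal.ofReal (r ^ (1 - q / 2) / (1 - q / 2))) ^ 2 := by
  have hm := measurable_h1D (q / 2) r
  calc ∫⁻ y, pK r x y ^ q ∂μUH ≤ ∫⁻ y, pK r x y ^ q := by
        unfold μUH; exact setLIntegral_le_lintegral _ _
    _ ≤ ∫⁻ y : ℝ × ℝ, h1D (q / 2) r (x.1 - y.1) * h1D (q / 2) r (x.2 - y.2) :=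
        lintegral_mono fun y => pK_rpow_le hq x y
    _ = (∫⁻ u, h1D (q / 2) r (x.1 - u)) * ∫⁻ v, h1D (q / 2) r (x.2 - v) := by
        have := lintegral_prod_mul (μ := (volume : Measure ℝ)) (ν := (volume : Measure ℝ))
          (f := fun u => h1D (q / 2) r (x.1 - u)) (g := fun u => h1D (q / 2) r (x.2 - u))
          (by fun_prop) (by fun_prop)
        rw [← this]; rfl
    _ = (∫⁻ u, h1D (q / 2) r u) * ∫⁻ v, h1D (q / 2) r v := by
        rw [lintegral_sub_left_eq_self (h1D (q/2) r), lintegral_sub_left_eq_self (h1D (q/2) r)]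
    _ ≤ _ := by
        rw [sq]
        gcongr <;> exact lintegral_h1D_le (by linarith) hr

theorem exists_omega {p : ℝ} (hp : 2 < p) {A : ℝ≥0∞} (hA : A ≠ ⊤) :
    ∃ ω : ℝ → ℝ≥0∞, (∀ r, ω r ≠ ⊤) ∧ Tendsto ω (𝓝[>] 0) (𝓝 0) ∧
      ∀ f : ℝ × ℝ → ℝ≥0∞, Measurable f → ∫⁻ y, f y ^ p ∂μUH ≤ A → ∀ r > 0, ∀ x,
        ∫⁻ y, pK r x y * f y ∂μUH ≤ ω r := by
  set q := p / (p - 1) with hq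
  have hq0 : 0 < q := by apply div_pos <;> linarith
  have hq2 : q < 2 := by rw [hq, div_lt_iff₀ (by linarith)]; linarith
  have hpq : q.HolderConjugate p := (Real.HolderConjugate.conjExponent (by linarith : 1 < p)).symm
  refine ⟨fun r => ((2 * ENNReal.ofReal (r ^ (1 - q / 2) / (1 - q / 2))) ^ 2) ^ (1 / q) *
    A ^ (1 / p), ?_, ?_, ?_⟩
  · intro r
    apply ENNReal.mul_ne_top
    · apply ENNReal.rpow_ne_top_of_nonneg (by positivity)
      apply ENNReal.pow_ne_top
      exact ENNReal.mul_ne_top (by norm_num) ENNReal.ofReal_ne_top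
    · apply ENNReal.rpow_ne_top_of_nonneg (by positivity) hA
  · have h1 : Tendsto (fun r : ℝ => r ^ (1 - q / 2) / (1 - q / 2)) (𝓝[>] 0) (𝓝 0) := by
      have : ContinuousAt (fun r : ℝ => r ^ (1 - q / 2) / (1 - q / 2)) 0 := by
        apply ContinuousAt.div_const
        exact Real.continuousAt_rpow_const _ _ (Or.inr (by linarith))
      have h := this.tendsto
      simp only [Real.zero_rpow (show 1 - q / 2 ≠ 0 by linarith), zero_div] at h
      exact h.mono_left nhdsWithin_le_nhds
    have h2 := ENNReal.tendsto_ofReal h1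
    rw [ENNReal.ofReal_zero] at h2
    have h3 := ENNReal.Tendsto.const_mul (a := 2) h2 (Or.inr (by norm_num))
    have h4 := ((ENNReal.continuous_pow 2).tendsto _).comp h3
    have h5 := ((ENNReal.continuous_rpow_const (y := 1 / q)).tendsto _).comp h4
    have h6 := ENNReal.Tendsto.mul_const (b := A ^ (1 / p)) h5
      (Or.inr (ENNReal.rpow_ne_top_of_nonneg (by positivity) hA))
    have e : ((2 * 0 : ℝ≥0∞) ^ 2) ^ (1 / q) * A ^ (1 / p) = 0 := by
      simp [hq0]
    rw [e] at h6
    exact h6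
  · intro f hf hfA r hr x
    refine (ENNReal.lintegral_mul_le_Lp_mul_Lq μUH hpq
      (measurable_slice (measurable_pK r) x).aemeasurable hf.aemeasurable).trans ?_
    have hpp : 0 ≤ 1 / p := by
      have : 0 < p := by linarith
      positivity
    exact mul_le_mul' (ENNReal.rpow_le_rpow (lintegral_pK_rpow_le hq0 hq2 hr x) (by positivity))
      (ENNReal.rpow_le_rpow hfA hpp)


theorem integral_oR {g : ℝ × ℝ → ℝ} (hm : Measurable g) (h0 : ∀ x, 0 ≤ g x) :
    ∫ x, g x ∂μUH = (∫⁻ x, oR g x ∂μUH).toReal :=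
  integral_eq_lintegral_of_nonneg_ae (Eventually.of_forall h0) hm.aestronglyMeasurable

theorem exists_trunc {ω : ℝ → ℝ≥0∞} {C : ℝ≥0∞} (hω0 : Tendsto ω (𝓝[>] 0) (𝓝 0)) (hC : C ≠ ⊤)
    {δ : ℝ≥0∞} (hδ : 0 < δ) : ∃ r > 0, ∃ H ≥ 1,
      C * (ω r + ENNReal.ofReal (1 / H) * C + ENNReal.ofReal (1 / (r * H)) * C) ≤ δ := by
  have h1 : Tendsto (fun r => C * ω r) (𝓝[>] 0) (𝓝 (C * 0)) :=
    ENNReal.Tendsto.const_mul hω0 (Or.inr hC)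
  rw [mul_zero] at h1
  have h2 := (h1.eventually_lt_const hδ).and self_mem_nhdsWithin
  obtain ⟨r, hr, hr0⟩ := h2.exists
  have hr0 : 0 < r := hr0
  refine ⟨r, hr0, ?_⟩
  have a1 : Tendsto (fun H : ℝ => ENNReal.ofReal (1 / H) * C) atTop (𝓝 0) := by
    have : Tendsto (fun H : ℝ => 1 / H) atTop (𝓝 0) := by
      simpa using tendsto_inv_atTop_zero (𝕜 := ℝ)
    have := ENNReal.Tendsto.mul_const (b := C) (ENNReal.tendsto_ofReal this) (Or.inr hC)
    simpa using this
  have a2 : Tendsto (fun H : ℝ => ENNReal.ofReal (1 / (r * H)) * C) atTop (𝓝 0) := by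
    have : Tendsto (fun H : ℝ => 1 / (r * H)) atTop (𝓝 0) := by
      have h := (tendsto_inv_atTop_zero (𝕜 := ℝ)).const_mul r⁻¹
      rw [mul_zero] at h
      refine h.congr fun H => ?_
      rw [one_div, mul_inv]
    have := ENNReal.Tendsto.mul_const (b := C) (ENNReal.tendsto_ofReal this) (Or.inr hC)
    simpa using this
  have a3 := ENNReal.Tendsto.const_mul (a := C)
    ((tendsto_const_nhds (x := ω r)).add a1 |>.add a2) (Or.inr hC)
  rw [add_zero, add_zero] at a3
  obtain ⟨H, h, hH⟩ := ((a3.eventually_lt_const hr).and (eventually_ge_atTop 1)).exists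
  exact ⟨H, hH, h.le⟩

/-- vertical shift of a function on the half-plane -/
def upF (s : ℝ) (f : ℝ × ℝ → ℝ≥0∞) (x : ℝ × ℝ) : ℝ≥0∞ :=
  if s < x.2 then f (x.1, x.2 - s) else 0

theorem lintegral_upF {s : ℝ} (hs : 0 ≤ s) (f h : ℝ × ℝ → ℝ≥0∞) :
    ∫⁻ x, h x * upF s f x ∂μUH = ∫⁻ x, h (up s x) * f x ∂μUH := by
  unfold μUH
  rw [← lintegral_indicator measurableSet_UHP, ← lintegral_indicator measurableSet_UHP]
  rw [← lintegral_sub_right_eq_self (μ := volume) (UHP.indicator fun x => h (up s x) * f x)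
    ((0, s) : ℝ × ℝ)]
  congr 1
  ext x
  have e : up s (x - (0, s)) = x := by
    ext <;> simp [up]
  simp only [Set.indicator, UHP, Set.mem_ofPred_eq, e, upF]
  by_cases h1 : s < x.2
  · have h2 : 0 < x.2 := by linarith
    have h3 : 0 < (x - (0, s)).2 := by simpa using h1
    simp only [h1, h2, h3, if_true]
    congr 2
    ext <;> simp
  · have h3 : ¬ 0 < (x - (0, s)).2 := by simpa using h1
    simp [h1, h3]

theorem measurable_upF {s : ℝ} {f : ℝ × ℝ → ℝ≥0∞} (hf : Measurable f) : Measurable (upF s f) := by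
  unfold upF
  refine Measurable.ite (measurableSet_lt measurable_const measurable_snd) ?_ measurable_const
  exact hf.comp (by fun_prop)

theorem BK_upF {s : ℝ} (hs : 0 ≤ s) (f : ℝ × ℝ → ℝ≥0∞) (K : ℝ × ℝ → ℝ × ℝ → ℝ≥0∞) :
    BK K (upF s f) = BK (fun x y => K (up s x) (up s y)) f := by
  unfold BK
  have := lintegral_upF hs f (fun x => ∫⁻ y, K x y * upF s f y ∂μUH)
  simp_rw [mul_comm _ (upF s f _), mul_comm _ (f _)] at this
  simp_rw [mul_comm _ (upF s f _), mul_comm _ (f _)]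
  rw [this]
  congr 1; ext x
  congr 1
  have := lintegral_upF hs f (fun y => K (up s x) y)
  simp_rw [mul_comm _ (upF s f _), mul_comm _ (f _)] at this
  exact this

theorem Good.upF {ω : ℝ → ℝ≥0∞} {C : ℝ≥0∞} {f : ℝ × ℝ → ℝ≥0∞} (h : Good ω C f) {s : ℝ}
    (hs : 0 ≤ s) (hi : ∫⁻ y, f y * ENNReal.ofReal y.2 ∂μUH + ENNReal.ofReal s * ∫⁻ y, f y ∂μUH ≤ C) :
    Good ω C (upF s f) ∧ ∫⁻ y, upF s f y * ENNReal.ofReal y.2 ∂μUH =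
      ∫⁻ y, f y * ENNReal.ofReal y.2 ∂μUH + ENNReal.ofReal s * ∫⁻ y, f y ∂μUH := by
  have hm := h.meas
  have e : ∫⁻ y, _root_.upF s f y * ENNReal.ofReal y.2 ∂μUH =
      ∫⁻ y, f y * ENNReal.ofReal y.2 ∂μUH + ENNReal.ofReal s * ∫⁻ y, f y ∂μUH := by
    have := lintegral_upF hs f (fun y => ENNReal.ofReal y.2)
    simp_rw [mul_comm _ (_root_.upF s f _)] at this
    rw [this, ← lintegral_const_mul _ hm, ← lintegral_add_left (by fun_prop)]
    apply lintegral_congr_ae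
    filter_upwards [ae_UHP] with y hy
    simp only [up]
    rw [ENNReal.ofReal_add hy.le hs]; ring
  refine ⟨⟨measurable_upF hm, ?_, ?_, ?_⟩, e⟩
  · have := lintegral_upF hs f (fun y => 1)
    simp only [one_mul] at this
    rw [this]; exact h.mass
  · rw [e]; exact hi
  · intro r hr x
    have := lintegral_upF hs f (fun y => pK r x y)
    rw [this]
    have e2 : ∀ y, pK r x (up s y) = pK r (x.1, x.2 - s) y := by
      intro y
      have : euclDist x (up s y) = euclDist (x.1, x.2 - s) y := by
        unfold euclDist sqdist up
        congr 1
        simp only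
        ring
      unfold pK
      rw [this]
    simp_rw [e2]
    exact h.pot r hr _

theorem gain {ω : ℝ → ℝ≥0∞} {C : ℝ≥0∞} (hω : ∀ r, ω r ≠ ⊤) (hω0 : Tendsto ω (𝓝[>] 0) (𝓝 0))
    (hC : C ≠ ⊤) (hC1 : 1 ≤ C) {i₀ : ℝ} (hi₀ : 0 < i₀) (hCi : ENNReal.ofReal i₀ ≤ C) {M₀ : ℝ}
    (hM : 0 < M₀) {ζ₀ : ℝ × ℝ → ℝ} (hmax : ∀ ξ ∈ Weq ζ₀ i₀, energy ξ ≤ M₀) :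
    ∃ c > 0, ∀ η : ℝ × ℝ → ℝ, Measurable η → (∀ x, 0 ≤ η x) → Good ω C (oR η) → prec η ζ₀ →
      impulse η ≤ i₀ → M₀ / 2 ≤ energy η → energy η + c * (i₀ - impulse η) ≤ M₀ := by
  obtain ⟨r, hr, H, hH, htr⟩ := exists_trunc (ω := ω) hω0 hC
    (δ := ENNReal.ofReal (M₀ / 2)) (by simpa using hM)
  set D := C.toReal with hD
  have hD1 : 1 ≤ D := by
    rw [hD]; simpa using ENNReal.toReal_mono hC hC1
  have hDi : i₀ ≤ D := by
    have := ENNReal.toReal_mono hC hCi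
    rwa [ENNReal.toReal_ofReal hi₀.le] at this
  have hH0 : 0 < H := by linarith
  have hD0 : 0 < D := by linarith
  refine ⟨1 / 2 * ((1 / D) * (r / (40 * H ^ 2)) * (M₀ / 2)), by positivity, ?_⟩
  intro η hm h0 hG hprec hile hEge
  have hEη := energy_eq hm h0 hG (hω 1) hC
  have hIη := impulse_eq hm h0
  have himptop : ∫⁻ y, oR η y * ENNReal.ofReal y.2 ∂μUH ≠ ⊤ := (hG.imp.trans_lt hC.lt_top).ne
  have hmasstop : ∫⁻ y, oR η y ∂μUH ≠ ⊤ := (hG.mass.trans_lt hC.lt_top).ne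
  have hBtop := (hG.BK_lt_top (hω 1) hC).ne
  set i := impulse η with hi
  set m := (∫⁻ y, oR η y ∂μUH).toReal with hmdef
  have hi0 : 0 ≤ i := by rw [hIη]; exact ENNReal.toReal_nonneg
  have hB : ENNReal.ofReal M₀ ≤ BK gE (oR η) := by
    rw [ENNReal.ofReal_le_iff_le_toReal hBtop]; linarith
  have hm0 : 0 < m := by
    apply ENNReal.toReal_pos _ hmasstop
    intro h
    have h' := (lintegral_eq_zero_iff hG.meas).1 h
    have : BK gE (oR η) = 0 := by
      unfold BK
      rw [lintegral_eq_zero_iff (measurable_fK measurable_gE hG.meas)]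
      filter_upwards [h'] with x hx
      simp only [hx, Pi.zero_apply, zero_mul]
    rw [this] at hB
    simp at hB
    linarith
  have hmD : m ≤ D := ENNReal.toReal_mono hC hG.mass
  set s := (i₀ - i) / m with hs
  set s' := (i₀ - i) / D with hs'
  have hs'0 : 0 ≤ s' := div_nonneg (by linarith) hD0.le
  have hs'1 : s' ≤ 1 := by rw [hs', div_le_one hD0]; linarith
  have hss : s' ≤ s := by
    rw [hs, hs']; exact div_le_div_of_nonneg_left (by linarith) hm0 hmD
  have hs0 : 0 ≤ s := hs'0.trans hss
  have himp : ∫⁻ y, oR η y * ENNReal.ofReal y.2 ∂μUH + ENNReal.ofReal s * ∫⁻ y, oR η y ∂μUH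
      = ENNReal.ofReal i₀ := by
    rw [← ENNReal.ofReal_toReal himptop, ← ENNReal.ofReal_toReal hmasstop, ← hIη, ← hmdef,
      ← ENNReal.ofReal_mul hs0, ← ENNReal.ofReal_add hi0 (by positivity)]
    congr 1
    rw [hs]; field_simp; ring
  obtain ⟨hG', hI'⟩ := hG.upF hs0 (himp.trans_le hCi)
  set ξ : ℝ × ℝ → ℝ := fun x => if s < x.2 then η (x.1, x.2 - s) else 0 with hξ
  have hξo : ∀ φ : ℝ → ℝ, φ 0 = 0 → oR (fun x => φ (ξ x)) = upF s (oR (fun x => φ (η x))) := by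
    intro φ hφ
    ext x
    simp only [oR, upF, hξ]
    split_ifs <;> simp [hφ]
  have hξo1 : oR ξ = upF s (oR η) := hξo (fun t => t) rfl
  have hξm : Measurable ξ := by
    refine Measurable.ite (measurableSet_lt measurable_const measurable_snd) ?_ measurable_const
    exact hm.comp (by fun_prop)
  have hξ0 : ∀ x, 0 ≤ ξ x := by
    intro x; simp only [hξ]; split_ifs
    · exact h0 _
    · exact le_rfl
  rw [← hξo1] at hG' hI'
  have hEξ := energy_eq hξm hξ0 hG' (hω 1) hC
  have hξW : ξ ∈ Weq ζ₀ i₀ := by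
    refine ⟨⟨hξ0, integrable_of_lt_top hξm hξ0 (hG'.mass.trans_lt hC.lt_top).ne, ?_⟩, ?_⟩
    · intro a ha
      refine le_trans (le_of_eq ?_) (hprec a ha)
      rw [integral_oR (by fun_prop) (fun x => le_max_right _ _), integral_oR (by fun_prop)
        (fun x => le_max_right _ _)]
      congr 1
      have h1 := hξo (fun t => max (t - a) 0) (by simp [ha.le])
      have h2 := lintegral_upF hs0 (oR fun x => max (η x - a) 0) (fun _ => 1)
      simp only [one_mul] at h2
      rw [← h1] at h2
      exact h2
    · rw [impulse_eq hξm hξ0, hI', himp, ENNReal.toReal_ofReal hi₀.le]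
  have hfin := hmax ξ hξW
  have hT : ENNReal.ofReal (M₀ / 2) ≤ BK (gT r H) (oR η) := by
    have h1 := hB.trans ((hG.BK_trunc hr hH0).trans (add_le_add_right htr _))
    have h2 : ENNReal.ofReal M₀ = ENNReal.ofReal (M₀ / 2) + ENNReal.ofReal (M₀ / 2) := by
      rw [← ENNReal.ofReal_add (by linarith) (by linarith)]; congr 1; ring
    rw [h2] at h1
    exact (ENNReal.add_le_add_iff_right ENNReal.ofReal_ne_top).1 h1
  set κ := s' * (r / (40 * H ^ 2)) with hκ
  have hκ0 : 0 ≤ κ := by positivity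
  have hge : BK gE (oR η) + ENNReal.ofReal κ * ENNReal.ofReal (M₀ / 2) ≤ BK gE (oR ξ) := by
    calc _ ≤ BK gE (oR η) + ENNReal.ofReal κ * BK (gT r H) (oR η) := by gcongr
      _ = BK (fun x y => gE x y + ENNReal.ofReal κ * gT r H x y) (oR η) := by
        rw [BK_add measurable_gE hG.meas, BK_const_mul _ (measurable_gT r H) hG.meas]
      _ ≤ BK (fun x y => gE (up s x) (up s y)) (oR η) := by
        apply BK_mono _ (fun _ => le_rfl)
        intro x y hx hy
        have h2 := greenG_up_mono hx hy hs'0 hss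
        unfold gT
        split_ifs with h
        · have h1 := greenG_gain hx hy hr hH hs'0 hs'1 h
          unfold gE
          have h3 := greenG_nonneg hx hy
          rw [← ENNReal.ofReal_mul hκ0, ← ENNReal.ofReal_add h3 (by positivity)]
          exact ENNReal.ofReal_le_ofReal (h1.trans h2)
        · rw [mul_zero, add_zero]
          apply ENNReal.ofReal_le_ofReal
          have := greenG_up_mono hx hy le_rfl hs0
          simpa [up] using this
      _ = _ := by rw [hξo1, BK_upF hs0]
  have hge2 := ENNReal.toReal_mono (hG'.BK_lt_top (hω 1) hC).ne hge
  rw [ENNReal.toReal_add hBtop (ENNReal.mul_ne_top ENNReal.ofReal_ne_top ENNReal.ofReal_ne_top),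
    ENNReal.toReal_mul, ENNReal.toReal_ofReal hκ0, ENNReal.toReal_ofReal (by linarith)] at hge2
  have : 1 / 2 * ((1 / D) * (r / (40 * H ^ 2)) * (M₀ / 2)) * (i₀ - i) = 1/2 * (κ * (M₀ / 2)) := by
    rw [hκ, hs']; ring
  rw [this]
  linarith


theorem lintegral_pow_equi {α β : Type*} [MeasurableSpace α] [MeasurableSpace β] {μ : Measure α}
    {ν : Measure β} {f : α → ℝ} {g : β → ℝ} (hf : ∀ x, 0 ≤ f x) (hg : ∀ x, 0 ≤ g x)
    (hfm : AEMeasurable f μ) (hgm : AEMeasurable g ν)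
    (h : ∀ t : ℝ, 0 < t → μ {x | t < f x} = ν {x | t < g x}) {q : ℝ} (hq : 0 < q) :
    ∫⁻ x, ENNReal.ofReal (f x) ^ q ∂μ = ∫⁻ x, ENNReal.ofReal (g x) ^ q ∂ν := by
  simp_rw [ENNReal.ofReal_rpow_of_nonneg (hf _) hq.le, ENNReal.ofReal_rpow_of_nonneg (hg _) hq.le]
  rw [lintegral_rpow_eq_lintegral_meas_lt_mul μ (Eventually.of_forall hf) hfm hq,
    lintegral_rpow_eq_lintegral_meas_lt_mul ν (Eventually.of_forall hg) hgm hq]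
  congr 1
  apply setLIntegral_congr_fun measurableSet_Ioi
  intro t ht
  simp only
  rw [h t ht]

theorem lintegral_pp_equi {α β : Type*} [MeasurableSpace α] [MeasurableSpace β] {μ : Measure α}
    {ν : Measure β} {f : α → ℝ} {g : β → ℝ}
    (hfm : AEMeasurable f μ) (hgm : AEMeasurable g ν)
    (h : ∀ t : ℝ, 0 < t → μ {x | t < f x} = ν {x | t < g x}) {a : ℝ} (ha : 0 < a) :
    ∫⁻ x, ENNReal.ofReal (max (f x - a) 0) ∂μ = ∫⁻ x, ENNReal.ofReal (max (g x - a) 0) ∂ν := by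
  rw [lintegral_eq_lintegral_meas_lt (f := fun x => max (f x - a) 0) μ
    (Eventually.of_forall fun _ => le_max_right _ _) ((hfm.sub_const a).max aemeasurable_const),
    lintegral_eq_lintegral_meas_lt (f := fun x => max (g x - a) 0) ν
    (Eventually.of_forall fun _ => le_max_right _ _)
    ((hgm.sub_const a).max aemeasurable_const)]
  apply setLIntegral_congr_fun measurableSet_Ioi
  intro t ht
  have ht : 0 < t := ht
  have e : ∀ u : ℝ, t < max (u - a) 0 ↔ t + a < u := by
    intro u
    rw [lt_max_iff]
    constructor
    · rintro (h | h) <;> linarith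
    · intro h; left; linarith
  simp only [e]
  rw [h _ (by linarith)]


theorem meas_gt_le {f : ℝ × ℝ → ℝ} (hf : ∀ x, 0 ≤ f x) (hm : Integrable f μUH) {a : ℝ} (ha : 0 < a) :
    ENNReal.ofReal a * μUH {x | a < f x} ≤ ∫⁻ x, oR f x ∂μUH := by
  refine le_trans ?_ (mul_meas_ge_le_lintegral₀ hm.aemeasurable.ennreal_ofReal (ENNReal.ofReal a))
  gcongr
  exact fun h => ENNReal.ofReal_le_ofReal (le_of_lt h)

theorem mass_ne_top {f : ℝ × ℝ → ℝ} (hf : ∀ x, 0 ≤ f x) (hm : Integrable f μUH) : ∫⁻ x, oR f x ∂μUH ≠ ⊤ := by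
  have := hm.2
  rw [hasFiniteIntegral_iff_ofReal (Eventually.of_forall hf)] at this
  exact this.ne

theorem meas_gt_ne_top {f : ℝ × ℝ → ℝ} (hf : ∀ x, 0 ≤ f x) (hm : Integrable f μUH) {a : ℝ} (ha : 0 < a) : μUH {x | a < f x} ≠ ⊤ := by
  intro h
  have := meas_gt_le hf hm ha
  rw [h, ENNReal.mul_top (by simpa using ha)] at this
  exact mass_ne_top hf hm (top_le_iff.1 this)

theorem decSet_nonempty {f : ℝ × ℝ → ℝ} (hf : ∀ x, 0 ≤ f x) (hm : Integrable f μUH) {s : ℝ} (hs : 0 < s) :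
    {a : ℝ | 0 < a ∧ μUH {x | a < f x} ≤ ENNReal.ofReal s}.Nonempty := by
  set m := (∫⁻ x, oR f x ∂μUH).toReal
  have hm0 : 0 ≤ m := ENNReal.toReal_nonneg
  have ha : 0 < (m + 1) / s := by positivity
  refine ⟨(m + 1) / s, ha, ?_⟩
  have h := meas_gt_le hf hm ha
  rw [← ENNReal.ofReal_toReal (mass_ne_top hf hm), ← ENNReal.ofReal_toReal (meas_gt_ne_top hf hm ha),
    ← ENNReal.ofReal_mul ha.le, ENNReal.ofReal_le_ofReal_iff hm0] at h
  rw [← ENNReal.ofReal_toReal (meas_gt_ne_top hf hm ha)]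
  apply ENNReal.ofReal_le_ofReal
  rw [div_mul_eq_mul_div, div_le_iff₀ hs] at h
  by_contra hc
  push Not at hc
  nlinarith

theorem decSet_bdd {f : ℝ × ℝ → ℝ} (s : ℝ) : BddBelow {a : ℝ | 0 < a ∧ μUH {x | a < f x} ≤ ENNReal.ofReal s} :=
  ⟨0, fun _ h => h.1.le⟩

theorem decRearr_nonneg {f : ℝ × ℝ → ℝ} (s : ℝ) : 0 ≤ decRearr f s := Real.sInf_nonneg fun _ h => h.1.le

theorem lt_decRearr_iff {f : ℝ × ℝ → ℝ} (hf : ∀ x, 0 ≤ f x) (hm : Integrable f μUH) {a s : ℝ} (ha : 0 < a) (hs : 0 < s) :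
    a < decRearr f s ↔ ENNReal.ofReal s < μUH {x | a < f x} := by
  rw [← not_iff_not]
  push Not
  constructor
  · intro h
    have e : {x | a < f x} = ⋃ n : ℕ, {x | a + 1 / ((n : ℝ) + 1) < f x} := by
      ext x
      simp only [Set.mem_ofPred_eq, Set.mem_iUnion]
      constructor
      · intro hx
        obtain ⟨n, hn⟩ := exists_nat_one_div_lt (sub_pos.2 hx)
        exact ⟨n, by linarith⟩
      · rintro ⟨n, hn⟩
        have : 0 < 1 / ((n : ℝ) + 1) := by positivity
        linarith
    have hmono : Monotone fun n : ℕ => {x | a + 1 / ((n : ℝ) + 1) < f x} := by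
      intro n k hnk x hx
      simp only [Set.mem_ofPred_eq] at hx ⊢
      have := Nat.one_div_le_one_div (α := ℝ) hnk
      linarith
    rw [e, hmono.measure_iUnion]
    apply iSup_le
    intro n
    have hpos : 0 < 1 / ((n : ℝ) + 1) := by positivity
    obtain ⟨b, hb, hlt⟩ := exists_lt_of_csInf_lt (decSet_nonempty hf hm hs)
      (show decRearr f s < a + 1 / ((n : ℝ) + 1) by linarith)
    refine le_trans (measure_mono ?_) hb.2
    intro x hx
    exact hlt.trans hx
  · intro h
    exact csInf_le (decSet_bdd s) ⟨ha, h⟩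

theorem decRearr_equi {f : ℝ × ℝ → ℝ} (hf : ∀ x, 0 ≤ f x) (hm : Integrable f μUH) {a : ℝ} (ha : 0 < a) :
    volume.restrict (Set.Ioi (0:ℝ)) {s | a < decRearr f s} = μUH {x | a < f x} := by
  have hT := meas_gt_ne_top hf hm ha
  rw [Measure.restrict_apply' measurableSet_Ioi]
  have e : {s | a < decRearr f s} ∩ Set.Ioi 0 = Set.Ioo 0 (μUH {x | a < f x}).toReal := by
    ext s
    simp only [Set.mem_inter_iff, Set.mem_ofPred_eq, Set.mem_Ioi, Set.mem_Ioo]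
    constructor
    · rintro ⟨h1, h2⟩
      rw [lt_decRearr_iff hf hm ha h2, ENNReal.ofReal_lt_iff_lt_toReal h2.le hT] at h1
      exact ⟨h2, h1⟩
    · rintro ⟨h2, h1⟩
      rw [lt_decRearr_iff hf hm ha h2, ENNReal.ofReal_lt_iff_lt_toReal h2.le hT]
      exact ⟨h1, h2⟩
  rw [e, Real.volume_Ioo, sub_zero, ENNReal.ofReal_toReal hT]

theorem decRearr_aemeas {f : ℝ × ℝ → ℝ} (hf : ∀ x, 0 ≤ f x) (hm : Integrable f μUH) : AEMeasurable (decRearr f) (volume.restrict (Set.Ioi (0:ℝ))) := by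
  apply aemeasurable_restrict_of_antitoneOn measurableSet_Ioi
  intro s hs t ht hst
  apply csInf_le_csInf (decSet_bdd t) (decSet_nonempty hf hm hs)
  intro a ha
  exact ⟨ha.1, ha.2.trans (ENNReal.ofReal_le_ofReal hst)⟩

theorem eLpNorm_nonneg_eq {α : Type*} [MeasurableSpace α] {μ : Measure α} {f : α → ℝ}
    (hf : ∀ x, 0 ≤ f x) {q : ℝ} (hq : 0 < q) :
    eLpNorm f (ENNReal.ofReal q) μ = (∫⁻ x, ENNReal.ofReal (f x) ^ q ∂μ) ^ (1 / q) := by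
  rw [eLpNorm_eq_lintegral_rpow_enorm_toReal (by simpa using hq) ENNReal.ofReal_ne_top,
    ENNReal.toReal_ofReal hq.le]
  congr 2
  ext x
  rw [Real.enorm_eq_ofReal (hf x)]

theorem tendsto_lintegral_pow {α : Type*} [MeasurableSpace α] {μ : Measure α} {fn : ℕ → α → ℝ}
    {f : α → ℝ} (hfn : ∀ n x, 0 ≤ fn n x) (hf : ∀ x, 0 ≤ f x) (hfnm : ∀ n, AEMeasurable (fn n) μ)
    (hfm : AEMeasurable f μ) {q : ℝ} (hq : 1 ≤ q) (hfin : ∫⁻ x, ENNReal.ofReal (f x) ^ q ∂μ ≠ ⊤)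
    (h : Tendsto (fun n => eLpNorm (fun x => fn n x - f x) (ENNReal.ofReal q) μ) atTop (𝓝 0)) :
    Tendsto (fun n => ∫⁻ x, ENNReal.ofReal (fn n x) ^ q ∂μ) atTop
      (𝓝 (∫⁻ x, ENNReal.ofReal (f x) ^ q ∂μ)) := by
  have hq0 : 0 < q := by linarith
  have hqE : 1 ≤ ENNReal.ofReal q := by rw [← ENNReal.ofReal_one]; exact ENNReal.ofReal_le_ofReal hq
  have h1 : Tendsto (fun n => eLpNorm (fn n) (ENNReal.ofReal q) μ) atTop
      (𝓝 (eLpNorm f (ENNReal.ofReal q) μ)) := by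
    have hft : eLpNorm f (ENNReal.ofReal q) μ ≠ ⊤ := by
      rw [eLpNorm_nonneg_eq hf hq0]
      exact ENNReal.rpow_ne_top_of_nonneg (by positivity) hfin
    have u1 := ENNReal.Tendsto.sub (tendsto_const_nhds (x := eLpNorm f (ENNReal.ofReal q) μ)
      (f := atTop (α := ℕ))) h (Or.inl hft)
    have u2 := (tendsto_const_nhds (x := eLpNorm f (ENNReal.ofReal q) μ)
      (f := atTop (α := ℕ))).add h
    rw [tsub_zero] at u1
    rw [add_zero] at u2
    refine tendsto_of_tendsto_of_tendsto_of_le_of_le u1 u2 ?_ ?_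
    · intro n
      simp only
      rw [tsub_le_iff_right]
      have := eLpNorm_sub_le (μ := μ) (hfnm n).aestronglyMeasurable
        ((hfnm n).sub hfm).aestronglyMeasurable hqE
      rw [sub_sub_cancel] at this
      exact this
    · intro n
      have := eLpNorm_add_le (μ := μ) hfm.aestronglyMeasurable
        ((hfnm n).sub hfm).aestronglyMeasurable hqE
      rw [add_sub_cancel] at this
      exact this
  simp_rw [eLpNorm_nonneg_eq hf hq0, eLpNorm_nonneg_eq (hfn _) hq0] at h1
  have h2 := ((ENNReal.continuous_rpow_const (y := q)).tendsto _).comp h1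
  have e : ∀ t : ℝ≥0∞, (t ^ (1 / q)) ^ q = t := by
    intro t
    rw [← ENNReal.rpow_mul, one_div_mul_cancel hq0.ne', ENNReal.rpow_one]
  simpa only [Function.comp_def, e] using h2

theorem tendsto_eLpNorm_two {α : Type*} [MeasurableSpace α] {μ : Measure α} {fn : ℕ → α → ℝ}
    (hm : ∀ n, AEMeasurable (fn n) μ) {p : ℝ} (hp : 2 < p)
    (h1 : Tendsto (fun n => eLpNorm (fn n) 1 μ) atTop (𝓝 0))
    (h2 : Tendsto (fun n => eLpNorm (fn n) (ENNReal.ofReal p) μ) atTop (𝓝 0)) :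
    Tendsto (fun n => eLpNorm (fn n) (ENNReal.ofReal 2) μ) atTop (𝓝 0) := by
  have hp0 : 0 < p := by linarith
  have g2 : Tendsto (fun n => ∫⁻ x, ‖fn n x‖ₑ ^ p ∂μ) atTop (𝓝 0) := by
    have h3 := ((ENNReal.continuous_rpow_const (y := p)).tendsto _).comp h2
    rw [ENNReal.zero_rpow_of_pos hp0] at h3
    refine h3.congr fun n => ?_
    simp only [Function.comp]
    rw [eLpNorm_eq_lintegral_rpow_enorm_toReal (by simpa using hp0) ENNReal.ofReal_ne_top,
    ENNReal.toReal_ofReal hp0.le, ← ENNReal.rpow_mul, one_div_mul_cancel hp0.ne', ENNReal.rpow_one]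
  simp_rw [eLpNorm_one_eq_lintegral_enorm] at h1
  have g3 := h1.add g2
  rw [add_zero] at g3
  have g4 : Tendsto (fun n => ∫⁻ x, ‖fn n x‖ₑ ^ (2:ℝ) ∂μ) atTop (𝓝 0) := by
    refine tendsto_of_tendsto_of_tendsto_of_le_of_le tendsto_const_nhds g3
      (fun _ => zero_le) ?_
    intro n
    simp only
    rw [← lintegral_add_left' (by exact (hm n).enorm)]
    apply lintegral_mono
    intro x
    simp only
    rcases le_total ‖fn n x‖ₑ 1 with h | h
    · refine le_trans ?_ le_self_add
      calc _ ≤ ‖fn n x‖ₑ ^ (1:ℝ) := ENNReal.rpow_le_rpow_of_exponent_ge h (by norm_num)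
        _ = _ := ENNReal.rpow_one _
    · refine le_trans ?_ le_add_self
      exact ENNReal.rpow_le_rpow_of_exponent_le h hp.le
  have g5 := ((ENNReal.continuous_rpow_const (y := 1/2)).tendsto _).comp g4
  rw [ENNReal.zero_rpow_of_pos (by norm_num)] at g5
  refine g5.congr fun n => ?_
  simp only [Function.comp]
  rw [eLpNorm_eq_lintegral_rpow_enorm_toReal (by norm_num) ENNReal.ofReal_ne_top,
    ENNReal.toReal_ofReal (by norm_num)]

theorem tendsto_pp {α : Type*} [MeasurableSpace α] {μ : Measure α} {fn : ℕ → α → ℝ}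
    {f : α → ℝ} (hf : ∀ x, 0 ≤ f x) (hfnm : ∀ n, AEMeasurable (fn n) μ)
    (hfm : AEMeasurable f μ) (hfin : ∫⁻ x, ENNReal.ofReal (f x) ∂μ ≠ ⊤)
    (h : Tendsto (fun n => eLpNorm (fun x => fn n x - f x) 1 μ) atTop (𝓝 0)) {a : ℝ} (ha : 0 < a) :
    Tendsto (fun n => ∫⁻ x, ENNReal.ofReal (max (fn n x - a) 0) ∂μ) atTop
      (𝓝 (∫⁻ x, ENNReal.ofReal (max (f x - a) 0) ∂μ)) := by
  have := tendsto_lintegral_pow (μ := μ) (fn := fun n x => max (fn n x - a) 0)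
    (f := fun x => max (f x - a) 0) (fun _ _ => le_max_right _ _) (fun _ => le_max_right _ _)
    (fun n => ((hfnm n).sub_const a).max aemeasurable_const)
    ((hfm.sub_const a).max aemeasurable_const) (q := 1) le_rfl ?_ ?_
  · simpa using this
  · simp_rw [ENNReal.rpow_one]
    refine ((lintegral_mono fun x => ?_).trans_lt hfin.lt_top).ne
    apply ENNReal.ofReal_le_ofReal
    exact max_le (by linarith) (hf x)
  · rw [ENNReal.ofReal_one]
    refine tendsto_of_tendsto_of_tendsto_of_le_of_le tendsto_const_nhds h (fun _ => zero_le) ?_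
    intro n
    apply eLpNorm_mono
    intro x
    simp only [Real.norm_eq_abs]
    have := abs_max_sub_max_le_abs (fn n x - a) (f x - a) 0
    simpa using this

/-- all consequences of convergence of the decreasing rearrangements -/
theorem rearr_conv {p : ℝ} (hp : 2 < p) {ζ₀ : ℝ × ℝ → ℝ} {ζn : ℕ → ℝ × ℝ → ℝ}
    (h0 : ∀ x, 0 ≤ ζ₀ x) (hn : ∀ n x, 0 ≤ ζn n x) (h0i : Integrable ζ₀ μUH)
    (h0p : ∫⁻ x, oR ζ₀ x ^ p ∂μUH ≠ ⊤) (hni : ∀ n, Integrable (ζn n) μUH)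
    (hΔp : Tendsto (fun n => eLpNorm (fun s => decRearr (ζn n) s - decRearr ζ₀ s)
        (ENNReal.ofReal p) (MeasureTheory.volume.restrict (Set.Ioi (0 : ℝ))))
        atTop (nhds 0))
    (hΔ1 : Tendsto (fun n => eLpNorm (fun s => decRearr (ζn n) s - decRearr ζ₀ s)
        1 (MeasureTheory.volume.restrict (Set.Ioi (0 : ℝ)))) atTop (nhds 0)) :
    (∀ q ∈ ({1, 2, p} : Set ℝ), ∫⁻ x, oR ζ₀ x ^ q ∂μUH ≠ ⊤ ∧
      Tendsto (fun n => ∫⁻ x, oR (ζn n) x ^ q ∂μUH) atTop (𝓝 (∫⁻ x, oR ζ₀ x ^ q ∂μUH))) ∧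
    (∀ a > 0, Tendsto (fun n => ∫⁻ x, ENNReal.ofReal (max (ζn n x - a) 0) ∂μUH) atTop
      (𝓝 (∫⁻ x, ENNReal.ofReal (max (ζ₀ x - a) 0) ∂μUH))) := by
  have m0 := decRearr_aemeas h0 h0i
  have mn := fun n => decRearr_aemeas (hn n) (hni n)
  have e0 : ∀ q : ℝ, 0 < q → ∫⁻ x, oR ζ₀ x ^ q ∂μUH = _ := fun q hq =>
    lintegral_pow_equi h0 decRearr_nonneg h0i.aemeasurable m0
      (fun t ht => (decRearr_equi h0 h0i ht).symm) hq
  have en : ∀ n, ∀ q : ℝ, 0 < q → ∫⁻ x, oR (ζn n) x ^ q ∂μUH = _ := fun n q hq =>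
    lintegral_pow_equi (hn n) decRearr_nonneg (hni n).aemeasurable (mn n)
      (fun t ht => (decRearr_equi (hn n) (hni n) ht).symm) hq
  have key : ∀ q : ℝ, 1 ≤ q → ∫⁻ x, oR ζ₀ x ^ q ∂μUH ≠ ⊤ →
      Tendsto (fun n => eLpNorm (fun s => decRearr (ζn n) s - decRearr ζ₀ s)
        (ENNReal.ofReal q) (MeasureTheory.volume.restrict (Set.Ioi (0 : ℝ)))) atTop (nhds 0) →
      Tendsto (fun n => ∫⁻ x, oR (ζn n) x ^ q ∂μUH) atTop (𝓝 (∫⁻ x, oR ζ₀ x ^ q ∂μUH)) := by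
    intro q hq hfin ht
    have hq0 : 0 < q := by linarith
    rw [e0 q hq0] at hfin ⊢
    simp_rw [fun n => en n q hq0]
    exact tendsto_lintegral_pow (fun n => decRearr_nonneg) decRearr_nonneg mn m0 hq hfin ht
  have f1 : ∫⁻ x, oR ζ₀ x ^ (1:ℝ) ∂μUH ≠ ⊤ := by
    simp_rw [ENNReal.rpow_one]; exact mass_ne_top h0 h0i
  have f2 : ∫⁻ x, oR ζ₀ x ^ (2:ℝ) ∂μUH ≠ ⊤ := by
    have : ∫⁻ x, oR ζ₀ x ^ (2:ℝ) ∂μUH ≤ ∫⁻ x, oR ζ₀ x ^ (1:ℝ) ∂μUH + ∫⁻ x, oR ζ₀ x ^ p ∂μUH := by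
      rw [← lintegral_add_left' (by exact h0i.aemeasurable.ennreal_ofReal.pow_const _)]
      apply lintegral_mono
      intro x
      rcases le_total (oR ζ₀ x) 1 with h | h
      · refine le_trans ?_ le_self_add
        exact ENNReal.rpow_le_rpow_of_exponent_ge h (by norm_num)
      · refine le_trans ?_ le_add_self
        exact ENNReal.rpow_le_rpow_of_exponent_le h hp.le
    exact (this.trans_lt (ENNReal.add_lt_top.2 ⟨f1.lt_top, h0p.lt_top⟩)).ne
  refine ⟨?_, ?_⟩
  · rintro q (rfl | rfl | rfl)
    · exact ⟨f1, key 1 le_rfl f1 (by simpa using hΔ1)⟩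
    · exact ⟨f2, key 2 (by norm_num) f2
        (tendsto_eLpNorm_two (fun n => (mn n).sub m0) hp hΔ1 hΔp)⟩
    · exact ⟨h0p, key _ (by linarith) h0p hΔp⟩
  · intro a ha
    rw [lintegral_pp_equi h0i.aemeasurable m0 (fun t ht => (decRearr_equi h0 h0i ht).symm) ha]
    simp_rw [fun n => lintegral_pp_equi (hni n).aemeasurable (mn n)
      (fun t ht => (decRearr_equi (hn n) (hni n) ht).symm) ha]
    refine tendsto_pp decRearr_nonneg mn m0 ?_ hΔ1 ha
    have := e0 1 one_pos
    simp_rw [ENNReal.rpow_one] at this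
    rw [← this]
    exact mass_ne_top h0 h0i


/-- weak convergence in `L²` -/
def WConv (fn : ℕ → ℝ × ℝ → ℝ) (f : ℝ × ℝ → ℝ) : Prop :=
  ∀ g : ℝ × ℝ → ℝ, MemLp g 2 μUH →
    Tendsto (fun n => ∫ x, fn n x * g x ∂μUH) atTop (𝓝 (∫ x, f x * g x ∂μUH))

theorem lint_mul_integrable {f g : ℝ × ℝ → ℝ} (hf : MemLp f 2 μUH) (hg : MemLp g 2 μUH) :
    Integrable (fun x => f x * g x) μUH := hf.integrable_mul hg

theorem memLp_two_of_lintegral {f : ℝ × ℝ → ℝ} (hm : Measurable f) (h0 : ∀ x, 0 ≤ f x)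
    (h : ∫⁻ x, oR f x ^ (2:ℝ) ∂μUH ≠ ⊤) : MemLp f 2 μUH := by
  refine ⟨hm.aestronglyMeasurable, ?_⟩
  have := eLpNorm_nonneg_eq (μ := μUH) h0 (q := 2) (by norm_num)
  rw [show ENNReal.ofReal 2 = 2 by simp] at this
  rw [this]
  exact (ENNReal.rpow_ne_top_of_nonneg (by positivity) h).lt_top

theorem weak_compact {fn : ℕ → ℝ × ℝ → ℝ} (hm : ∀ n, Measurable (fn n)) (h0 : ∀ n x, 0 ≤ fn n x)
    {A : ℝ≥0∞} (hA : A ≠ ⊤) (hb : ∀ n, ∫⁻ x, oR (fn n) x ^ (2:ℝ) ∂μUH ≤ A) {V : Set (ℝ × ℝ)}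
    (hV : MeasurableSet V) (hfV : ∀ n, ∀ x ∉ V, fn n x = 0) :
    ∃ f : ℝ × ℝ → ℝ, Measurable f ∧ (∀ x, 0 ≤ f x) ∧ MemLp f 2 μUH ∧ (∀ x ∉ V, f x = 0) ∧
      ∃ φ : ℕ → ℕ, StrictMono φ ∧ WConv (fun k => fn (φ k)) f := by
  haveI : Fact ((2:ℝ≥0∞) ≠ ⊤) := ⟨by norm_num⟩
  have hL : ∀ n, MemLp (fn n) 2 μUH := fun n =>
    memLp_two_of_lintegral (hm n) (h0 n) ((hb n).trans_lt hA.lt_top).ne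
  set F : ℕ → Lp ℝ 2 μUH := fun n => (hL n).toLp (fn n) with hF
  have hFn : ∀ n, ‖F n‖ ≤ (A ^ (1/2 : ℝ)).toReal := by
    intro n
    rw [hF, Lp.norm_toLp]
    apply ENNReal.toReal_mono (ENNReal.rpow_ne_top_of_nonneg (by positivity) hA)
    have := eLpNorm_nonneg_eq (μ := μUH) (h0 n) (q := 2) (by norm_num)
    rw [show ENNReal.ofReal 2 = 2 by simp] at this
    rw [this]
    exact ENNReal.rpow_le_rpow (hb n) (by norm_num)
  set T : ℕ → WeakDual ℝ (Lp ℝ 2 μUH) := fun n => StrongDual.toWeakDual (innerSL ℝ (F n)) with hT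
  have hTm : ∀ n, T n ∈ WeakDual.toStrongDual ⁻¹' Metric.closedBall (0 : StrongDual ℝ (Lp ℝ 2 μUH))
      (A ^ (1/2 : ℝ)).toReal := by
    intro n
    have e : WeakDual.toStrongDual (T n) = innerSL ℝ (F n) := rfl
    rw [Set.mem_preimage, e, mem_closedBall_zero_iff, innerSL_apply_norm]
    exact hFn n
  obtain ⟨S, -, φ, hφ, hlim⟩ := WeakDual.isSeqCompact_closedBall ℝ (Lp ℝ 2 μUH) 0
    (A ^ (1/2 : ℝ)).toReal hTm
  set G : Lp ℝ 2 μUH := (InnerProductSpace.toDual ℝ (Lp ℝ 2 μUH)).symm (WeakDual.toStrongDual S)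
    with hG
  have hGL : MemLp G 2 μUH := Lp.memLp G
  have key : ∀ g : ℝ × ℝ → ℝ, MemLp g 2 μUH →
    Tendsto (fun n => ∫ x, fn (φ n) x * g x ∂μUH) atTop (𝓝 (∫ x, G x * g x ∂μUH)) := by
    intro g hg
    have h1 := ((WeakDual.eval_continuous (𝕜 := ℝ) (hg.toLp g)).tendsto S).comp hlim
    have e1 : S (hg.toLp g) = ∫ x, G x * g x ∂μUH := by
      have : S (hg.toLp g) = inner ℝ G (hg.toLp g) := by
        rw [hG, InnerProductSpace.toDual_symm_apply]; rfl
      rw [this, L2.inner_def]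
      apply integral_congr_ae
      filter_upwards [hg.coeFn_toLp] with x hx
      rw [hx]; simp [mul_comm]
    rw [e1] at h1
    refine h1.congr fun n => ?_
    have : (T (φ n)) (hg.toLp g) = inner ℝ (F (φ n)) (hg.toLp g) := rfl
    simp only [Function.comp]
    rw [this, L2.inner_def]
    apply integral_congr_ae
    filter_upwards [hg.coeFn_toLp, (hL (φ n)).coeFn_toLp] with x hx hx2
    rw [hx, hF, hx2]; simp [mul_comm]
  have hGm : Measurable G := (Lp.stronglyMeasurable G).measurable
  set f : ℝ × ℝ → ℝ := V.indicator (fun x => max (G x) 0) with hf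
  have hfm : Measurable f := (hGm.max measurable_const).indicator hV
  have hf0 : ∀ x, 0 ≤ f x := fun x => Set.indicator_nonneg (fun _ _ => le_max_right _ _) x
  have hfL : MemLp f 2 μUH := by
    refine hGL.mono hfm.aestronglyMeasurable (Eventually.of_forall fun x => ?_)
    rw [hf]
    by_cases hx : x ∈ V
    · rw [Set.indicator_of_mem hx, Real.norm_eq_abs, Real.norm_eq_abs, abs_of_nonneg (le_max_right _ _)]
      exact max_le (le_abs_self _) (abs_nonneg _)
    · rw [Set.indicator_of_notMem hx]; simp
  have hfG : f =ᵐ[μUH] G := by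
    have hd : MemLp (fun x => f x - G x) 2 μUH := hfL.sub hGL
    have h1 := key _ hd
    have h2 : 0 ≤ ∫ x, G x * (f x - G x) ∂μUH := by
      refine ge_of_tendsto' h1 fun n => ?_
      apply integral_nonneg
      intro x
      by_cases hx : x ∈ V
      · apply mul_nonneg (h0 _ _)
        rw [hf, Set.indicator_of_mem hx]
        have := le_max_left (G x) 0
        linarith
      · simp [hfV _ x hx]
    have h3 : ∀ x, (f x - G x) ^ 2 = - (G x * (f x - G x)) := by
      intro x
      rw [hf]
      by_cases hx : x ∈ V
      · rw [Set.indicator_of_mem hx]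
        rcases le_total (G x) 0 with h | h
        · rw [max_eq_right h]; ring
        · rw [max_eq_left h]; ring
      · rw [Set.indicator_of_notMem hx]; ring
    have h4 : ∫ x, (f x - G x) ^ 2 ∂μUH = 0 := by
      apply le_antisymm
      · simp_rw [h3]; rw [integral_neg]; linarith
      · exact integral_nonneg fun x => sq_nonneg _
    rw [integral_eq_zero_iff_of_nonneg (fun x => sq_nonneg _) hd.integrable_sq] at h4
    filter_upwards [h4] with x hx
    have : (f x - G x) ^ 2 = 0 := hx
    have := pow_eq_zero_iff (n := 2) (by norm_num) |>.1 this
    linarith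
  refine ⟨f, hfm, hf0, hfL, fun x hx => Set.indicator_of_notMem hx _, φ, hφ, ?_⟩
  intro g hg
  have e : ∫ x, f x * g x ∂μUH = ∫ x, G x * g x ∂μUH := by
    apply integral_congr_ae
    filter_upwards [hfG] with x hx
    rw [hx]
  rw [e]
  exact key g hg


/-- a weakly convergent sequence of nonnegative functions, with bounds -/
structure WSeq (A C : ℝ≥0∞) (fn : ℕ → ℝ × ℝ → ℝ) (f : ℝ × ℝ → ℝ) : Prop where
  hA : A ≠ ⊤
  hC : C ≠ ⊤
  mn : ∀ n, Measurable (fn n)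
  nn : ∀ n x, 0 ≤ fn n x
  mf : Measurable f
  nf : ∀ x, 0 ≤ f x
  l2n : ∀ n, ∫⁻ x, oR (fn n) x ^ (2:ℝ) ∂μUH ≤ A
  l2f : MemLp f 2 μUH
  massn : ∀ n, ∫⁻ x, oR (fn n) x ∂μUH ≤ C
  conv : WConv fn f

section
variable {A C : ℝ≥0∞} {fn : ℕ → ℝ × ℝ → ℝ} {f : ℝ × ℝ → ℝ}

theorem WSeq.memn (h : WSeq A C fn f) (n : ℕ) : MemLp (fn n) 2 μUH :=
  memLp_two_of_lintegral (h.mn n) (h.nn n) ((h.l2n n).trans_lt h.hA.lt_top).ne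

theorem measurable_oR {g : ℝ × ℝ → ℝ} (h : Measurable g) : Measurable (oR g) := h.ennreal_ofReal

theorem lintegral_oR_mul {g v : ℝ × ℝ → ℝ} (hg : ∀ x, 0 ≤ g x) (hv : ∀ x, 0 ≤ v x)
    (h : Integrable (fun x => g x * v x) μUH) :
    ∫⁻ x, oR g x * ENNReal.ofReal (v x) ∂μUH = ENNReal.ofReal (∫ x, g x * v x ∂μUH) := by
  rw [ofReal_integral_eq_lintegral_ofReal h (Eventually.of_forall fun x => mul_nonneg (hg x) (hv x))]
  congr 1
  ext x
  rw [ENNReal.ofReal_mul (hg x)]; rfl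

theorem memLp_two_bdd {v : ℝ × ℝ → ℝ} (hv : Measurable v) {Q : Set (ℝ × ℝ)}
    (hQ' : μUH Q ≠ ⊤) {b : ℝ} (hb : ∀ x, |v x| ≤ b) (h0 : ∀ x ∉ Q, v x = 0) : MemLp v 2 μUH := by
  have h1 : MemLp v ⊤ μUH := memLp_top_of_bound hv.aestronglyMeasurable b
    (Eventually.of_forall fun x => by simpa using hb x)
  exact h1.mono_exponent_of_measure_support_ne_top h0 hQ' le_top

theorem WSeq.lsc (h : WSeq A C fn f) {w : ℝ × ℝ → ℝ≥0∞} (hw : Measurable w) {B : ℝ≥0∞}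
    (hB : ∀ᶠ n in atTop, ∫⁻ x, oR (fn n) x * w x ∂μUH ≤ B) : ∫⁻ x, oR f x * w x ∂μUH ≤ B := by
  by_cases hBt : B = ⊤
  · rw [hBt]; exact le_top
  set v : ℕ → ℝ × ℝ → ℝ := fun m => (Metric.closedBall 0 (m:ℝ)).indicator
    (fun x => (min (w x) m).toReal) with hv
  have hvm : ∀ m, Measurable (v m) := fun m =>
    ((hw.min measurable_const).ennreal_toReal).indicator Metric.isClosed_closedBall.measurableSet
  have hv0 : ∀ m x, 0 ≤ v m x := fun m x =>
    Set.indicator_nonneg (fun _ _ => ENNReal.toReal_nonneg) x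
  have hvL : ∀ m, MemLp (v m) 2 μUH := by
    intro m
    refine memLp_two_bdd (hvm m) (Q := Metric.closedBall 0 (m:ℝ)) (b := m) ?_ ?_ ?_
    · refine ((Measure.restrict_apply_le _ _).trans_lt ?_).ne
      exact (isCompact_closedBall _ _).measure_lt_top
    · intro x
      rw [abs_of_nonneg (hv0 m x)]
      simp only [hv, Set.indicator]
      split_ifs
      swap
      · positivity
      have : (min (w x) m).toReal ≤ (m : ℝ≥0∞).toReal := ENNReal.toReal_mono (by simp) (min_le_right _ _)
      simpa using this
    · intro x hx
      exact Set.indicator_of_notMem hx _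
  have hvw : ∀ m x, ENNReal.ofReal (v m x) ≤ w x := by
    intro m x
    simp only [hv, Set.indicator]
    split_ifs
    · rw [ENNReal.ofReal_toReal (by simp)]; exact min_le_left _ _
    · simp
  have hstep : ∀ m, ∫⁻ x, oR f x * ENNReal.ofReal (v m x) ∂μUH ≤ B := by
    intro m
    have h1 := h.conv _ (hvL m)
    rw [lintegral_oR_mul h.nf (hv0 m) (lint_mul_integrable h.l2f (hvL m))]
    refine le_of_tendsto (ENNReal.tendsto_ofReal h1) ?_
    filter_upwards [hB] with n hn
    rw [← lintegral_oR_mul (h.nn n) (hv0 m) (lint_mul_integrable (h.memn n) (hvL m))]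
    refine le_trans (lintegral_mono fun x => ?_) hn
    gcongr
    exact hvw m x
  have hpt : ∀ x, Tendsto (fun m => oR f x * ENNReal.ofReal (v m x)) atTop (𝓝 (oR f x * w x)) := by
    intro x
    refine ENNReal.Tendsto.const_mul ?_ (Or.inr ENNReal.ofReal_ne_top)
    have h1 : Tendsto (fun m : ℕ => min (w x) (m : ℝ≥0∞)) atTop (𝓝 (min (w x) ⊤)) :=
      tendsto_const_nhds.min ENNReal.tendsto_nat_nhds_top
    rw [min_top_right] at h1
    refine h1.congr' ?_
    filter_upwards [eventually_ge_atTop ⌈‖x‖⌉₊] with m hm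
    have : x ∈ Metric.closedBall (0 : ℝ × ℝ) (m:ℝ) := by
      rw [mem_closedBall_zero_iff]
      exact (Nat.le_ceil _).trans (by exact_mod_cast hm)
    simp only [hv, Set.indicator_of_mem this]
    rw [ENNReal.ofReal_toReal (by simp)]
  calc ∫⁻ x, oR f x * w x ∂μUH
      = ∫⁻ x, liminf (fun m => oR f x * ENNReal.ofReal (v m x)) atTop ∂μUH := by
        congr 1; ext x; exact (hpt x).liminf_eq.symm
    _ ≤ liminf (fun m => ∫⁻ x, oR f x * ENNReal.ofReal (v m x) ∂μUH) atTop :=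
        lintegral_liminf_le fun m => (measurable_oR h.mf).mul (hvm m).ennreal_ofReal
    _ ≤ liminf (fun _ : ℕ => B) atTop := liminf_le_liminf (Eventually.of_forall hstep)
    _ = B := liminf_const B

theorem WSeq.mass (h : WSeq A C fn f) : ∫⁻ x, oR f x ∂μUH ≤ C := by
  have := h.lsc (w := fun _ => 1) measurable_const (B := C)
    (Eventually.of_forall fun n => by simpa using h.massn n)
  simpa using this

theorem WSeq.good (h : WSeq A C fn f) {ω : ℝ → ℝ≥0∞} (hG : ∀ n, Good ω C (oR (fn n))) :
    Good ω C (oR f) := by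
  refine ⟨measurable_oR h.mf, h.mass, ?_, ?_⟩
  · exact h.lsc (by fun_prop) (Eventually.of_forall fun n => (hG n).imp)
  · intro r hr x
    simp_rw [mul_comm (pK r x _)]
    refine h.lsc (measurable_slice (measurable_pK r) x) (Eventually.of_forall fun n => ?_)
    simp_rw [mul_comm _ (pK r x _)]
    exact (hG n).pot r hr x

theorem WSeq.pp (h : WSeq A C fn f) {a : ℝ} (ha : 0 < a) {B : ℝ≥0∞} {Bn : ℕ → ℝ≥0∞}
    (hBn : Tendsto Bn atTop (𝓝 B)) (hle : ∀ n, ∫⁻ x, ENNReal.ofReal (max (fn n x - a) 0) ∂μUH ≤ Bn n) :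
    ∫⁻ x, ENNReal.ofReal (max (f x - a) 0) ∂μUH ≤ B := by
  by_cases hBt : B = ⊤
  · rw [hBt]; exact le_top
  have hS : MeasurableSet {x | a < f x} := measurableSet_lt measurable_const h.mf
  set S := {x | a < f x} with hSd
  have hint : Integrable f μUH := integrable_of_lt_top h.mf h.nf (h.mass.trans_lt h.hC.lt_top).ne
  have hSt : μUH S ≠ ⊤ := meas_gt_ne_top h.nf hint ha
  have e1 : ∀ g : ℝ × ℝ → ℝ, (∀ x, 0 ≤ g x) → ∫⁻ x, oR g x * S.indicator 1 x ∂μUH ≤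
      ENNReal.ofReal a * μUH S + ∫⁻ x, ENNReal.ofReal (max (g x - a) 0) ∂μUH := by
    intro g hg
    rw [← lintegral_indicator_const hS, ← lintegral_add_left (measurable_const.indicator hS)]
    apply lintegral_mono
    intro x
    by_cases hx : x ∈ S
    · simp only [Set.indicator_of_mem hx, Pi.one_apply, mul_one, oR]
      rw [← ENNReal.ofReal_add ha.le (le_max_right _ _)]
      apply ENNReal.ofReal_le_ofReal
      have := le_max_left (g x - a) 0
      linarith
    · simp [Set.indicator_of_notMem hx]
  have e2 : ∫⁻ x, oR f x * S.indicator 1 x ∂μUH =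
      ENNReal.ofReal a * μUH S + ∫⁻ x, ENNReal.ofReal (max (f x - a) 0) ∂μUH := by
    rw [← lintegral_indicator_const hS, ← lintegral_add_left (measurable_const.indicator hS)]
    congr 1; ext x
    by_cases hx : x ∈ S
    · have hx' : a < f x := hx
      simp only [Set.indicator_of_mem hx, Pi.one_apply, mul_one, oR]
      rw [← ENNReal.ofReal_add ha.le (le_max_right _ _), max_eq_left (by linarith)]
      congr 1; ring
    · have hx' : ¬ a < f x := hx
      simp [Set.indicator_of_notMem hx, not_lt.1 hx']
  refine ENNReal.le_of_forall_pos_le_add fun δ hδ _ => ?_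
  have h3 := h.lsc (w := S.indicator 1) (measurable_one.indicator hS)
    (B := ENNReal.ofReal a * μUH S + (B + δ)) ?_
  · rw [e2] at h3
    exact (ENNReal.add_le_add_iff_left (ENNReal.mul_ne_top ENNReal.ofReal_ne_top hSt)).1 h3
  · have : B < B + δ := ENNReal.lt_add_right hBt (by simpa using hδ.ne')
    filter_upwards [hBn.eventually_le_const this] with n hn
    refine (e1 _ (h.nn n)).trans ?_
    gcongr
    exact (hle n).trans hn

theorem WSeq.conv_BK (h : WSeq A C fn f) {K : ℝ × ℝ → ℝ × ℝ → ℝ≥0∞}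
    (hK : Measurable (fun z : (ℝ × ℝ) × (ℝ × ℝ) => K z.1 z.2)) {Q : Set (ℝ × ℝ)}
    (hQ' : μUH Q ≠ ⊤) {b : ℝ≥0∞} (hb : b ≠ ⊤) (hKb : ∀ x y, K x y ≤ b)
    (hKQ : ∀ x y, ¬ (x ∈ Q ∧ y ∈ Q) → K x y = 0) :
    Tendsto (fun n => BK K (oR (fn n))) atTop (𝓝 (BK K (oR f))) := by
  set U : (ℝ × ℝ → ℝ) → ℝ × ℝ → ℝ≥0∞ := fun g x => ∫⁻ y, K x y * oR g y ∂μUH with hU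
  have hUm : ∀ g, Measurable g → Measurable (U g) := fun g hg => measurable_inner hK (measurable_oR hg)
  have hUb : ∀ g, ∫⁻ x, oR g x ∂μUH ≤ C → ∀ x, U g x ≤ b * C := by
    intro g hg x
    calc U g x ≤ ∫⁻ y, b * oR g y ∂μUH := lintegral_mono fun y => by gcongr; exact hKb x y
      _ = b * ∫⁻ y, oR g y ∂μUH := lintegral_const_mul' _ _ hb
      _ ≤ _ := by gcongr
  have hbC : b * C ≠ ⊤ := ENNReal.mul_ne_top hb h.hC
  have hU0 : ∀ g, ∀ x ∉ Q, U g x = 0 := by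
    intro g x hx
    have : ∀ y, K x y * oR g y = 0 := fun y => by
      rw [hKQ x y (fun h => hx h.1), zero_mul]
    show ∫⁻ y, K x y * oR g y ∂μUH = 0
    rw [lintegral_congr this]; exact lintegral_zero
  set u : (ℝ × ℝ → ℝ) → ℝ × ℝ → ℝ := fun g x => (U g x).toReal with hu
  have hum : ∀ g, Measurable g → Measurable (u g) := fun g hg => (hUm g hg).ennreal_toReal
  have huL : ∀ g, Measurable g → ∫⁻ x, oR g x ∂μUH ≤ C → MemLp (u g) 2 μUH := by
    intro g hg hgC
    refine memLp_two_bdd (hum g hg) hQ' (b := (b * C).toReal) ?_ ?_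
    · intro x
      rw [abs_of_nonneg ENNReal.toReal_nonneg]
      exact ENNReal.toReal_mono hbC (hUb g hgC x)
    · intro x hx
      simp [hu, hU0 g x hx]
  have hBK : ∀ g, Measurable g → (∀ x, 0 ≤ g x) → MemLp g 2 μUH → ∫⁻ x, oR g x ∂μUH ≤ C →
      BK K (oR g) = ENNReal.ofReal (∫ x, g x * u g x ∂μUH) := by
    intro g hg hg0 hgL hgC
    rw [← lintegral_oR_mul hg0 (fun x => ENNReal.toReal_nonneg)
      (lint_mul_integrable hgL (huL g hg hgC))]
    unfold BK
    refine lintegral_congr fun x => ?_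
    have e : ENNReal.ofReal (u g x) = U g x :=
      ENNReal.ofReal_toReal ((hUb g hgC x).trans_lt hbC.lt_top).ne
    rw [e]
  rw [hBK f h.mf h.nf h.l2f h.mass]
  simp_rw [fun n => hBK (fn n) (h.mn n) (h.nn n) (h.memn n) (h.massn n)]
  apply ENNReal.tendsto_ofReal
  -- pointwise convergence of potentials
  have hpt : ∀ x, Tendsto (fun n => u (fn n) x) atTop (𝓝 (u f x)) := by
    intro x
    have hk : MemLp (fun y => (K x y).toReal) 2 μUH := by
      refine memLp_two_bdd (measurable_slice hK x).ennreal_toReal hQ' (b := b.toReal) ?_ ?_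
      · intro y
        rw [abs_of_nonneg ENNReal.toReal_nonneg]
        exact ENNReal.toReal_mono hb (hKb x y)
      · intro y hy
        simp [hKQ x y (fun h => hy h.2)]
    have e : ∀ g, (∀ x, 0 ≤ g x) → MemLp g 2 μUH → u g x = ∫ y, g y * (K x y).toReal ∂μUH := by
      intro g hg0 hgL
      have := lintegral_oR_mul hg0 (fun y => ENNReal.toReal_nonneg) (lint_mul_integrable hgL hk)
      have e2 : U g x = ∫⁻ y, oR g y * ENNReal.ofReal (K x y).toReal ∂μUH := by
        simp only [hU]
        congr 1; ext y
        rw [ENNReal.ofReal_toReal ((hKb x y).trans_lt hb.lt_top).ne, mul_comm]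
      simp only [hu]
      rw [e2, this, ENNReal.toReal_ofReal]
      exact integral_nonneg fun y => mul_nonneg (hg0 y) ENNReal.toReal_nonneg
    rw [e f h.nf h.l2f]
    simp_rw [fun n => e (fn n) (h.nn n) (h.memn n)]
    exact h.conv _ hk
  have h1 := h.conv _ (huL f h.mf h.mass)
  have h2 : Tendsto (fun n => ∫ x, fn n x * (u (fn n) x - u f x) ∂μUH) atTop (𝓝 0) := by
    rw [tendsto_zero_iff_norm_tendsto_zero]
    have hD : Tendsto (fun n => ∫⁻ x, (‖u (fn n) x - u f x‖ₑ) ^ (2:ℝ) ∂μUH) atTop (𝓝 0) := by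
      have := tendsto_lintegral_of_dominated_convergence (μ := μUH)
        (F := fun n x => (‖u (fn n) x - u f x‖ₑ) ^ (2:ℝ)) (f := fun _ => 0)
        ((toMeasurable μUH Q).indicator fun _ => (b * C + b * C) ^ (2:ℝ)) ?_ ?_ ?_ ?_
      · simpa using this
      · intro n
        exact (((hum _ (h.mn n)).sub (hum _ h.mf)).enorm).pow_const _
      · intro n
        refine Eventually.of_forall fun x => ?_
        by_cases hx : x ∈ toMeasurable μUH Q
        · simp only [Set.indicator_of_mem hx]
          gcongr
          refine (enorm_sub_le).trans ?_
          have e : ∀ g, ∫⁻ x, oR g x ∂μUH ≤ C → ‖u g x‖ₑ ≤ b * C := by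
            intro g hg
            simp only [hu]
            rw [Real.enorm_eq_ofReal ENNReal.toReal_nonneg]
            exact ENNReal.ofReal_toReal_le.trans (hUb g hg x)
          gcongr
          · exact e _ (h.massn n)
          · exact e _ h.mass
        · have hx' : x ∉ Q := fun hh => hx (subset_toMeasurable _ _ hh)
          simp [hu, hU0 _ x hx']
      · rw [lintegral_indicator_const (measurableSet_toMeasurable _ _), measure_toMeasurable]
        refine ENNReal.mul_ne_top (ENNReal.rpow_ne_top_of_nonneg (by norm_num) ?_) hQ'
        exact ENNReal.add_ne_top.2 ⟨hbC, hbC⟩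
      · refine Eventually.of_forall fun x => ?_
        have h3 := ((hpt x).sub_const (u f x)).enorm
        have h4 := ((ENNReal.continuous_rpow_const (y := 2)).tendsto _).comp h3
        simpa [Function.comp_def] using h4
    have hD2 := ((ENNReal.continuous_rpow_const (y := 1/2)).tendsto _).comp hD
    rw [ENNReal.zero_rpow_of_pos (by norm_num)] at hD2
    have hD3 := ENNReal.Tendsto.const_mul (a := A ^ (1/2:ℝ)) hD2
      (Or.inr (ENNReal.rpow_ne_top_of_nonneg (by norm_num) h.hA))
    rw [mul_zero] at hD3
    have hD4 := (ENNReal.tendsto_toReal ENNReal.zero_ne_top).comp hD3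
    rw [ENNReal.toReal_zero] at hD4
    refine tendsto_of_tendsto_of_tendsto_of_le_of_le' tendsto_const_nhds hD4
      (Eventually.of_forall fun _ => norm_nonneg _) ?_
    have hfin := hD3.eventually_lt_const (show (0:ℝ≥0∞) < 1 by norm_num)
    filter_upwards [hfin] with n hn
    have hlt := (hn.trans ENNReal.one_lt_top).ne
    simp only [Function.comp] at hlt ⊢
    rw [← toReal_enorm]
    apply ENNReal.toReal_mono hlt
    refine (enorm_integral_le_lintegral_enorm _).trans ?_
    simp_rw [enorm_mul]
    have hpq : (2:ℝ).HolderConjugate 2 := Real.HolderConjugate.two_two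
    refine (ENNReal.lintegral_mul_le_Lp_mul_Lq μUH hpq (h.mn n).enorm.aemeasurable
      ((hum _ (h.mn n)).sub (hum _ h.mf)).enorm.aemeasurable).trans ?_
    refine mul_le_mul' (ENNReal.rpow_le_rpow ?_ (by norm_num)) le_rfl
    refine le_trans (le_of_eq ?_) (h.l2n n)
    congr 1; ext x
    rw [Real.enorm_eq_ofReal (h.nn n x)]; rfl
  have h3 := h1.add h2
  rw [add_zero] at h3
  refine h3.congr fun n => ?_
  have i2 : Integrable (fun x => fn n x * (u (fn n) x - u f x)) μUH :=
    lint_mul_integrable (h.memn n) ((huL _ (h.mn n) (h.massn n)).sub (huL f h.mf h.mass))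
  rw [← integral_add (lint_mul_integrable (h.memn n) (huL f h.mf h.mass)) i2]
  congr 1; ext x; ring

theorem box_finite (a b H : ℝ) : μUH {x : ℝ × ℝ | a ≤ x.1 ∧ x.1 ≤ b ∧ 0 < x.2 ∧ x.2 ≤ H} ≠ ⊤ := by
  have hsub : {x : ℝ × ℝ | a ≤ x.1 ∧ x.1 ≤ b ∧ 0 < x.2 ∧ x.2 ≤ H} ⊆ Set.Icc a b ×ˢ Set.Icc 0 H := by
    rintro x ⟨h1, h2, h3, h4⟩
    exact ⟨⟨h1, h2⟩, ⟨h3.le, h4⟩⟩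
  refine ((measure_mono hsub).trans_lt ((Measure.restrict_apply_le _ _).trans_lt ?_)).ne
  exact (isCompact_Icc.prod isCompact_Icc).measure_lt_top

theorem WSeq.usc (h : WSeq A C fn f) {ω : ℝ → ℝ≥0∞} (hω0 : Tendsto ω (𝓝[>] 0) (𝓝 0))
    (hG : ∀ n, Good ω C (oR (fn n))) (hω1 : ω 1 ≠ ⊤) {W : ℝ}
    (hV : ∀ n x, ¬ (0 ≤ x.1 ∧ x.1 ≤ W) → fn n x = 0) {θ : ℝ≥0∞} (hθ : 0 < θ) :
    ∀ᶠ n in atTop, BK gE (oR (fn n)) ≤ BK gE (oR f) + θ := by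
  have hθ2 : 0 < θ / 2 := ENNReal.half_pos hθ.ne'
  obtain ⟨r, hr, H, hH, htr⟩ := exists_trunc (ω := ω) hω0 h.hC hθ2
  have hH0 : 0 < H := by linarith
  set Q := {x : ℝ × ℝ | 0 ≤ x.1 ∧ x.1 ≤ W ∧ 0 < x.2 ∧ x.2 ≤ H} with hQ
  have hQm : MeasurableSet Q := by
    refine (measurableSet_le measurable_const measurable_fst).inter
      ((measurableSet_le measurable_fst measurable_const).inter
      ((measurableSet_lt measurable_const measurable_snd).inter
      (measurableSet_le measurable_snd measurable_const)))
  set K : ℝ × ℝ → ℝ × ℝ → ℝ≥0∞ := fun x y => (Q ×ˢ Q).indicator (fun z => gT r H z.1 z.2) (x, y)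
    with hK
  have hKm : Measurable (fun z : (ℝ × ℝ) × (ℝ × ℝ) => K z.1 z.2) :=
    (measurable_gT r H).indicator (hQm.prod hQm)
  have hKle : ∀ x y, K x y ≤ gE x y := by
    intro x y
    simp only [hK, Set.indicator, gT]
    split_ifs
    · exact le_rfl
    · exact zero_le
    · exact zero_le
  have hlim := h.conv_BK hKm (Q := Q) (box_finite _ _ _) (b := ENNReal.ofReal (H / r))
    ENNReal.ofReal_ne_top ?_ ?_
  · have hBt : BK K (oR f) ≠ ⊤ := by
      refine ((BK_mono (fun x y _ _ => hKle x y) fun _ => le_rfl).trans_lt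
        ((h.good hG).BK_lt_top hω1 h.hC)).ne
    have := hlim.eventually_le_const (ENNReal.lt_add_right hBt hθ2.ne')
    filter_upwards [this] with n hn
    calc BK gE (oR (fn n)) ≤ BK (gT r H) (oR (fn n)) + θ / 2 :=
          ((hG n).BK_trunc hr hH0).trans (add_le_add_right htr _)
      _ = BK K (oR (fn n)) + θ / 2 := by
          congr 1
          unfold BK
          apply lintegral_congr_ae
          filter_upwards [ae_UHP] with x hx
          by_cases hxV : 0 ≤ x.1 ∧ x.1 ≤ W
          · congr 1
            apply lintegral_congr_ae
            filter_upwards [ae_UHP] with y hy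
            by_cases hyV : 0 ≤ y.1 ∧ y.1 ≤ W
            · congr 1
              simp only [hK, Set.indicator, gT]
              by_cases hT : TSet r H x y
              · have : (x, y) ∈ Q ×ˢ Q :=
                  ⟨⟨hxV.1, hxV.2, hx, hT.2.2.1⟩, ⟨hyV.1, hyV.2, hy, hT.2.2.2⟩⟩
                simp [this]
              · simp [hT]
            · simp [oR, hV n y hyV]
          · simp [oR, hV n x hxV]
      _ ≤ (BK K (oR f) + θ / 2) + θ / 2 := by gcongr
      _ = BK K (oR f) + θ := by rw [add_assoc, ENNReal.add_halves]
      _ ≤ _ := by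
          gcongr
          exact BK_mono (fun x y _ _ => hKle x y) fun _ => le_rfl
  · intro x y
    simp only [hK, Set.indicator]
    split_ifs with hxy
    · exact gT_le hxy.1.2.2.1 hxy.2.2.2.1 hr hH0
    · exact zero_le
  · intro x y hxy
    simp only [hK, Set.indicator]
    exact if_neg hxy
end


/-- index of the vertical cell containing `x` -/
def cellIdx (R : ℝ) (x : ℝ × ℝ) : ℤ := ⌊x.1 / R⌋

def cell (R : ℝ) (j : ℤ) : Set (ℝ × ℝ) := {x | cellIdx R x = j}

theorem measurable_cellIdx (R : ℝ) : Measurable (cellIdx R) :=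
  Int.measurable_floor.comp (measurable_fst.div_const R)

theorem measurableSet_cell (R : ℝ) (j : ℤ) : MeasurableSet (cell R j) :=
  measurable_cellIdx R (measurableSet_singleton j)

theorem cell_disjoint (R : ℝ) {i j : ℤ} (h : i ≠ j) : Disjoint (cell R i) (cell R j) := by
  rw [Set.disjoint_left]
  intro x hx hy
  exact h (hx.symm.trans hy)

theorem mem_cell {R : ℝ} (hR : 0 < R) {x : ℝ × ℝ} {j : ℤ} :
    x ∈ cell R j ↔ j * R ≤ x.1 ∧ x.1 < (j + 1) * R := by
  show ⌊x.1 / R⌋ = j ↔ _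
  rw [Int.floor_eq_iff, le_div_iff₀ hR, div_lt_iff₀ hR]

/-- translation in the first variable -/
def shift (s : ℝ) (x : ℝ × ℝ) : ℝ × ℝ := (x.1 + s, x.2)

theorem shift_emb (s : ℝ) : MeasurableEmbedding (shift s) := by
  have : shift s = fun x => x + (s, 0) := by
    ext x <;> simp [shift]
  rw [this]
  exact measurableEmbedding_addRight _

theorem shift_mp (s : ℝ) : MeasurePreserving (shift s) μUH μUH := by
  have h : MeasurePreserving (shift s) (volume : Measure (ℝ × ℝ)) volume := by
    have : shift s = fun x => x + (s, 0) := by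
      ext x <;> simp [shift]
    rw [this]
    exact measurePreserving_add_right _ _
  have h2 := h.restrict_preimage measurableSet_UHP
  have h3 : shift s ⁻¹' UHP = UHP := by ext x; simp [shift, UHP]
  rw [h3] at h2
  exact h2

theorem setLIntegral_shift (s : ℝ) (S : Set (ℝ × ℝ)) (F : ℝ × ℝ → ℝ≥0∞) :
    ∫⁻ x in shift s ⁻¹' S, F (shift s x) ∂μUH = ∫⁻ x in S, F x ∂μUH :=
  (shift_mp s).setLIntegral_comp_preimage_emb (shift_emb s) F S

theorem lintegral_shift (s : ℝ) (F : ℝ × ℝ → ℝ≥0∞) :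
    ∫⁻ x, F (shift s x) ∂μUH = ∫⁻ x, F x ∂μUH :=
  (shift_mp s).lintegral_comp_emb (shift_emb s) F

theorem shift_preimage_cell {R : ℝ} (hR : 0 < R) (i j : ℤ) :
    shift ((j - i) * R) ⁻¹' cell R j = cell R i := by
  ext x
  rw [Set.mem_preimage, mem_cell hR, mem_cell hR]
  simp only [shift]
  constructor
  · rintro ⟨h1, h2⟩; constructor <;> nlinarith
  · rintro ⟨h1, h2⟩; constructor <;> nlinarith

/-- measure-preserving folding of a union of strips onto another, not increasing Green energies -/
structure Fold (Φ : ℝ × ℝ → ℝ × ℝ) (V U : Set (ℝ × ℝ)) : Prop where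
  mV : MeasurableSet V
  mU : MeasurableSet U
  mΦ : Measurable Φ
  cov : ∀ F : ℝ × ℝ → ℝ≥0∞, ∫⁻ x in V, F (Φ x) ∂μUH = ∫⁻ x in U, F x ∂μUH
  snd : ∀ x, (Φ x).2 = x.2

def foldV (R : ℝ) (N : ℕ) : Set (ℝ × ℝ) := {x | ∃ j ∈ Finset.range N, cellIdx R x = (j : ℤ)}
def foldU (R : ℝ) (N : ℕ) (k : ℕ → ℤ) : Set (ℝ × ℝ) := {x | ∃ j ∈ Finset.range N, cellIdx R x = k j}
def foldΦ (R : ℝ) (k : ℕ → ℤ) (x : ℝ × ℝ) : ℝ × ℝ :=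
  shift ((k (cellIdx R x).toNat - cellIdx R x) * R) x

/-- spreading-out index map -/
def Spread (N : ℕ) (k : ℕ → ℤ) : Prop := ∀ i j : ℕ, i < j → j < N → (j : ℤ) - i ≤ k j - k i

theorem fold_fold {R : ℝ} (hR : 0 < R) {N : ℕ} {k : ℕ → ℤ} (hk : Spread N k) :
    Fold (foldΦ R k) (foldV R N) (foldU R N k) := by
  have eV : foldV R N = ⋃ j ∈ Finset.range N, cell R (j : ℤ) := by
    ext x; simp [foldV, cell]
  have eU : foldU R N k = ⋃ j ∈ Finset.range N, cell R (k j) := by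
    ext x; simp [foldU, cell]
  have hc : Measurable fun x : ℝ × ℝ => ((k (cellIdx R x).toNat : ℤ) - cellIdx R x : ℝ) := by
    have : Measurable fun j : ℤ => ((k j.toNat : ℤ) - j : ℝ) := measurable_from_top
    exact this.comp (measurable_cellIdx R)
  have hinj : ∀ i j : ℕ, i < N → j < N → i ≠ j → k i ≠ k j := by
    intro i j hi hj hij
    rcases lt_or_gt_of_ne hij with h | h
    · have := hk i j h hj; omega
    · have := hk j i h hi; omega
  refine ⟨?_, ?_, ?_, ?_, fun x => rfl⟩
  · rw [eV]
    exact Finset.measurableSet_biUnion _ fun j _ => measurableSet_cell R _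
  · rw [eU]
    exact Finset.measurableSet_biUnion _ fun j _ => measurableSet_cell R _
  · exact (measurable_fst.add (hc.mul_const R)).prodMk measurable_snd
  · intro F
    rw [eV, eU, lintegral_biUnion_finset, lintegral_biUnion_finset]
    · refine Finset.sum_congr rfl fun j hj => ?_
      rw [← setLIntegral_shift ((k j - (j : ℤ)) * R) (cell R (k j)), shift_preimage_cell hR]
      refine setLIntegral_congr_fun (measurableSet_cell R _) fun x hx => ?_
      have hx' : cellIdx R x = (j : ℤ) := hx
      simp only [foldΦ, hx', Int.toNat_natCast]
    · intro i hi j hj hij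
      exact cell_disjoint R (hinj i j (by simpa using hi) (by simpa using hj) hij)
    · exact fun j _ => measurableSet_cell R _
    · intro i hi j hj hij
      exact cell_disjoint R (by exact_mod_cast hij)
    · exact fun j _ => measurableSet_cell R _

theorem foldΦ_spread {R : ℝ} (hR : 0 < R) {N : ℕ} {k : ℕ → ℤ} (hk : Spread N k) {x y : ℝ × ℝ}
    (hx : x ∈ foldV R N) (hy : y ∈ foldV R N) :
    |x.1 - y.1| ≤ |(foldΦ R k x).1 - (foldΦ R k y).1| := by
  have key : ∀ x y : ℝ × ℝ, ∀ i j : ℕ, i < j → j < N → cellIdx R x = (i:ℤ) → cellIdx R y = (j : ℤ) →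
      |x.1 - y.1| ≤ |(foldΦ R k x).1 - (foldΦ R k y).1| := by
    intro x y i j hij hj hxi hyj
    simp only [foldΦ, shift, hxi, hyj, Int.toNat_natCast]
    have h1 := (mem_cell hR).1 (show x ∈ cell R (i:ℤ) from hxi)
    have h2 := (mem_cell hR).1 (show y ∈ cell R (j:ℤ) from hyj)
    have h3 : ((j:ℤ) - (i:ℤ) : ℝ) ≤ k j - k i := by exact_mod_cast hk i j hij hj
    have h4 : ((i:ℤ):ℝ) + 1 ≤ (j:ℤ) := by exact_mod_cast hij
    have h5 : x.1 ≤ y.1 := by nlinarith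
    rw [abs_sub_comm, abs_of_nonneg (by linarith), abs_sub_comm]
    refine le_trans ?_ (le_abs_self _)
    nlinarith
  obtain ⟨i, hi, hxi⟩ := hx
  obtain ⟨j, hj, hyj⟩ := hy
  rw [Finset.mem_range] at hi hj
  rcases lt_trichotomy i j with h | h | h
  · exact key x y i j h hj hxi hyj
  · subst h
    simp only [foldΦ, shift, hxi, hyj, Int.toNat_natCast]
    apply le_of_eq; congr 1; ring
  · rw [abs_sub_comm, abs_sub_comm (foldΦ R k x).1]
    exact key y x j i h hi hyj hxi

theorem foldV_bdd {R : ℝ} (hR : 0 < R) {N : ℕ} {x : ℝ × ℝ} (hx : x ∈ foldV R N) :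
    0 ≤ x.1 ∧ x.1 ≤ N * R := by
  obtain ⟨j, hj, h⟩ := hx
  rw [Finset.mem_range] at hj
  obtain ⟨h1, h2⟩ := (mem_cell hR).1 (show x ∈ cell R (j:ℤ) from h)
  have h3 : ((j:ℤ):ℝ) + 1 ≤ N := by exact_mod_cast hj
  have h4 : (0:ℝ) ≤ (j:ℤ) := by positivity
  constructor <;> nlinarith

/-- selection of the heavy cells -/
theorem exists_spread {C : ℝ≥0∞} (hC : C ≠ ⊤) {d : ℝ≥0∞} (hd : 0 < d) {R : ℝ} (hR : 0 < R) :
    ∃ N : ℕ, ∀ f : ℝ × ℝ → ℝ≥0∞, ∫⁻ x, f x ∂μUH ≤ C → ∃ k : ℕ → ℤ, Spread N k ∧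
      ∀ x ∉ foldU R N k, ∫⁻ y in {y | |x.1 - y.1| < R}, f y ∂μUH ≤ 3 * d := by
  obtain ⟨m, hm⟩ : ∃ m : ℕ, C < (m : ℝ≥0∞) * d := ENNReal.exists_nat_mul_gt hd.ne' hC
  refine ⟨3 * m, fun f hf => ?_⟩
  set H : Set ℤ := {j | d ≤ ∫⁻ x in cell R j, f x ∂μUH} with hH
  have hT : ∀ T : Finset ℤ, (∀ j ∈ T, j ∈ H) → T.card ≤ m := by
    intro T hT
    by_contra hlt
    push Not at hlt
    have h1 : (T.card : ℝ≥0∞) * d ≤ C := by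
      calc (T.card : ℝ≥0∞) * d = ∑ j ∈ T, d := by simp
        _ ≤ ∑ j ∈ T, ∫⁻ x in cell R j, f x ∂μUH := Finset.sum_le_sum hT
        _ = ∫⁻ x in ⋃ j ∈ T, cell R j, f x ∂μUH := by
            rw [lintegral_biUnion_finset]
            · intro i _ j _ hij; exact cell_disjoint R hij
            · exact fun j _ => measurableSet_cell R j
        _ ≤ _ := (setLIntegral_le_lintegral _ _).trans hf
    have h2 : (m : ℝ≥0∞) * d ≤ T.card * d := by gcongr
    exact absurd (hm.trans_le (h2.trans h1)) (lt_irrefl _)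
  have hfin : H.Finite := by
    by_contra hinf
    obtain ⟨T, hT1, hT2⟩ := Set.Infinite.exists_subset_card_eq hinf (m + 1)
    have := hT T (fun j hj => hT1 hj)
    omega
  set F := hfin.toFinset with hF
  have hFc : F.card ≤ m := hT F fun j hj => by simpa [hF] using hj
  set K0 := F ∪ (F.image (· + 1) ∪ F.image (· - 1)) with hK0
  have hK0c : K0.card ≤ 3 * m := by
    have h1 := Finset.card_union_le F (F.image (· + 1) ∪ F.image (· - 1))
    have h2 := Finset.card_union_le (F.image (· + 1)) (F.image (· - 1))
    have h3 := Finset.card_image_le (s := F) (f := (· + 1))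
    have h4 := Finset.card_image_le (s := F) (f := (· - 1))
    rw [← hK0] at h1
    omega
  obtain ⟨K, hK0K, hKc⟩ := Infinite.exists_superset_card_eq K0 (3 * m) hK0c
  set k : ℕ → ℤ := fun j => if h : j < 3 * m then K.orderEmbOfFin hKc ⟨j, h⟩ else 0 with hk
  have hkm : ∀ i j : ℕ, i < j → j < 3 * m → k i < k j := by
    intro i j hij hj
    simp only [hk, hj, hij.trans hj, dif_pos]
    exact (K.orderEmbOfFin hKc).strictMono hij
  refine ⟨k, ?_, ?_⟩
  · intro i j hij
    induction j, hij using Nat.le_induction with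
    | base =>
      intro hj
      have := hkm i (i+1) (by omega) hj
      rw [Nat.succ_eq_add_one]
      push_cast; omega
    | succ j hij ih =>
      intro hj
      have := hkm j (j+1) (by omega) hj
      have := ih (by omega)
      push_cast; omega
  · intro x hx
    have hxK : cellIdx R x ∉ K := by
      intro hmem
      apply hx
      have : cellIdx R x ∈ Set.range (K.orderEmbOfFin hKc) := by
        rw [Finset.range_orderEmbOfFin]; exact hmem
      obtain ⟨j, hj⟩ := this
      refine ⟨j, Finset.mem_range.2 j.2, ?_⟩
      simp [hk, hj]
    set c := cellIdx R x with hc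
    have hnot : ∀ a : ℤ, a = c ∨ a = c - 1 ∨ a = c + 1 → ∫⁻ y in cell R a, f y ∂μUH ≤ d := by
      intro a ha
      by_contra hlt
      push Not at hlt
      have haF : a ∈ F := by simpa [hF, hH] using hlt.le
      apply hxK
      apply hK0K
      simp only [hK0, Finset.mem_union, Finset.mem_image]
      rcases ha with rfl | rfl | rfl
      · exact Or.inl haF
      · exact Or.inr (Or.inl ⟨_, haF, by ring⟩)
      · exact Or.inr (Or.inr ⟨_, haF, by ring⟩)
    have hsub : {y : ℝ × ℝ | |x.1 - y.1| < R} ⊆ cell R c ∪ (cell R (c-1) ∪ cell R (c+1)) := by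
      intro y hy
      have hy' : |x.1 - y.1| < R := hy
      obtain ⟨h1, h2⟩ := (mem_cell hR).1 (show x ∈ cell R c from rfl)
      rw [abs_lt] at hy'
      simp only [Set.mem_union, mem_cell hR]
      push_cast
      by_cases h3 : y.1 < c * R
      · right; left; constructor <;> nlinarith
      · by_cases h4 : y.1 < (c + 1) * R
        · left; exact ⟨not_lt.1 h3, h4⟩
        · right; right; constructor <;> nlinarith
    calc ∫⁻ y in {y | |x.1 - y.1| < R}, f y ∂μUH
        ≤ ∫⁻ y in cell R c ∪ (cell R (c-1) ∪ cell R (c+1)), f y ∂μUH := lintegral_mono_set hsub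
      _ ≤ ∫⁻ y in cell R c, f y ∂μUH + ∫⁻ y in cell R (c-1) ∪ cell R (c+1), f y ∂μUH :=
          lintegral_union_le _ _ _
      _ ≤ ∫⁻ y in cell R c, f y ∂μUH + (∫⁻ y in cell R (c-1), f y ∂μUH
          + ∫⁻ y in cell R (c+1), f y ∂μUH) := by
          gcongr; exact lintegral_union_le _ _ _
      _ ≤ d + (d + d) := by
          gcongr <;> exact hnot _ (by simp)
      _ = 3 * d := by ring


section
variable {Φ : ℝ × ℝ → ℝ × ℝ} {V U : Set (ℝ × ℝ)}

def pull (Φ : ℝ × ℝ → ℝ × ℝ) (V : Set (ℝ × ℝ)) (ζ : ℝ × ℝ → ℝ) : ℝ × ℝ → ℝ :=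
  V.indicator fun x => ζ (Φ x)

theorem Fold.meas_pull (h : Fold Φ V U) {ζ : ℝ × ℝ → ℝ} (hm : Measurable ζ) :
    Measurable (pull Φ V ζ) := (hm.comp h.mΦ).indicator h.mV

theorem pull_nonneg {ζ : ℝ × ℝ → ℝ} (h0 : ∀ x, 0 ≤ ζ x) (x : ℝ × ℝ) : 0 ≤ pull Φ V ζ x :=
  Set.indicator_nonneg (fun _ _ => h0 _) x

theorem pull_off {ζ : ℝ × ℝ → ℝ} {x : ℝ × ℝ} (hx : x ∉ V) : pull Φ V ζ x = 0 :=
  Set.indicator_of_notMem hx _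

theorem pull_on {ζ : ℝ × ℝ → ℝ} {x : ℝ × ℝ} (hx : x ∈ V) : pull Φ V ζ x = ζ (Φ x) :=
  Set.indicator_of_mem hx _

theorem Fold.lint (h : Fold Φ V U) (ζ : ℝ × ℝ → ℝ) (g : ℝ → ℝ → ℝ≥0∞) (hg : ∀ t, g 0 t = 0) :
    ∫⁻ x, g (pull Φ V ζ x) x.2 ∂μUH = ∫⁻ x in U, g (ζ x) x.2 ∂μUH := by
  rw [← h.cov, ← lintegral_indicator h.mV]
  refine lintegral_congr fun x => ?_
  by_cases hx : x ∈ V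
  · rw [Set.indicator_of_mem hx, pull_on hx, h.snd]
  · rw [Set.indicator_of_notMem hx, pull_off hx, hg]

theorem Fold.lint_le (h : Fold Φ V U) (ζ : ℝ × ℝ → ℝ) (g : ℝ → ℝ → ℝ≥0∞) (hg : ∀ t, g 0 t = 0) :
    ∫⁻ x, g (pull Φ V ζ x) x.2 ∂μUH ≤ ∫⁻ x, g (ζ x) x.2 ∂μUH := by
  rw [h.lint ζ g hg]; exact setLIntegral_le_lintegral _ _

theorem Fold.imp_add (h : Fold Φ V U) (ζ : ℝ × ℝ → ℝ) :
    ∫⁻ x, oR (pull Φ V ζ) x * ENNReal.ofReal x.2 ∂μUH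
      + ∫⁻ x in Uᶜ, oR ζ x * ENNReal.ofReal x.2 ∂μUH = ∫⁻ x, oR ζ x * ENNReal.ofReal x.2 ∂μUH := by
  have := h.lint ζ (fun s t => ENNReal.ofReal s * ENNReal.ofReal t) (by simp)
  simp only [oR]
  rw [this, lintegral_add_compl _ h.mU]

theorem BK_indicator {K : ℝ × ℝ → ℝ × ℝ → ℝ≥0∞} {f : ℝ × ℝ → ℝ≥0∞} {S : Set (ℝ × ℝ)}
    (hS : MeasurableSet S) :
    BK K (S.indicator f) = ∫⁻ x in S, f x * ∫⁻ y in S, K x y * f y ∂μUH ∂μUH := by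
  unfold BK
  rw [← lintegral_indicator hS]
  refine lintegral_congr fun x => ?_
  by_cases hx : x ∈ S
  · rw [Set.indicator_of_mem hx, Set.indicator_of_mem hx, ← lintegral_indicator hS]
    congr 1
    refine lintegral_congr fun y => ?_
    by_cases hy : y ∈ S
    · rw [Set.indicator_of_mem hy, Set.indicator_of_mem hy]
    · rw [Set.indicator_of_notMem hy, Set.indicator_of_notMem hy, mul_zero]
  · rw [Set.indicator_of_notMem hx, Set.indicator_of_notMem hx, zero_mul]

theorem oR_pull (ζ : ℝ × ℝ → ℝ) : oR (pull Φ V ζ) = V.indicator (fun x => oR ζ (Φ x)) := by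
  ext x
  by_cases hx : x ∈ V
  · simp only [oR, pull_on hx, Set.indicator_of_mem hx]
  · simp only [oR, pull_off hx, Set.indicator_of_notMem hx, ENNReal.ofReal_zero]

theorem Fold.BK_add_le (h : Fold Φ V U) {ζ : ℝ × ℝ → ℝ} (hm : Measurable ζ)
    {D : ℝ × ℝ → ℝ × ℝ → ℝ≥0∞}
    (hle : ∀ x ∈ V, ∀ y ∈ V, 0 < x.2 → 0 < y.2 → gE (Φ x) (Φ y) + D x y ≤ gE x y) :
    BK gE (U.indicator (oR ζ)) + BK D (oR (pull Φ V ζ)) ≤ BK gE (oR (pull Φ V ζ)) := by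
  have hmΦ : Measurable fun x => oR ζ (Φ x) := (measurable_oR hm).comp h.mΦ
  have hΦ2 : Measurable (fun z : (ℝ × ℝ) × (ℝ × ℝ) => (Φ z.1, Φ z.2)) :=
    (h.mΦ.comp measurable_fst).prodMk (h.mΦ.comp measurable_snd)
  have hgΦ : Measurable (fun z : (ℝ × ℝ) × (ℝ × ℝ) => gE (Φ z.1) (Φ z.2)) := by
    have := measurable_gE.comp hΦ2
    simpa only [Function.comp_def] using this
  have e1 : BK gE (U.indicator (oR ζ)) = BK (fun x y => gE (Φ x) (Φ y)) (oR (pull Φ V ζ)) := by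
    rw [oR_pull, BK_indicator h.mV, BK_indicator h.mU, ← h.cov]
    refine lintegral_congr fun x => ?_
    rw [← h.cov]
  have hpm : Measurable (oR (pull Φ V ζ)) := measurable_oR (h.meas_pull hm)
  have e2 : BK gE (U.indicator (oR ζ)) + BK D (oR (pull Φ V ζ))
      = BK (fun x y => gE (Φ x) (Φ y) + D x y) (oR (pull Φ V ζ)) := by
    rw [e1]
    unfold BK
    rw [← lintegral_add_left]
    · refine lintegral_congr fun x => ?_
      rw [← mul_add, ← lintegral_add_left]
      · congr 1
        refine lintegral_congr fun y => ?_
        rw [add_mul]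
      · exact (measurable_slice (K := fun x y => gE (Φ x) (Φ y)) hgΦ x).mul hpm
    · exact hpm.mul (measurable_inner (K := fun x y => gE (Φ x) (Φ y)) hgΦ hpm)
  rw [e2, oR_pull, BK_indicator h.mV, BK_indicator h.mV]
  refine lintegral_mono_ae ?_
  filter_upwards [ae_restrict_mem h.mV, ae_restrict_of_ae ae_UHP] with x hx hx0
  refine mul_le_mul' le_rfl ?_
  refine lintegral_mono_ae ?_
  filter_upwards [ae_restrict_mem h.mV, ae_restrict_of_ae ae_UHP] with y hy hy0
  gcongr
  exact hle x hx y hy hx0 hy0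

theorem gE_comm (x y : ℝ × ℝ) : gE x y = gE y x := by unfold gE; rw [greenG_comm]

theorem BK_le_split {f : ℝ × ℝ → ℝ≥0∞} (hf : Measurable f) {U : Set (ℝ × ℝ)} (hU : MeasurableSet U)
    {ε : ℝ≥0∞} (hε : ∀ x ∉ U, 0 < x.2 → ∫⁻ y, gE x y * f y ∂μUH ≤ ε * ENNReal.ofReal x.2) :
    BK gE f ≤ BK gE (U.indicator f) + 2 * ε * ∫⁻ x in Uᶜ, f x * ENNReal.ofReal x.2 ∂μUH := by
  have hone : ∫⁻ x in Uᶜ, f x * ∫⁻ y, gE x y * f y ∂μUH ∂μUH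
      ≤ ε * ∫⁻ x in Uᶜ, f x * ENNReal.ofReal x.2 ∂μUH := by
    rw [← lintegral_const_mul _ (by fun_prop)]
    refine lintegral_mono_ae ?_
    filter_upwards [ae_restrict_mem hU.compl, ae_restrict_of_ae ae_UHP] with x hx hx0
    calc f x * ∫⁻ y, gE x y * f y ∂μUH ≤ f x * (ε * ENNReal.ofReal x.2) := by
          gcongr; exact hε x hx hx0
      _ = _ := by ring
  have hsw : ∫⁻ x in U, f x * ∫⁻ y in Uᶜ, gE x y * f y ∂μUH ∂μUH
      = ∫⁻ x in Uᶜ, f x * ∫⁻ y in U, gE x y * f y ∂μUH ∂μUH := by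
    have e : ∀ S : Set (ℝ × ℝ), ∀ x, f x * ∫⁻ y in S, gE x y * f y ∂μUH
        = ∫⁻ y in S, f x * (gE x y * f y) ∂μUH := fun S x =>
      (lintegral_const_mul _ ((measurable_slice measurable_gE x).mul hf)).symm
    simp_rw [e]
    rw [lintegral_lintegral_swap]
    · refine lintegral_congr fun x => lintegral_congr fun y => ?_
      rw [gE_comm]; ring
    · exact ((hf.comp measurable_fst).mul (measurable_gE.mul (hf.comp measurable_snd))).aemeasurable
  have hin : ∀ x, ∫⁻ y, gE x y * f y ∂μUH = ∫⁻ y in U, gE x y * f y ∂μUH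
      + ∫⁻ y in Uᶜ, gE x y * f y ∂μUH := fun x => (lintegral_add_compl _ hU).symm
  have hmU : Measurable fun x => f x * ∫⁻ y in U, gE x y * f y ∂μUH := by
    have : Measurable (fun z : (ℝ × ℝ) × (ℝ × ℝ) => gE z.1 z.2 * f z.2) :=
      measurable_gE.mul (hf.comp measurable_snd)
    exact hf.mul this.lintegral_prod_right'
  calc BK gE f = ∫⁻ x in U, f x * ∫⁻ y, gE x y * f y ∂μUH ∂μUH
        + ∫⁻ x in Uᶜ, f x * ∫⁻ y, gE x y * f y ∂μUH ∂μUH := (lintegral_add_compl _ hU).symm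
    _ = (BK gE (U.indicator f) + ∫⁻ x in U, f x * ∫⁻ y in Uᶜ, gE x y * f y ∂μUH ∂μUH)
        + ∫⁻ x in Uᶜ, f x * ∫⁻ y, gE x y * f y ∂μUH ∂μUH := by
        congr 1
        rw [BK_indicator hU, ← lintegral_add_left hmU]
        refine lintegral_congr fun x => ?_
        rw [hin, mul_add]
    _ ≤ (BK gE (U.indicator f) + ∫⁻ x in Uᶜ, f x * ∫⁻ y, gE x y * f y ∂μUH ∂μUH)
        + ∫⁻ x in Uᶜ, f x * ∫⁻ y, gE x y * f y ∂μUH ∂μUH := by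
        rw [hsw]
        refine add_le_add (add_le_add le_rfl (lintegral_mono fun x => ?_)) le_rfl
        exact mul_le_mul' le_rfl (setLIntegral_le_lintegral _ _)
    _ ≤ (BK gE (U.indicator f) + ε * ∫⁻ x in Uᶜ, f x * ENNReal.ofReal x.2 ∂μUH)
        + ε * ∫⁻ x in Uᶜ, f x * ENNReal.ofReal x.2 ∂μUH := by gcongr
    _ = _ := by ring

theorem greenG_self (x : ℝ × ℝ) : greenG x x = 0 := by
  simp [greenG, sqdist]

/-- folding does not decrease the Green function -/
theorem foldΦ_gE {R : ℝ} (hR : 0 < R) {N : ℕ} {k : ℕ → ℤ} (hk : Spread N k) {x y : ℝ × ℝ}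
    (hx : x ∈ foldV R N) (hy : y ∈ foldV R N) (hx0 : 0 < x.2) (hy0 : 0 < y.2) :
    gE (foldΦ R k x) (foldΦ R k y) ≤ gE x y := by
  by_cases hxy : x = y
  · subst hxy; simp [gE, greenG_self]
  · unfold gE
    exact ENNReal.ofReal_le_ofReal
      (greenG_anti (x' := foldΦ R k x) (y' := foldΦ R k y) hx0 hy0 rfl rfl
        (foldΦ_spread hR hk hx hy) hxy)

/-- The gap kernel -/
def gapK (R H : ℝ) (i j : ℤ) (x y : ℝ × ℝ) : ℝ≥0∞ :=
  ({z : (ℝ × ℝ) × (ℝ × ℝ) | (z.1 ∈ cell R i ∧ z.1.2 ≤ H) ∧ z.2 ∈ cell R j ∧ z.2.2 ≤ H}).indicator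
    (fun z => min (gE z.1 z.2 - gE z.1 (shift R z.2)) 1) (x, y)

theorem measurable_gapK (R H : ℝ) (i j : ℤ) :
    Measurable (fun z : (ℝ × ℝ) × (ℝ × ℝ) => gapK R H i j z.1 z.2) := by
  have h0 : Measurable (fun z : (ℝ × ℝ) × (ℝ × ℝ) => (z.1, shift R z.2)) :=
    measurable_fst.prodMk ((shift_emb R).measurable.comp measurable_snd)
  have h1 : Measurable (fun z : (ℝ × ℝ) × (ℝ × ℝ) => gE z.1 (shift R z.2)) := by
    have := measurable_gE.comp h0
    simpa only [Function.comp_def] using this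
  refine Measurable.indicator ((measurable_gE.sub h1).min measurable_const) ?_
  exact ((measurable_fst (measurableSet_cell R i)).inter
    (measurableSet_le (measurable_snd.comp measurable_fst) measurable_const)).inter
    ((measurable_snd (measurableSet_cell R j)).inter
    (measurableSet_le (measurable_snd.comp measurable_snd) measurable_const))

theorem gapK_le_one (R H : ℝ) (i j : ℤ) (x y : ℝ × ℝ) : gapK R H i j x y ≤ 1 := by
  simp only [gapK, Set.indicator]
  split_ifs
  · exact min_le_right _ _
  · exact zero_le

theorem gapK_fold {R : ℝ} (hR : 0 < R) {N : ℕ} {k : ℕ → ℤ} (hk : Spread N k) {i j : ℕ}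
    (hij : i < j) (hj : j < N) (hne : k j - k i ≠ j - i) {H : ℝ} {x y : ℝ × ℝ}
    (hx : x ∈ foldV R N) (hy : y ∈ foldV R N) (hx0 : 0 < x.2) (hy0 : 0 < y.2) :
    gE (foldΦ R k x) (foldΦ R k y) + gapK R H i j x y ≤ gE x y := by
  simp only [gapK, Set.indicator]
  split_ifs with hc
  swap
  · rw [add_zero]; exact foldΦ_gE hR hk hx hy hx0 hy0
  obtain ⟨⟨hxi, -⟩, hyj, -⟩ := hc
  have hxi' : cellIdx R x = (i:ℤ) := hxi
  have hyj' : cellIdx R y = (j:ℤ) := hyj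
  have h1 := (mem_cell hR).1 hxi
  have h2 := (mem_cell hR).1 hyj
  have h4 : ((i:ℤ):ℝ) + 1 ≤ (j:ℤ) := by exact_mod_cast hij
  have h5 : x.1 < y.1 := by nlinarith
  have h3 : ((j:ℤ) - (i:ℤ) + 1 : ℝ) ≤ k j - k i := by
    have := hk i j hij hj
    have : (j:ℤ) - i + 1 ≤ k j - k i := by omega
    exact_mod_cast this
  have hsx : x ≠ shift R y := by
    intro h
    have : x.1 = y.1 + R := congrArg Prod.fst h
    linarith
  have e1 : gE (foldΦ R k x) (foldΦ R k y) ≤ gE x (shift R y) := by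
    apply ENNReal.ofReal_le_ofReal
    refine greenG_anti (x' := foldΦ R k x) (y' := foldΦ R k y) hx0 (y := shift R y) hy0 rfl rfl ?_ hsx
    simp only [foldΦ, shift, hxi', hyj', Int.toNat_natCast]
    rw [abs_sub_comm, abs_of_nonneg (by linarith), abs_sub_comm]
    refine le_trans ?_ (le_abs_self _)
    nlinarith
  have e2 : gE x (shift R y) ≤ gE x y := by
    apply ENNReal.ofReal_le_ofReal
    refine greenG_anti hx0 hy0 rfl rfl ?_ (fun h => by rw [h] at h5; exact lt_irrefl _ h5)
    simp only [shift]
    rw [abs_sub_comm, abs_of_nonneg (by linarith), abs_sub_comm, abs_of_nonneg (by linarith)]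
    linarith
  calc _ ≤ gE x (shift R y) + (gE x y - gE x (shift R y)) := add_le_add e1 (min_le_left _ _)
    _ = gE x y := add_tsub_cancel_of_le e2

theorem gapK_pos {R : ℝ} (hR : 0 < R) {i j : ℕ} (hij : i < j) {H : ℝ} {x y : ℝ × ℝ}
    (hx0 : 0 < x.2) (hy0 : 0 < y.2) (hxi : x ∈ cell R i) (hyj : y ∈ cell R j)
    (hxH : x.2 ≤ H) (hyH : y.2 ≤ H) : 0 < gapK R H i j x y := by
  have h1 := (mem_cell hR).1 hxi
  have h2 := (mem_cell hR).1 hyj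
  have h4 : ((i:ℤ):ℝ) + 1 ≤ (j:ℤ) := by exact_mod_cast hij
  have h5 : x.1 < y.1 := by nlinarith
  have : (x, y) ∈ {z : (ℝ × ℝ) × (ℝ × ℝ) | (z.1 ∈ cell R i ∧ z.1.2 ≤ H) ∧ z.2 ∈ cell R j ∧ z.2.2 ≤ H} :=
    ⟨⟨hxi, hxH⟩, hyj, hyH⟩
  simp only [gapK]
  rw [Set.indicator_of_mem this]
  refine lt_min (tsub_pos_of_lt ?_) one_pos
  have hs : greenG x (shift R y) < greenG x y := by
    refine greenG_strict hx0 hy0 rfl rfl ?_ (fun h => by rw [h] at h5; exact lt_irrefl _ h5)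
    simp only [shift]
    rw [abs_sub_comm, abs_of_nonneg (by linarith), abs_sub_comm, abs_of_nonneg (by linarith)]
    linarith
  exact (ENNReal.ofReal_lt_ofReal_iff_of_nonneg (greenG_nonneg hx0 (y := shift R y) hy0)).2 hs
end


theorem exists_consts {ω : ℝ → ℝ≥0∞} {C : ℝ≥0∞} (hω0 : Tendsto ω (𝓝[>] 0) (𝓝 0)) (hC : C ≠ ⊤)
    {ε : ℝ} (hε : 0 < ε) : ∃ r > 0, ∃ R > 0, ∃ d : ℝ≥0∞, 0 < d ∧
      ω r + ENNReal.ofReal (1 / r) * (3 * d) + ENNReal.ofReal (1 / R) * C ≤ ENNReal.ofReal ε := by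
  have h1 := (hω0.eventually_lt_const (show (0:ℝ≥0∞) < ENNReal.ofReal (ε / 3) by
    rw [ENNReal.ofReal_pos]; positivity)).and self_mem_nhdsWithin
  obtain ⟨r, hr, hr0⟩ := h1.exists
  have hr0 : 0 < r := hr0
  set D := C.toReal with hD
  have hD0 : 0 ≤ D := ENNReal.toReal_nonneg
  refine ⟨r, hr0, 3 * D / ε + 1, by positivity, ENNReal.ofReal (ε * r / 9), by
    rw [ENNReal.ofReal_pos]; positivity, ?_⟩
  have e2 : ENNReal.ofReal (1 / r) * (3 * ENNReal.ofReal (ε * r / 9)) = ENNReal.ofReal (ε / 3) := by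
    rw [show (3:ℝ≥0∞) = ENNReal.ofReal 3 by simp, ← ENNReal.ofReal_mul (by norm_num),
      ← ENNReal.ofReal_mul (by positivity)]
    congr 1; field_simp; norm_num
  have e3 : ENNReal.ofReal (1 / (3 * D / ε + 1)) * C ≤ ENNReal.ofReal (ε / 3) := by
    rw [← ENNReal.ofReal_toReal hC, ← hD, ← ENNReal.ofReal_mul (by positivity)]
    apply ENNReal.ofReal_le_ofReal
    rw [one_div, inv_mul_le_iff₀ (by positivity)]
    have : (3 * D / ε + 1) * (ε / 3) = D + ε / 3 := by field_simp
    rw [this]; linarith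
  calc _ ≤ ENNReal.ofReal (ε / 3) + ENNReal.ofReal (ε / 3) + ENNReal.ofReal (ε / 3) := by
        rw [e2]; gcongr
    _ = ENNReal.ofReal ε := by
        rw [← ENNReal.ofReal_add (by positivity) (by positivity),
          ← ENNReal.ofReal_add (by positivity) (by positivity)]
        congr 1; ring

theorem fold_stage {ω : ℝ → ℝ≥0∞} {C : ℝ≥0∞} (hω : ∀ r, ω r ≠ ⊤)
    (hω0 : Tendsto ω (𝓝[>] 0) (𝓝 0)) (hC : C ≠ ⊤) {ε : ℝ} (hε : 0 < ε) :
    ∃ R > 0, ∃ N : ℕ, ∀ ζ : ℝ × ℝ → ℝ, Measurable ζ → (∀ x, 0 ≤ ζ x) → Good ω C (oR ζ) →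
      ∃ k : ℕ → ℤ, Spread N k ∧ (Good ω C (oR (pull (foldΦ R k) (foldV R N) ζ)) →
        ∀ D : ℝ × ℝ → ℝ × ℝ → ℝ≥0∞,
        (∀ x ∈ foldV R N, ∀ y ∈ foldV R N, 0 < x.2 → 0 < y.2 →
          gE (foldΦ R k x) (foldΦ R k y) + D x y ≤ gE x y) →
        energy ζ + 1 / 2 * (BK D (oR (pull (foldΦ R k) (foldV R N) ζ))).toReal ≤
          energy (pull (foldΦ R k) (foldV R N) ζ) +
            ε * (impulse ζ - impulse (pull (foldΦ R k) (foldV R N) ζ))) := by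
  obtain ⟨r, hr, R, hR, d, hd, hle⟩ := exists_consts hω0 hC hε
  obtain ⟨N, hN⟩ := exists_spread hC hd hR
  refine ⟨R, hR, N, fun ζ hm h0 hG => ?_⟩
  obtain ⟨k, hk, hout⟩ := hN (oR ζ) hG.mass
  refine ⟨k, hk, fun hGη D hD => ?_⟩
  set U := foldU R N k
  have hF : Fold (foldΦ R k) (foldV R N) U := fold_fold hR hk
  set η := pull (foldΦ R k) (foldV R N) ζ with hη
  have hηm : Measurable η := hF.meas_pull hm
  have hη0 : ∀ x, 0 ≤ η x := pull_nonneg h0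
  have hsplit := BK_le_split (measurable_oR hm) hF.mU (ε := ENNReal.ofReal ε) ?_
  swap
  · intro x hx hx0
    refine (hG.Gop_le hx0 hr hR).trans ?_
    rw [mul_comm]
    gcongr
    refine le_trans ?_ hle
    gcongr
    exact hout x hx
  have hadd := hF.BK_add_le hm hD
  have himp := hF.imp_add ζ
  rw [← hη] at hadd himp
  set J := ∫⁻ x in Uᶜ, oR ζ x * ENNReal.ofReal x.2 ∂μUH with hJ
  have hJt : J ≠ ⊤ := ((setLIntegral_le_lintegral _ _).trans_lt (hG.imp.trans_lt hC.lt_top)).ne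
  have hBη : BK gE (oR η) ≠ ⊤ := (hGη.BK_lt_top (hω 1) hC).ne
  have hBζ : BK gE (oR ζ) ≠ ⊤ := (hG.BK_lt_top (hω 1) hC).ne
  have hBU : BK gE (U.indicator (oR ζ)) ≠ ⊤ := (le_self_add.trans hadd |>.trans_lt hBη.lt_top).ne
  have hBD : BK D (oR η) ≠ ⊤ := (le_add_self.trans hadd |>.trans_lt hBη.lt_top).ne
  rw [energy_eq hm h0 hG (hω 1) hC, energy_eq hηm hη0 hGη (hω 1) hC, impulse_eq hm h0,
    impulse_eq hηm hη0, ← himp]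
  rw [ENNReal.toReal_add (hGη.imp.trans_lt hC.lt_top).ne hJt]
  have r1 := ENNReal.toReal_mono hBη hadd
  rw [ENNReal.toReal_add hBU hBD] at r1
  have hx : 2 * ENNReal.ofReal ε * J ≠ ⊤ :=
    ENNReal.mul_ne_top (ENNReal.mul_ne_top (by norm_num) ENNReal.ofReal_ne_top) hJt
  have r2 := ENNReal.toReal_mono (ENNReal.add_ne_top.2 ⟨hBU, hx⟩) hsplit
  rw [ENNReal.toReal_add hBU hx, ENNReal.toReal_mul, ENNReal.toReal_mul,
    ENNReal.toReal_ofReal hε.le] at r2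
  simp only [ENNReal.toReal_ofNat] at r2
  linarith

section
variable {A C : ℝ≥0∞} {fn : ℕ → ℝ × ℝ → ℝ} {f : ℝ × ℝ → ℝ}

theorem WSeq.comp (h : WSeq A C fn f) {ψ : ℕ → ℕ} (hψ : StrictMono ψ) :
    WSeq A C (fun k => fn (ψ k)) f :=
  ⟨h.hA, h.hC, fun _ => h.mn _, fun _ => h.nn _, h.mf, h.nf, fun _ => h.l2n _, h.l2f,
    fun _ => h.massn _, fun g hg => (h.conv g hg).comp hψ.tendsto_atTop⟩

theorem WSeq.lsc_lt (h : WSeq A C fn f) {w : ℝ × ℝ → ℝ≥0∞} (hw : Measurable w) {b : ℝ≥0∞}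
    (hb : b < ∫⁻ x, oR f x * w x ∂μUH) : ∀ᶠ n in atTop, b < ∫⁻ x, oR (fn n) x * w x ∂μUH := by
  by_contra hcon
  rw [not_eventually] at hcon
  obtain ⟨ψ, hψ, hψ2⟩ := extraction_of_frequently_atTop hcon
  have := (h.comp hψ).lsc hw (B := b) (Eventually.of_forall fun n => not_lt.1 (hψ2 n))
  exact absurd (hb.trans_le this) (lt_irrefl _)

theorem exists_height {S : Set (ℝ × ℝ)} (hS : μUH S ≠ 0) : ∃ m : ℕ, μUH ({x | x ∈ S ∧ x.2 ≤ m}) ≠ 0 := by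
  by_contra hcon
  push Not at hcon
  apply hS
  have : S ⊆ ⋃ m : ℕ, {x | x ∈ S ∧ x.2 ≤ m} := by
    intro x hx
    obtain ⟨m, hm⟩ := exists_nat_ge x.2
    exact Set.mem_iUnion.2 ⟨m, hx, hm⟩
  exact measure_mono_null this (measure_iUnion_null hcon)

theorem gapK_BK_pos {f : ℝ × ℝ → ℝ} (hf : Measurable f) {R : ℝ} (hR : 0 < R) {i j : ℕ}
    (hij : i < j) (hi : μUH (cell R i ∩ {x | f x ≠ 0}) ≠ 0)
    (hj : μUH (cell R j ∩ {x | f x ≠ 0}) ≠ 0) (h0 : ∀ x, 0 ≤ f x) :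
    ∃ H : ℝ, 0 < BK (gapK R H i j) (oR f) := by
  obtain ⟨m1, hm1⟩ := exists_height hi
  obtain ⟨m2, hm2⟩ := exists_height hj
  refine ⟨max m1 m2, ?_⟩
  refine BK_pos (A := {x | x ∈ cell R i ∧ x.2 ≤ m1}) (B := {x | x ∈ cell R j ∧ x.2 ≤ m2})
    (measurable_gapK _ _ _ _) (measurable_oR hf) ?_ ?_ ?_
  · refine fun h => hm1 (measure_mono_null ?_ h)
    rintro x ⟨⟨h1, h2⟩, h3⟩
    refine ⟨⟨h1, h3⟩, ?_⟩
    simp only [Function.mem_support, oR]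
    exact (ENNReal.ofReal_pos.2 (lt_of_le_of_ne (h0 x) (Ne.symm h2))).ne'
  · refine fun h => hm2 (measure_mono_null ?_ h)
    rintro x ⟨⟨h1, h2⟩, h3⟩
    refine ⟨⟨h1, h3⟩, ?_⟩
    simp only [Function.mem_support, oR]
    exact (ENNReal.ofReal_pos.2 (lt_of_le_of_ne (h0 x) (Ne.symm h2))).ne'
  · intro x hx y hy hx0 hy0 _
    exact (gapK_pos hR hij hx0 hy0 hx.1 hy.1 (hx.2.trans (le_max_left _ _))
      (hy.2.trans (le_max_right _ _))).ne'

theorem WSeq.conv_gapK (h : WSeq A C fn f) {R : ℝ} (hR : 0 < R) (i j : ℕ) (H : ℝ) :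
    Tendsto (fun n => BK (gapK R H i j) (oR (fn n))) atTop (𝓝 (BK (gapK R H i j) (oR f))) := by
  -- remove the lower half plane from the kernel
  set K : ℝ × ℝ → ℝ × ℝ → ℝ≥0∞ := fun x y =>
    (UHP ×ˢ UHP).indicator (fun z => gapK R H i j z.1 z.2) (x, y) with hK
  have e : ∀ g : ℝ × ℝ → ℝ≥0∞, BK (gapK R H i j) g = BK K g := by
    intro g
    unfold BK
    apply lintegral_congr_ae
    filter_upwards [ae_UHP] with x hx
    congr 1
    apply lintegral_congr_ae
    filter_upwards [ae_UHP] with y hy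
    have : (x, y) ∈ UHP ×ˢ UHP := ⟨hx, hy⟩
    simp only [hK]
    rw [Set.indicator_of_mem this]
  simp_rw [e]
  refine h.conv_BK ((measurable_gapK R H i j).indicator (measurableSet_UHP.prod measurableSet_UHP))
    (Q := {x : ℝ × ℝ | 0 ≤ x.1 ∧ x.1 ≤ (i + 1 + j) * R ∧ 0 < x.2 ∧ x.2 ≤ H}) (box_finite _ _ _)
    ENNReal.one_ne_top ?_ ?_
  · intro x y
    simp only [hK, Set.indicator]
    split_ifs
    · exact gapK_le_one _ _ _ _ _ _
    · exact zero_le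
  · intro x y hxy
    simp only [hK, Set.indicator]
    split_ifs with hU
    swap
    · rfl
    simp only [gapK, Set.indicator]
    split_ifs with hc
    swap
    · rfl
    exfalso
    apply hxy
    obtain ⟨⟨h1, h2⟩, h3, h4⟩ := hc
    obtain ⟨h1a, h1b⟩ := (mem_cell hR).1 h1
    obtain ⟨h3a, h3b⟩ := (mem_cell hR).1 h3
    push_cast at h1a h1b h3a h3b
    have hi : (0:ℝ) ≤ i := Nat.cast_nonneg i
    have hj : (0:ℝ) ≤ j := Nat.cast_nonneg j
    refine ⟨⟨?_, ?_, hU.1, h2⟩, ⟨?_, ?_, hU.2, h4⟩⟩ <;> nlinarith [mul_nonneg hi hR.le, mul_nonneg hj hR.le]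
end


theorem prec_of_lint {η ζ₀ : ℝ × ℝ → ℝ} (hm : Measurable η) (h0 : ∀ x, 0 ≤ ζ₀ x)
    (h0i : Integrable ζ₀ μUH)
    (h : ∀ a > 0, ∫⁻ x, ENNReal.ofReal (max (η x - a) 0) ∂μUH
      ≤ ∫⁻ x, ENNReal.ofReal (max (ζ₀ x - a) 0) ∂μUH) : prec η ζ₀ := by
  intro a ha
  have hfin : ∫⁻ x, ENNReal.ofReal (max (ζ₀ x - a) 0) ∂μUH ≠ ⊤ := by
    refine ((lintegral_mono fun x => ?_).trans_lt
      ((hasFiniteIntegral_iff_ofReal (Eventually.of_forall h0)).1 h0i.2)).ne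
    exact ENNReal.ofReal_le_ofReal (max_le (by linarith) (h0 x))
  have e1 : ∫ x, max (η x - a) 0 ∂μUH
      = (∫⁻ x, ENNReal.ofReal (max (η x - a) 0) ∂μUH).toReal :=
    integral_eq_lintegral_of_nonneg_ae (Eventually.of_forall fun x => le_max_right _ _)
      ((hm.sub_const a).max measurable_const).aestronglyMeasurable
  have e2 : ∫ x, max (ζ₀ x - a) 0 ∂μUH
      = (∫⁻ x, ENNReal.ofReal (max (ζ₀ x - a) 0) ∂μUH).toReal :=
    integral_eq_lintegral_of_nonneg_ae (Eventually.of_forall fun x => le_max_right _ _)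
      ((h0i.aemeasurable.sub_const a).max aemeasurable_const).aestronglyMeasurable
  rw [e1, e2]
  exact ENNReal.toReal_mono hfin (h a ha)

theorem core {ω : ℝ → ℝ≥0∞} {A C Ap : ℝ≥0∞} {p : ℝ} (hp : 2 < p) (hω : ∀ r, ω r ≠ ⊤)
    (hω0 : Tendsto ω (𝓝[>] 0) (𝓝 0)) (hA : A ≠ ⊤)
    (hC : C ≠ ⊤) (hC1 : 1 ≤ C) {i₀ : ℝ} (hi₀ : 0 < i₀) (hCi : ENNReal.ofReal i₀ ≤ C) {M₀ : ℝ}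
    (hM : 0 < M₀) {ζ₀ : ℝ × ℝ → ℝ} (hmax : ∀ ξ ∈ Weq ζ₀ i₀, energy ξ ≤ M₀)
    (h0 : ∀ x, 0 ≤ ζ₀ x) (h0i : Integrable ζ₀ μUH)
    (hpot : ∀ f : ℝ × ℝ → ℝ≥0∞, Measurable f → ∫⁻ y, f y ^ p ∂μUH ≤ Ap → ∀ r > 0, ∀ x,
        ∫⁻ y, pK r x y * f y ∂μUH ≤ ω r)
    {z : ℕ → ℝ × ℝ → ℝ} (hzm : ∀ n, Measurable (z n)) (hz0 : ∀ n x, 0 ≤ z n x)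
    (hz1 : ∀ n, ∫⁻ x, oR (z n) x ∂μUH ≤ C) (hzi : ∀ n, ∫⁻ x, oR (z n) x * ENNReal.ofReal x.2 ∂μUH ≤ C)
    (hz2 : ∀ n, ∫⁻ x, oR (z n) x ^ (2:ℝ) ∂μUH ≤ A) (hzp : ∀ n, ∫⁻ x, oR (z n) x ^ p ∂μUH ≤ Ap)
    (hpp : ∀ a > 0, Tendsto (fun n => ∫⁻ x, ENNReal.ofReal (max (z n x - a) 0) ∂μUH) atTop
      (𝓝 (∫⁻ x, ENNReal.ofReal (max (ζ₀ x - a) 0) ∂μUH)))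
    (hI : Tendsto (fun n => impulse (z n)) atTop (𝓝 i₀))
    (hE : Tendsto (fun n => energy (z n)) atTop (𝓝 M₀)) :
    ∃ φ : ℕ → ℕ, StrictMono φ ∧ ∃ s : ℕ → ℝ, ∃ η : ℝ × ℝ → ℝ, Measurable η ∧ (∀ x, 0 ≤ η x) ∧
      η ∈ Weq ζ₀ i₀ ∧ energy η = M₀ ∧ MemLp η 2 μUH ∧
      Tendsto (fun n => ∫ x, z (φ n) (shift (s n) x) * η x ∂μUH) atTop (𝓝 (∫ x, η x * η x ∂μUH)) := by
  have hzG : ∀ n, Good ω C (oR (z n)) := fun n =>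
    ⟨measurable_oR (hzm n), hz1 n, hzi n, hpot _ (measurable_oR (hzm n)) (hzp n)⟩
  obtain ⟨c, hc, hgain⟩ := gain hω hω0 hC hC1 hi₀ hCi hM hmax
  set ε := min (c / 2) (M₀ / (2 * i₀)) with hεd
  have hε : 0 < ε := lt_min (by positivity) (by positivity)
  have hεc : ε ≤ c / 2 := min_le_left _ _
  have hεi : ε * i₀ ≤ M₀ / 2 := by
    have : ε ≤ M₀ / (2 * i₀) := min_le_right _ _
    calc ε * i₀ ≤ M₀ / (2 * i₀) * i₀ := by gcongr
      _ = M₀ / 2 := by field_simp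
  obtain ⟨R, hR, N, hst⟩ := fold_stage hω hω0 hC hε
  choose k hk hfold using fun n => hst (z n) (hzm n) (hz0 n) (hzG n)
  set V := foldV R N with hV
  set e : ℕ → ℝ × ℝ → ℝ := fun n => pull (foldΦ R (k n)) V (z n) with he
  have hF : ∀ n, Fold (foldΦ R (k n)) V (foldU R N (k n)) := fun n => fold_fold hR (hk n)
  have hem : ∀ n, Measurable (e n) := fun n => (hF n).meas_pull (hzm n)
  have he0 : ∀ n x, 0 ≤ e n x := fun n => pull_nonneg (hz0 n)
  have hepow : ∀ q : ℝ, 0 < q → ∀ n, ∫⁻ x, oR (e n) x ^ q ∂μUH ≤ ∫⁻ x, oR (z n) x ^ q ∂μUH :=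
    fun q hq n => (hF n).lint_le (z n) (fun s _ => ENNReal.ofReal s ^ q) (by
      intro t; rw [ENNReal.ofReal_zero, ENNReal.zero_rpow_of_pos hq])
  have he1 : ∀ n, ∫⁻ x, oR (e n) x ∂μUH ≤ C := fun n =>
    ((hF n).lint_le (z n) (fun s _ => ENNReal.ofReal s) (by simp)).trans (hz1 n)
  have hei : ∀ n, ∫⁻ x, oR (e n) x * ENNReal.ofReal x.2 ∂μUH
      ≤ ∫⁻ x, oR (z n) x * ENNReal.ofReal x.2 ∂μUH := fun n =>
    (hF n).lint_le (z n) (fun s t => ENNReal.ofReal s * ENNReal.ofReal t) (by simp)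
  have heG : ∀ n, Good ω C (oR (e n)) := fun n =>
    ⟨measurable_oR (hem n), he1 n, (hei n).trans (hzi n), hpot _ (measurable_oR (hem n))
      ((hepow p (by linarith) n).trans (hzp n))⟩
  have he2 : ∀ n, ∫⁻ x, oR (e n) x ^ (2:ℝ) ∂μUH ≤ A := fun n =>
    (hepow 2 (by norm_num) n).trans (hz2 n)
  have heoff : ∀ n, ∀ x ∉ V, e n x = 0 := fun n x hx => pull_off hx
  have hppe : ∀ a > 0, ∀ n, ∫⁻ x, ENNReal.ofReal (max (e n x - a) 0) ∂μUH
      ≤ ∫⁻ x, ENNReal.ofReal (max (z n x - a) 0) ∂μUH := fun a ha n =>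
    (hF n).lint_le (z n) (fun s _ => ENNReal.ofReal (max (s - a) 0)) (by
      intro t; simp [ha.le])
  obtain ⟨η, hηm, hη0, hη2, hηV, φ, hφ, hconv⟩ :=
    weak_compact hem he0 hA he2 (hF 0).mV heoff
  have hW : WSeq A C (fun n => e (φ n)) η := ⟨hA, hC, fun n => hem _, fun n => he0 _, hηm, hη0,
    fun n => he2 _, hη2, fun n => he1 _, hconv⟩
  have hηG : Good ω C (oR η) := hW.good fun n => heG _
  have hIφ := hI.comp hφ.tendsto_atTop
  have hEφ := hE.comp hφ.tendsto_atTop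
  -- impulse of the pieces
  have himpe : ∀ n, ∫⁻ x, oR (e n) x * ENNReal.ofReal x.2 ∂μUH = ENNReal.ofReal (impulse (e n)) := by
    intro n
    rw [impulse_eq (hem n) (he0 n), ENNReal.ofReal_toReal ((heG n).imp.trans_lt hC.lt_top).ne]
  have himpη : ∫⁻ x, oR η x * ENNReal.ofReal x.2 ∂μUH = ENNReal.ofReal (impulse η) := by
    rw [impulse_eq hηm hη0, ENNReal.ofReal_toReal (hηG.imp.trans_lt hC.lt_top).ne]
  have hIη0 : 0 ≤ impulse η := by rw [impulse_eq hηm hη0]; exact ENNReal.toReal_nonneg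
  have hwm : Measurable fun x : ℝ × ℝ => ENNReal.ofReal x.2 := by fun_prop
  have hlsc : ∀ b : ℝ, (∀ᶠ n in atTop, impulse (e (φ n)) ≤ b) → impulse η ≤ b := by
    intro b hb
    have := hW.lsc hwm (B := ENNReal.ofReal b) (by
      filter_upwards [hb] with n hn
      rw [himpe]; exact ENNReal.ofReal_le_ofReal hn)
    rw [himpη] at this
    have hb0 : 0 ≤ b := by
      obtain ⟨n, hn⟩ := hb.exists
      refine le_trans ?_ hn
      rw [impulse_eq (hem _) (he0 _)]; exact ENNReal.toReal_nonneg
    exact (ENNReal.ofReal_le_ofReal_iff hb0).1 this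
  have husc : ∀ θ > 0, ∀ᶠ n in atTop, energy (e (φ n)) ≤ energy η + θ := by
    intro θ hθ
    have := hW.usc hω0 (fun n => heG _) (hω 1) (W := N * R) (fun n x hx => heoff _ x fun hxV =>
      hx (foldV_bdd hR hxV)) (θ := ENNReal.ofReal θ) (by simpa using hθ)
    filter_upwards [this] with n hn
    rw [energy_eq (hem _) (he0 _) (heG _) (hω 1) hC, energy_eq hηm hη0 hηG (hω 1) hC]
    have hfin := (hηG.BK_lt_top (hω 1) hC).ne
    have h2 := ENNReal.toReal_mono (ENNReal.add_ne_top.2 ⟨hfin, ENNReal.ofReal_ne_top⟩) hn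
    rw [ENNReal.toReal_add hfin ENNReal.ofReal_ne_top, ENNReal.toReal_ofReal hθ.le] at h2
    linarith
  have hbasic : ∀ n, energy (z n) ≤ energy (e n) + ε * (impulse (z n) - impulse (e n)) := by
    intro n
    have := hfold n (heG n) (fun _ _ => 0) (fun x hx y hy hx0 hy0 => by
      rw [add_zero]; exact foldΦ_gE hR (hk n) hx hy hx0 hy0)
    simpa [BK] using this
  have himple : ∀ n, impulse (e n) ≤ impulse (z n) := by
    intro n
    rw [impulse_eq (hem n) (he0 n), impulse_eq (hzm n) (hz0 n)]
    exact ENNReal.toReal_mono ((hzi n).trans_lt hC.lt_top).ne (hei n)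
  have hIle : impulse η ≤ i₀ := by
    refine le_of_forall_pos_le_add fun θ hθ => hlsc _ ?_
    filter_upwards [hIφ.eventually_le_const (show i₀ < i₀ + θ by linarith)] with n hn
    exact (himple _).trans hn
  have hkey : M₀ ≤ energy η + ε * (i₀ - impulse η) := by
    have h1 : impulse η ≤ i₀ + (energy η - M₀) / ε := by
      refine le_of_forall_pos_le_add fun θ hθ => hlsc _ ?_
      have hθ3 : 0 < θ / 3 := by positivity
      filter_upwards [hIφ.eventually_le_const (show i₀ < i₀ + θ / 3 by linarith),
        hEφ.eventually_const_le (show M₀ - ε * (θ / 3) < M₀ by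
          have := mul_pos hε hθ3; linarith),
        husc (ε * (θ / 3)) (mul_pos hε hθ3)] with n h1 h2 h3
      have h4 := hbasic (φ n)
      simp only [Function.comp] at h1 h2
      have h5 : ε * impulse (e (φ n)) ≤ ε * (i₀ + (energy η - M₀) / ε + θ) := by
        have : ε * (i₀ + (energy η - M₀) / ε + θ) = ε * i₀ + (energy η - M₀) + ε * θ := by
          field_simp
        rw [this]
        nlinarith [mul_le_mul_of_nonneg_left h1 hε.le]
      exact le_of_mul_le_mul_left h5 hε
    have h2 := mul_le_mul_of_nonneg_left h1 hε.le
    have : ε * (i₀ + (energy η - M₀) / ε) = ε * i₀ + (energy η - M₀) := by field_simp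
    rw [this] at h2
    linarith
  have hprec : prec η ζ₀ := prec_of_lint hηm h0 h0i fun a ha =>
    hW.pp ha ((hpp a ha).comp hφ.tendsto_atTop) fun n => hppe a ha _
  have hg := hgain η hηm hη0 hηG hprec hIle (by nlinarith)
  have hIeq : impulse η = i₀ := by
    have : 0 ≤ i₀ - impulse η := by linarith
    by_contra hne
    have : 0 < i₀ - impulse η := lt_of_le_of_ne this fun h => hne (by linarith)
    nlinarith
  have hEeq : energy η = M₀ := by
    rw [hIeq] at hkey hg
    simp only [sub_self, mul_zero, add_zero] at hkey hg
    linarith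
  have hηW : η ∈ Weq ζ₀ i₀ :=
    ⟨⟨hη0, integrable_of_lt_top hηm hη0 (hηG.mass.trans_lt hC.lt_top).ne, hprec⟩, hIeq⟩
  -- rigidity of the gaps
  have hdef : ∀ θ > 0, ∀ᶠ n in atTop, energy (e (φ n)) + ε * (impulse (z (φ n)) - impulse (e (φ n)))
      < energy (z (φ n)) + θ := by
    intro θ hθ
    have hθ2 : 0 < θ / 4 := by positivity
    have hx : 0 < θ / (4 * ε) := by positivity
    have hIev : ∀ᶠ n in atTop, i₀ - min (θ / (4 * ε)) i₀ / 2 < impulse (e (φ n)) := by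
      have hmn : 0 < min (θ / (4 * ε)) i₀ := lt_min hx hi₀
      have := hW.lsc_lt hwm (b := ENNReal.ofReal (i₀ - min (θ / (4 * ε)) i₀ / 2)) (by
        rw [himpη, hIeq]
        exact (ENNReal.ofReal_lt_ofReal_iff hi₀).2 (by linarith))
      filter_upwards [this] with n hn
      rw [himpe] at hn
      exact (ENNReal.ofReal_lt_ofReal_iff_of_nonneg (by
        have := min_le_right (θ / (4 * ε)) i₀; linarith)).1 hn
    filter_upwards [hIφ.eventually_lt_const (show i₀ < i₀ + θ / (4 * ε) / 2 by linarith),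
        hEφ.eventually_const_lt (show M₀ - θ / 4 < M₀ by linarith),
        husc (θ / 4) hθ2, hIev] with n h1 h2 h3 h4
    simp only [Function.comp] at h1 h2
    have h5 := min_le_left (θ / (4 * ε)) i₀
    have h6 : impulse (z (φ n)) - impulse (e (φ n)) ≤ θ / (4 * ε) := by linarith
    have h7 := mul_le_mul_of_nonneg_left h6 hε.le
    have : ε * (θ / (4 * ε)) = θ / 4 := by field_simp
    linarith
  have hrig : ∀ i j : ℕ, i < j → j < N → μUH (cell R i ∩ {x | η x ≠ 0}) ≠ 0 →
      μUH (cell R j ∩ {x | η x ≠ 0}) ≠ 0 →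
      ∀ᶠ n in atTop, k (φ n) j - k (φ n) i = j - i := by
    intro i j hij hj hi0 hj0
    obtain ⟨H, hH⟩ := gapK_BK_pos hηm hR hij hi0 hj0 hη0
    obtain ⟨b, hb0, hb⟩ := exists_between hH
    have hbt : b ≠ ⊤ := hb.ne_top
    have hbr : 0 < b.toReal := ENNReal.toReal_pos hb0.ne' hbt
    filter_upwards [(hW.conv_gapK hR i j H).eventually_const_lt hb,
      hdef (1 / 2 * b.toReal) (by positivity)] with n h1 h2
    by_contra hne
    have h3 := hfold (φ n) (heG _) (gapK R H i j) fun x hx y hy hx0 hy0 =>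
      gapK_fold hR (hk _) hij hj hne hx hy hx0 hy0
    have hle : BK (gapK R H i j) (oR (e (φ n))) ≤ BK gE (oR (e (φ n))) :=
      le_add_self.trans ((hF (φ n)).BK_add_le (hzm _) fun x hx y hy hx0 hy0 =>
        gapK_fold hR (hk _) hij hj hne hx hy hx0 hy0)
    have hfin : BK (gapK R H i j) (oR (e (φ n))) ≠ ⊤ :=
      (hle.trans_lt ((heG _).BK_lt_top (hω 1) hC)).ne
    have h4 := ENNReal.toReal_mono hfin h1.le
    have h5 : energy (z (φ n)) + 1 / 2 * (BK (gapK R H i j) (oR (e (φ n)))).toReal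
      ≤ energy (e (φ n)) + ε * (impulse (z (φ n)) - impulse (e (φ n))) := h3
    linarith
  -- translation
  obtain ⟨j₀, hj₀⟩ : ∃ j₀ : ℕ, ∀ j < N, μUH (cell R j ∩ {x | η x ≠ 0}) ≠ 0 →
      (j₀ < N ∧ μUH (cell R j₀ ∩ {x | η x ≠ 0}) ≠ 0) := by
    by_cases h : ∃ j < N, μUH (cell R j ∩ {x | η x ≠ 0}) ≠ 0
    · obtain ⟨j, hj, hj'⟩ := h
      exact ⟨j, fun _ _ _ => ⟨hj, hj'⟩⟩
    · exact ⟨0, fun j hj hj' => absurd ⟨j, hj, hj'⟩ h⟩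
  have hall : ∀ᶠ n in atTop, ∀ j ∈ Finset.range N, μUH (cell R j ∩ {x | η x ≠ 0}) ≠ 0 →
      k (φ n) j - j = k (φ n) j₀ - j₀ := by
    rw [Filter.eventually_all_finset]
    intro j hj
    rw [Finset.mem_range] at hj
    by_cases hne : μUH (cell R j ∩ {x | η x ≠ 0}) = 0
    · exact Eventually.of_forall fun n h => absurd hne h
    obtain ⟨hj₀N, hj₀ne⟩ := hj₀ j hj hne
    rcases lt_trichotomy j j₀ with h | h | h
    · filter_upwards [hrig j j₀ h hj₀N hne hj₀ne] with n hn _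
      linarith
    · subst h; exact Eventually.of_forall fun n _ => rfl
    · filter_upwards [hrig j₀ j h hj hj₀ne hne] with n hn _
      linarith
  refine ⟨φ, hφ, fun n => (k (φ n) j₀ - (j₀ : ℤ)) * R, η, hηm, hη0, hηW, hEeq, hη2, ?_⟩
  refine (hconv η hη2).congr' ?_
  filter_upwards [hall] with n hn
  apply integral_congr_ae
  have hnull : ∀ᵐ x ∂μUH, ∀ j ∈ Finset.range N, μUH (cell R j ∩ {x | η x ≠ 0}) = 0 →
      x ∉ cell R j ∩ {x | η x ≠ 0} := by
    have : ∀ j ∈ (Finset.range N : Set ℕ), ∀ᵐ x ∂μUH, μUH (cell R j ∩ {x | η x ≠ 0}) = 0 →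
      x ∉ cell R j ∩ {x | η x ≠ 0} := by
      intro j _
      by_cases h : μUH (cell R j ∩ {x | η x ≠ 0}) = 0
      · filter_upwards [measure_eq_zero_iff_ae_notMem.1 h] with x hx _ using hx
      · exact Eventually.of_forall fun x h' => absurd h' h
    exact (ae_ball_iff (Set.to_countable _)).2 this
  filter_upwards [hnull] with x hx
  by_cases hη : η x = 0
  · simp [hη]
  have hxV : x ∈ V := by by_contra h; exact hη (hηV x h)
  obtain ⟨j, hj, hxj⟩ := hxV
  have hne : μUH (cell R j ∩ {x | η x ≠ 0}) ≠ 0 := fun h => hx j hj h ⟨hxj, hη⟩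
  have hkj := hn j hj hne
  congr 1
  have : e (φ n) x = z (φ n) (foldΦ R (k (φ n)) x) := pull_on ⟨j, hj, hxj⟩
  rw [this]
  simp only [foldΦ, hxj, Int.toNat_natCast]
  congr 3
  exact_mod_cast hkj

theorem energy_congr {f g : ℝ × ℝ → ℝ} (h : f =ᵐ[μUH] g) : energy f = energy g := by
  have hG : Gop f = Gop g := by
    ext x
    apply integral_congr_ae
    filter_upwards [h] with y hy
    rw [hy]
  unfold energy
  rw [hG]
  congr 1
  apply integral_congr_ae
  filter_upwards [h] with y hy
  rw [hy]

theorem impulse_congr {f g : ℝ × ℝ → ℝ} (h : f =ᵐ[μUH] g) : impulse f = impulse g := by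
  apply integral_congr_ae
  filter_upwards [h] with y hy
  rw [hy]

theorem scheffe {α : Type*} [MeasurableSpace α] {μ : Measure α} {un : ℕ → α → ℝ≥0∞} {u : α → ℝ≥0∞}
    (hm : ∀ n, Measurable (un n)) (hu : Measurable u) (hut : ∀ x, u x ≠ ⊤)
    (hae : ∀ᵐ x ∂μ, Tendsto (fun n => un n x) atTop (𝓝 (u x)))
    (hfin : ∫⁻ x, u x ∂μ ≠ ⊤)
    (hint : Tendsto (fun n => ∫⁻ x, un n x ∂μ) atTop (𝓝 (∫⁻ x, u x ∂μ))) :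
    Tendsto (fun n => ∫⁻ x, ((un n x - u x) + (u x - un n x)) ∂μ) atTop (𝓝 0) := by
  have h1 : Tendsto (fun n => ∫⁻ x, (u x - un n x) ∂μ) atTop (𝓝 0) := by
    have := tendsto_lintegral_of_dominated_convergence (μ := μ)
      (F := fun n x => u x - un n x) (f := fun _ => 0) u (fun n => hu.sub (hm n))
      (fun n => Eventually.of_forall fun x => tsub_le_self) hfin ?_
    · simpa using this
    · filter_upwards [hae] with x hx
      have := ENNReal.Tendsto.sub (tendsto_const_nhds (x := u x) (f := atTop (α := ℕ))) hx
        (Or.inl (hut x))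
      simpa using this
  have h2 : ∀ n, ∫⁻ x, (un n x - u x) ∂μ
      = (∫⁻ x, un n x ∂μ + ∫⁻ x, (u x - un n x) ∂μ) - ∫⁻ x, u x ∂μ := by
    intro n
    have e : ∫⁻ x, (un n x - u x) ∂μ + ∫⁻ x, u x ∂μ
        = ∫⁻ x, un n x ∂μ + ∫⁻ x, (u x - un n x) ∂μ := by
      rw [← lintegral_add_right _ hu, ← lintegral_add_left (hm n)]
      congr 1
      ext x
      rcases le_total (un n x) (u x) with h | h
      · rw [tsub_eq_zero_of_le h, zero_add, add_tsub_cancel_of_le h]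
      · rw [tsub_eq_zero_of_le h, add_zero, tsub_add_cancel_of_le h]
    rw [← e, ENNReal.add_sub_cancel_right hfin]
  have h3 : Tendsto (fun n => ∫⁻ x, (un n x - u x) ∂μ) atTop (𝓝 0) := by
    simp_rw [h2]
    have := ENNReal.Tendsto.sub (hint.add h1) (tendsto_const_nhds (x := ∫⁻ x, u x ∂μ)) (Or.inr hfin)
    simpa using this
  have e : ∀ n, ∫⁻ x, ((un n x - u x) + (u x - un n x)) ∂μ
      = ∫⁻ x, (un n x - u x) ∂μ + ∫⁻ x, (u x - un n x) ∂μ := fun n =>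
    lintegral_add_left ((hm n).sub hu) _
  simp_rw [e]
  simpa using h3.add h1

theorem pow_diff {a b : ℝ} (ha : 0 ≤ a) (hb : 0 ≤ b) {q : ℝ} (hq : 1 ≤ q) :
    ‖a - b‖ₑ ^ q ≤ (ENNReal.ofReal a ^ q - ENNReal.ofReal b ^ q)
      + (ENNReal.ofReal b ^ q - ENNReal.ofReal a ^ q) := by
  have key : ∀ a b : ℝ, 0 ≤ b → b ≤ a →
      ENNReal.ofReal (a - b) ^ q ≤ ENNReal.ofReal a ^ q - ENNReal.ofReal b ^ q := by
    intro a b hb hab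
    have h := ENNReal.add_rpow_le_rpow_add (ENNReal.ofReal (a - b)) (ENNReal.ofReal b) hq
    rw [← ENNReal.ofReal_add (by linarith) hb, sub_add_cancel] at h
    exact ENNReal.le_sub_of_add_le_right
      (ENNReal.rpow_ne_top_of_nonneg (by linarith) ENNReal.ofReal_ne_top) h
  rcases le_total b a with h | h
  · rw [Real.enorm_eq_ofReal (by linarith)]
    exact (key a b hb h).trans le_self_add
  · rw [← enorm_neg, neg_sub, Real.enorm_eq_ofReal (by linarith)]
    exact (key b a ha h).trans le_add_self

theorem strong_q {gn : ℕ → ℝ × ℝ → ℝ} {η : ℝ × ℝ → ℝ} (hm : ∀ n, Measurable (gn n))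
    (hη : Measurable η) (h0 : ∀ n x, 0 ≤ gn n x) (hη0 : ∀ x, 0 ≤ η x) {q : ℝ} (hq : 1 ≤ q)
    (hae : ∀ᵐ x ∂μUH, Tendsto (fun n => gn n x) atTop (𝓝 (η x)))
    (hfin : ∫⁻ x, oR η x ^ q ∂μUH ≠ ⊤)
    (hint : Tendsto (fun n => ∫⁻ x, oR (gn n) x ^ q ∂μUH) atTop (𝓝 (∫⁻ x, oR η x ^ q ∂μUH))) :
    Tendsto (fun n => eLpNorm (fun x => gn n x - η x) (ENNReal.ofReal q) μUH) atTop (𝓝 0) := by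
  have hq0 : 0 < q := by linarith
  have hS := scheffe (μ := μUH) (un := fun n x => oR (gn n) x ^ q) (u := fun x => oR η x ^ q)
    (fun n => (measurable_oR (hm n)).pow_const q) ((measurable_oR hη).pow_const q)
    (fun x => ENNReal.rpow_ne_top_of_nonneg hq0.le ENNReal.ofReal_ne_top) ?_ hfin hint
  · have h1 : Tendsto (fun n => ∫⁻ x, ‖gn n x - η x‖ₑ ^ q ∂μUH) atTop (𝓝 0) :=
      tendsto_of_tendsto_of_tendsto_of_le_of_le tendsto_const_nhds hS (fun n => zero_le)
        (fun n => lintegral_mono fun x => pow_diff (h0 n x) (hη0 x) hq)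
    have h2 := ((ENNReal.continuous_rpow_const (y := 1 / q)).tendsto _).comp h1
    rw [ENNReal.zero_rpow_of_pos (by positivity)] at h2
    refine h2.congr fun n => ?_
    rw [eLpNorm_eq_lintegral_rpow_enorm_toReal (by simpa using hq0) ENNReal.ofReal_ne_top,
      ENNReal.toReal_ofReal hq0.le]
    rfl
  · filter_upwards [hae] with x hx
    exact ((ENNReal.continuous_rpow_const (y := q)).tendsto _).comp
      ((ENNReal.continuous_ofReal.tendsto _).comp hx)

theorem ae_sub {gn : ℕ → ℝ × ℝ → ℝ} {η : ℝ × ℝ → ℝ} (hm : ∀ n, Measurable (gn n))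
    (hη : Measurable η) (h0 : ∀ n x, 0 ≤ gn n x) (hη0 : ∀ x, 0 ≤ η x)
    (hg2 : ∀ n, ∫⁻ x, oR (gn n) x ^ (2:ℝ) ∂μUH ≠ ⊤)
    (hfin : ∫⁻ x, oR η x ^ (2:ℝ) ∂μUH ≠ ⊤)
    (hint : Tendsto (fun n => ∫⁻ x, oR (gn n) x ^ (2:ℝ) ∂μUH) atTop
      (𝓝 (∫⁻ x, oR η x ^ (2:ℝ) ∂μUH)))
    (hw : Tendsto (fun n => ∫ x, gn n x * η x ∂μUH) atTop (𝓝 (∫ x, η x * η x ∂μUH))) :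
    ∃ ψ : ℕ → ℕ, StrictMono ψ ∧
      ∀ᵐ x ∂μUH, Tendsto (fun n => gn (ψ n) x) atTop (𝓝 (η x)) := by
  have hgL := fun n => memLp_two_of_lintegral (hm n) (h0 n) (hg2 n)
  have hηL := memLp_two_of_lintegral hη hη0 hfin
  have sq : ∀ f : ℝ × ℝ → ℝ, Measurable f → (∀ x, 0 ≤ f x) →
      ∫ x, f x * f x ∂μUH = (∫⁻ x, oR f x ^ (2:ℝ) ∂μUH).toReal := by
    intro f hf hf0
    rw [integral_eq_lintegral_of_nonneg_ae (Eventually.of_forall fun x => mul_self_nonneg _)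
      (hf.mul hf).aestronglyMeasurable]
    congr 1
    apply lintegral_congr
    intro x
    rw [ENNReal.ofReal_mul (hf0 x), ENNReal.rpow_two, pow_two]; rfl
  have hsq : Tendsto (fun n => ∫ x, gn n x * gn n x ∂μUH) atTop (𝓝 (∫ x, η x * η x ∂μUH)) := by
    simp_rw [sq _ (hm _) (h0 _), sq _ hη hη0]
    exact (ENNReal.tendsto_toReal hfin).comp hint
  have hd : Tendsto (fun n => ∫ x, (gn n x - η x) ^ 2 ∂μUH) atTop (𝓝 0) := by
    have e : ∀ n, ∫ x, (gn n x - η x) ^ 2 ∂μUH = ∫ x, gn n x * gn n x ∂μUH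
        - 2 * ∫ x, gn n x * η x ∂μUH + ∫ x, η x * η x ∂μUH := by
      intro n
      have i1 := lint_mul_integrable (hgL n) (hgL n)
      have i2 := lint_mul_integrable (hgL n) hηL
      have i3 := lint_mul_integrable hηL hηL
      have i4 : Integrable (fun x => gn n x * gn n x - 2 * (gn n x * η x)) μUH :=
        i1.sub (i2.const_mul 2)
      rw [← integral_const_mul, ← integral_sub i1 (i2.const_mul 2),
        ← integral_add i4 i3]
      congr 1
      ext x
      ring
    simp_rw [e]
    have := (hsq.sub (hw.const_mul 2)).add_const (∫ x, η x * η x ∂μUH)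
    convert this using 2
    ring
  have hn : Tendsto (fun n => eLpNorm ((fun x => (gn n x - η x) ^ 2) - fun _ => (0:ℝ)) 1 μUH) atTop
      (𝓝 0) := by
    have e : ∀ n, eLpNorm ((fun x => (gn n x - η x) ^ 2) - fun _ => (0:ℝ)) 1 μUH
        = ENNReal.ofReal (∫ x, (gn n x - η x) ^ 2 ∂μUH) := by
      intro n
      have i4 : Integrable (fun x => (gn n x - η x) ^ 2) μUH := ((hgL n).sub hηL).integrable_sq
      rw [eLpNorm_one_eq_lintegral_enorm, ofReal_integral_eq_lintegral_ofReal i4 (Eventually.of_forall fun x => sq_nonneg _)]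
      apply lintegral_congr
      intro x
      simp only [Pi.sub_apply, sub_zero]
      rw [Real.enorm_eq_ofReal (sq_nonneg _)]
    simp_rw [e]
    simpa [Function.comp_def] using (ENNReal.continuous_ofReal.tendsto _).comp hd
  have hmeas := tendstoInMeasure_of_tendsto_eLpNorm one_ne_zero
    (fun n => (((hm n).sub hη).pow_const 2).aestronglyMeasurable)
    aestronglyMeasurable_const hn
  obtain ⟨ψ, hψ, hae⟩ := hmeas.exists_seq_tendsto_ae
  refine ⟨ψ, hψ, ?_⟩
  filter_upwards [hae] with x hx
  have h1 : Tendsto (fun n => |gn (ψ n) x - η x|) atTop (𝓝 0) := by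
    have := (Real.continuous_sqrt.tendsto _).comp hx
    simp only [Function.comp_def, Real.sqrt_zero] at this
    refine this.congr fun n => ?_
    exact Real.sqrt_sq_eq_abs _
  have h2 := tendsto_zero_iff_abs_tendsto_zero _ |>.2 h1
  simpa using h2.add_const (η x)

theorem M_pos {p : ℝ} (hp : 2 < p) {i₀ : ℝ} (hi₀ : 0 < i₀) {ζ₀ ζ : ℝ × ℝ → ℝ} (h0 : ∀ x, 0 ≤ ζ₀ x)
    (h0i : Integrable ζ₀ μUH) (h0p : ∫⁻ x, oR ζ₀ x ^ p ∂μUH ≠ ⊤) (hζ : ζ ∈ Weq ζ₀ i₀)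
    (hR : IsRearr ζ ζ₀) : 0 < energy ζ := by
  obtain ⟨⟨hn, hi, -⟩, hI⟩ := hζ
  obtain ⟨g, hgm, hgz⟩ := hi.1
  set f : ℝ × ℝ → ℝ := fun x => max (g x) 0 with hf
  have hfm : Measurable f := hgm.measurable.max measurable_const
  have hfz : ζ =ᵐ[μUH] f := by
    filter_upwards [hgz] with x hx
    simp only [hf, ← hx, max_eq_left (hn x)]
  have hf0 : ∀ x, 0 ≤ f x := fun x => le_max_right _ _
  have hpow : ∀ q : ℝ, 0 < q → ∫⁻ x, oR f x ^ q ∂μUH = ∫⁻ x, oR ζ₀ x ^ q ∂μUH := by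
    intro q hq
    refine Eq.trans ?_
      (lintegral_pow_equi (f := ζ) hn h0 hi.1.aemeasurable h0i.1.aemeasurable hR hq)
    apply lintegral_congr_ae
    filter_upwards [hfz] with x hx
    simp only [oR, hx]
  have hE : energy ζ = energy f := energy_congr hfz
  have hI' : impulse f = i₀ := by rw [← hI]; exact (impulse_congr hfz).symm
  rw [impulse_eq hfm hf0] at hI'
  have hIt : ∫⁻ y, oR f y * ENNReal.ofReal y.2 ∂μUH ≠ ⊤ := by
    intro h; rw [h] at hI'; simp at hI'; linarith
  have h1t : ∫⁻ y, oR f y ∂μUH ≠ ⊤ := by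
    have := (hi.congr hfz).2
    rw [hasFiniteIntegral_iff_ofReal (Eventually.of_forall hf0)] at this
    exact this.ne
  obtain ⟨ω, hω, -, hpot⟩ := exists_omega hp h0p
  have hG : Good ω (∫⁻ y, oR f y ∂μUH + ∫⁻ y, oR f y * ENNReal.ofReal y.2 ∂μUH) (oR f) :=
    ⟨measurable_oR hfm, le_self_add, le_add_self, hpot _ (measurable_oR hfm) (hpow p (by linarith)).le⟩
  have hCt := ENNReal.add_ne_top.2 ⟨h1t, hIt⟩
  rw [hE, energy_eq hfm hf0 hG (hω 1) hCt]
  have hs : μUH (Set.univ ∩ Function.support (oR f)) ≠ 0 := by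
    rw [Set.univ_inter]
    intro h
    have h2 : ∀ᵐ x ∂μUH, oR f x = 0 := by
      rw [ae_iff]; exact h
    have : ∫⁻ y, oR f y * ENNReal.ofReal y.2 ∂μUH = 0 := by
      rw [← lintegral_zero (μ := μUH)]
      apply lintegral_congr_ae
      filter_upwards [h2] with x hx
      simp [hx]
    rw [this] at hI'
    simp at hI'; linarith
  have hB := BK_pos measurable_gE (measurable_oR hfm) hs hs
    (fun x _ y _ hx hy hxy => (ENNReal.ofReal_pos.2 (greenG_pos hx hy hxy)).ne')
  have := ENNReal.toReal_pos hB.ne' (hG.BK_lt_top (hω 1) hCt).ne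
  positivity

end Helpers

/-- Theorem 1 (Compactness): every generalised maximising sequence converges,
after a subsequence and `x₁`-translations, to a maximiser, in `L^p` and `L¹`. -/
theorem stmt_13 (p : ℝ) (hp : 2 < p) (i₀ : ℝ) (hi₀ : 0 < i₀)
    (ζ₀ : ℝ × ℝ → ℝ) (h0nn : ∀ x, 0 ≤ ζ₀ x)
    (h0ne : ¬ (ζ₀ =ᵐ[μUH] fun _ => (0 : ℝ)))
    (h0p : MemLp ζ₀ (ENNReal.ofReal p) μUH) (h0supp : HasCompactSupport ζ₀)
    (S₀ : Set (ℝ × ℝ → ℝ))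
    (hSdef : S₀ = {ζ ∈ Weq ζ₀ i₀ | ∀ ξ ∈ Weq ζ₀ i₀, energy ξ ≤ energy ζ})
    (hSne : S₀.Nonempty) (hSR : ∀ ζ ∈ S₀, IsRearr ζ ζ₀)
    (M₀ : ℝ) (hM₀ : ∀ ζ ∈ S₀, energy ζ = M₀)
    (ζn : ℕ → ℝ × ℝ → ℝ)
    (hnn : ∀ n x, 0 ≤ ζn n x)
    (hmem : ∀ n, MemLp (ζn n) (ENNReal.ofReal p) μUH)
    (hint : ∀ n, Integrable (ζn n) μUH)
    (himpint : ∀ n, Integrable (fun y => ζn n y * y.2) μUH)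
    (hΔp : Tendsto (fun n => eLpNorm (fun s => decRearr (ζn n) s - decRearr ζ₀ s)
        (ENNReal.ofReal p) (MeasureTheory.volume.restrict (Set.Ioi (0 : ℝ))))
        atTop (nhds 0))
    (hΔ1 : Tendsto (fun n => eLpNorm (fun s => decRearr (ζn n) s - decRearr ζ₀ s)
        1 (MeasureTheory.volume.restrict (Set.Ioi (0 : ℝ)))) atTop (nhds 0))
    (hI : Tendsto (fun n => impulse (ζn n)) atTop (nhds i₀))
    (hE : Tendsto (fun n => energy (ζn n)) atTop (nhds M₀)) :
    ∃ φ : ℕ → ℕ, StrictMono φ ∧ ∃ τ : ℕ → ℝ, ∃ ξ ∈ S₀,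
      Tendsto (fun k => eLpNorm (fun x : ℝ × ℝ => ζn (φ k) (x.1 - τ k, x.2) - ξ x)
        (ENNReal.ofReal p) μUH) atTop (nhds 0) ∧
      Tendsto (fun k => eLpNorm (fun x : ℝ × ℝ => ζn (φ k) (x.1 - τ k, x.2) - ξ x)
        1 μUH) atTop (nhds 0) := by
  have hp0 : (0:ℝ) < p := by linarith
  -- integrability of the data
  have h0i : Integrable ζ₀ μUH := by
    rw [← memLp_one_iff_integrable]
    refine h0p.mono_exponent_of_measure_support_ne_top (s := tsupport ζ₀)
      (fun x hx => image_eq_zero_of_notMem_tsupport hx) ?_ ?_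
    · have h1 : μUH (tsupport ζ₀) ≤ volume (tsupport ζ₀) := Measure.restrict_apply_le _ _
      exact (h1.trans_lt h0supp.isCompact.measure_lt_top).ne
    · rw [← ENNReal.ofReal_one]
      exact ENNReal.ofReal_le_ofReal (by linarith)
  have h0pt : ∫⁻ x, oR ζ₀ x ^ p ∂μUH ≠ ⊤ := by
    have h1 := h0p.2
    rw [eLpNorm_nonneg_eq h0nn hp0] at h1
    intro h
    have h2 : (∫⁻ x, ENNReal.ofReal (ζ₀ x) ^ p ∂μUH) = ⊤ := h
    rw [h2, ENNReal.top_rpow_of_pos (by positivity)] at h1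
    exact lt_irrefl _ h1
  obtain ⟨hpow, hpp⟩ := rearr_conv hp h0nn hnn h0i h0pt hint hΔp hΔ1
  -- the maximiser
  obtain ⟨ζs, hζs⟩ := hSne
  have hζs' := hζs
  rw [hSdef] at hζs'
  obtain ⟨hsW, hsmax⟩ := hζs'
  have hMs := hM₀ ζs hζs
  have hM : 0 < M₀ := by
    rw [← hMs]
    exact M_pos hp hi₀ h0nn h0i h0pt hsW (hSR ζs hζs)
  have hmax : ∀ ξ ∈ Weq ζ₀ i₀, energy ξ ≤ M₀ := fun ξ hξ => hMs ▸ hsmax ξ hξ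
  -- measurable versions
  have hver : ∀ n, ∃ f : ℝ × ℝ → ℝ, Measurable f ∧ (∀ x, 0 ≤ f x) ∧ ζn n =ᵐ[μUH] f := by
    intro n
    obtain ⟨g, hgm, hgz⟩ := (hint n).1
    refine ⟨fun x => max (g x) 0, hgm.measurable.max measurable_const,
      fun x => le_max_right _ _, ?_⟩
    filter_upwards [hgz] with x hx
    simp only [← hx, max_eq_left (hnn n x)]
  choose z hzm hz0 hzz using hver
  have hzpow : ∀ (n : ℕ) (q : ℝ), ∫⁻ x, oR (z n) x ^ q ∂μUH = ∫⁻ x, oR (ζn n) x ^ q ∂μUH := by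
    intro n q
    apply lintegral_congr_ae
    filter_upwards [hzz n] with x hx
    simp only [oR, hx]
  have hzq : ∀ q ∈ ({1, 2, p} : Set ℝ), Tendsto (fun n => ∫⁻ x, oR (z n) x ^ q ∂μUH) atTop
      (𝓝 (∫⁻ x, oR ζ₀ x ^ q ∂μUH)) := by
    intro q hq
    simp_rw [hzpow]
    exact (hpow q hq).2
  have hzpp : ∀ a > 0, Tendsto (fun n => ∫⁻ x, ENNReal.ofReal (max (z n x - a) 0) ∂μUH) atTop
      (𝓝 (∫⁻ x, ENNReal.ofReal (max (ζ₀ x - a) 0) ∂μUH)) := by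
    intro a ha
    refine (hpp a ha).congr fun n => ?_
    apply lintegral_congr_ae
    filter_upwards [hzz n] with x hx
    simp only [hx]
  have hzI : Tendsto (fun n => impulse (z n)) atTop (𝓝 i₀) :=
    hI.congr fun n => impulse_congr (hzz n)
  have hzE : Tendsto (fun n => energy (z n)) atTop (𝓝 M₀) :=
    hE.congr fun n => energy_congr (hzz n)
  have hzimp : ∀ n, ∫⁻ x, oR (z n) x * ENNReal.ofReal x.2 ∂μUH = ENNReal.ofReal (impulse (z n)) := by
    intro n
    rw [impulse_eq (hzm n) (hz0 n), ENNReal.ofReal_toReal]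
    have h1 := (himpint n).2
    refine (lt_of_le_of_lt ?_ h1).ne
    unfold HasFiniteIntegral at h1
    apply lintegral_mono_ae
    filter_upwards [hzz n, ae_UHP] with x hx hx2
    rw [hx, Real.enorm_eq_ofReal (mul_nonneg (hz0 n x) hx2.le), ENNReal.ofReal_mul (hz0 n x)]
    exact le_rfl
  -- uniform bounds along a tail
  set A := ∫⁻ x, oR ζ₀ x ^ (2:ℝ) ∂μUH + 1 with hA
  set Ap := ∫⁻ x, oR ζ₀ x ^ p ∂μUH + 1 with hAp
  set C := ∫⁻ x, oR ζ₀ x ^ (1:ℝ) ∂μUH + 1 + ENNReal.ofReal (i₀ + 1) with hC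
  have m1 : (1:ℝ) ∈ ({1, 2, p} : Set ℝ) := by simp
  have m2 : (2:ℝ) ∈ ({1, 2, p} : Set ℝ) := by simp
  have mp : p ∈ ({1, 2, p} : Set ℝ) := by simp
  have hAt : A ≠ ⊤ := ENNReal.add_ne_top.2 ⟨(hpow 2 m2).1, ENNReal.one_ne_top⟩
  have hApt : Ap ≠ ⊤ := ENNReal.add_ne_top.2 ⟨(hpow p mp).1, ENNReal.one_ne_top⟩
  have hCt : C ≠ ⊤ := ENNReal.add_ne_top.2
    ⟨ENNReal.add_ne_top.2 ⟨(hpow 1 m1).1, ENNReal.one_ne_top⟩, ENNReal.ofReal_ne_top⟩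
  have hev : ∀ q ∈ ({1, 2, p} : Set ℝ), ∀ᶠ n in atTop,
      ∫⁻ x, oR (z n) x ^ q ∂μUH ≤ ∫⁻ x, oR ζ₀ x ^ q ∂μUH + 1 := by
    intro q hq
    have hlt : ∫⁻ x, oR ζ₀ x ^ q ∂μUH < ∫⁻ x, oR ζ₀ x ^ q ∂μUH + 1 :=
      ENNReal.lt_add_right (hpow q hq).1 one_ne_zero
    exact ((hzq q hq).eventually (gt_mem_nhds hlt)).mono fun n hn => hn.le
  have hevI : ∀ᶠ n in atTop, impulse (z n) < i₀ + 1 :=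
    hzI.eventually (gt_mem_nhds (by linarith))
  obtain ⟨n₀, hn₀⟩ := eventually_atTop.1 ((hev 1 m1).and ((hev 2 m2).and ((hev p mp).and hevI)))
  obtain ⟨ω, hω, hω0, hpot⟩ := exists_omega hp hApt
  have htail : Tendsto (fun n : ℕ => n + n₀) atTop atTop := tendsto_add_atTop_nat n₀
  obtain ⟨φ, hφ, s, η, hηm, hη0, hηW, hηE, hη2, hw⟩ := core (C := C) (z := fun n => z (n + n₀))
    hp hω hω0 hAt hCt
    (le_add_right le_add_self) hi₀
    ((ENNReal.ofReal_le_ofReal (by linarith : i₀ ≤ i₀ + 1)).trans le_add_self) hM hmax h0nn h0i hpot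
    (fun n => hzm _) (fun n => hz0 _)
    (fun n => by
      have h1 := (hn₀ (n + n₀) (by omega)).1
      simp only [ENNReal.rpow_one] at h1
      refine h1.trans ?_
      simp only [hC, ENNReal.rpow_one]
      exact le_self_add)
    (fun n => by
      rw [hzimp]
      exact (ENNReal.ofReal_le_ofReal (hn₀ (n + n₀) (by omega)).2.2.2.le).trans le_add_self)
    (fun n => (hn₀ (n + n₀) (by omega)).2.1)
    (fun n => (hn₀ (n + n₀) (by omega)).2.2.1)
    (fun a ha => (hzpp a ha).comp htail) (hzI.comp htail) (hzE.comp htail)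
  have hηS : η ∈ S₀ := by
    rw [hSdef]
    exact ⟨hηW, fun ξ hξ => hηE ▸ hmax ξ hξ⟩
  have hηR := hSR η hηS
  have hηpow : ∀ q : ℝ, 0 < q → ∫⁻ x, oR η x ^ q ∂μUH = ∫⁻ x, oR ζ₀ x ^ q ∂μUH := fun q hq =>
    lintegral_pow_equi hη0 h0nn hηm.aemeasurable h0i.1.aemeasurable hηR hq
  -- the translated sequence
  set g : ℕ → ℝ × ℝ → ℝ := fun n x => z (φ n + n₀) (shift (s n) x) with hg
  have hgm : ∀ n, Measurable (g n) := fun n => (hzm _).comp (shift_emb (s n)).measurable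
  have hg0 : ∀ n x, 0 ≤ g n x := fun n x => hz0 _ _
  have hgpow : ∀ (n : ℕ) (q : ℝ), ∫⁻ x, oR (g n) x ^ q ∂μUH
      = ∫⁻ x, oR (z (φ n + n₀)) x ^ q ∂μUH := fun n q =>
    lintegral_shift (s n) (fun x => oR (z (φ n + n₀)) x ^ q)
  have hgq : ∀ q ∈ ({1, 2, p} : Set ℝ), Tendsto (fun n => ∫⁻ x, oR (g n) x ^ q ∂μUH) atTop
      (𝓝 (∫⁻ x, oR η x ^ q ∂μUH)) := by
    intro q hq
    have hq0 : 0 < q := by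
      rcases hq with h | h | h
      · rw [h]; norm_num
      · rw [h]; norm_num
      · rw [h]; exact hp0
    rw [hηpow q hq0]
    simp_rw [hgpow]
    exact (hzq q hq).comp (htail.comp hφ.tendsto_atTop)
  have hg2t : ∀ n, ∫⁻ x, oR (g n) x ^ (2:ℝ) ∂μUH ≠ ⊤ := by
    intro n
    rw [hgpow]
    exact ((hn₀ (φ n + n₀) (by omega)).2.1.trans_lt hAt.lt_top).ne
  obtain ⟨ψ, hψ, hae⟩ := ae_sub hgm hηm hg0 hη0 hg2t
    (by rw [hηpow 2 (by norm_num)]; exact (hpow 2 m2).1) (hgq 2 m2) hw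
  have hfinal : ∀ q ∈ ({1, 2, p} : Set ℝ), 1 ≤ q → Tendsto (fun k => eLpNorm
      (fun x : ℝ × ℝ => ζn (φ (ψ k) + n₀) (x.1 - -s (ψ k), x.2) - η x)
        (ENNReal.ofReal q) μUH) atTop (nhds 0) := by
    intro q hq hq1
    have h1 := strong_q (fun n => hgm (ψ n)) hηm (fun n => hg0 (ψ n)) hη0 hq1 hae
      (by rw [hηpow q (by linarith)]; exact (hpow q hq).1) ((hgq q hq).comp hψ.tendsto_atTop)
    refine h1.congr fun k => ?_
    apply eLpNorm_congr_ae
    have h2 := (shift_mp (s (ψ k))).quasiMeasurePreserving.ae_eq (hzz (φ (ψ k) + n₀))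
    filter_upwards [h2] with x hx
    have hx' : ζn (φ (ψ k) + n₀) (shift (s (ψ k)) x) = z (φ (ψ k) + n₀) (shift (s (ψ k)) x) := hx
    simp only [hg]
    rw [← hx']
    simp only [shift, sub_neg_eq_add]
  refine ⟨fun k => φ (ψ k) + n₀, fun a b hab => Nat.add_lt_add_right (hφ (hψ hab)) n₀,
    fun k => -s (ψ k), η, hηS, hfinal p mp (by linarith), ?_⟩
  have h1 := hfinal 1 m1 le_rfl
  rw [ENNReal.ofReal_one] at h1
  exact h1
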